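/- (Walfisz's bound for the Mertens function.) There exist constants c > 0 and K > 0 such that for all real t ≥ 16, |M(t)| ≤ K·t·exp(−c·(log t)^{3/5}·(log log t)^{−1/5}). -/

import Mathlib

/-- The Mertens function `M(n) = ∑_{1 ≤ k ≤ n} μ(k)`. -/
def mertens (n : ℕ) : ℤ := ∑ k ∈ Finset.Icc 1 n, ArithmeticFunction.moebius k

section
open Finset
namespace Wz

/-- The vector of powers `(x, x^2, …, x^k)`. -/
def vk (k : ℕ) (x : ℤ) : Fin k → ℤ := fun j => x ^ (j.val + 1)

/-- Weighted Vinogradov system counting function. -/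
def Wn (k s : ℕ) {ι : Type} (Z : Finset ι) (g : ι → Fin k → ℤ) (X : Finset ℤ) : ℕ :=
  #{t ∈ (Z ×ˢ Z) ×ˢ (Fintype.piFinset (fun _ : Fin s => X) ×ˢ Fintype.piFinset (fun _ : Fin s => X)) |
    g t.1.1 - g t.1.2 + (∑ i, vk k (t.2.1 i) - ∑ i, vk k (t.2.2 i)) = 0}

/-- Vinogradov system counting function. -/
def En (k s : ℕ) (X : Finset ℤ) : ℕ :=
  #{t ∈ Fintype.piFinset (fun _ : Fin s => X) ×ˢ Fintype.piFinset (fun _ : Fin s => X) |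
    ∑ i, vk k (t.1 i) - ∑ i, vk k (t.2 i) = 0}

/-- reduction mod q -/
def rdq (k q : ℕ) (v : Fin k → ℤ) : Fin k → ZMod q := fun j => (v j : ZMod q)

lemma rdq_add (k q : ℕ) (v w : Fin k → ℤ) : rdq k q (v + w) = rdq k q v + rdq k q w := by
  ext j; simp [rdq]

lemma rdq_sub (k q : ℕ) (v w : Fin k → ℤ) : rdq k q (v - w) = rdq k q v - rdq k q w := by
  ext j; simp [rdq]

lemma rdq_sum (k q : ℕ) {ι : Type*} (s : Finset ι) (v : ι → Fin k → ℤ) :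
    rdq k q (∑ i ∈ s, v i) = ∑ i ∈ s, rdq k q (v i) := by
  ext j; simp [rdq]

lemma exists_detect (k : ℕ) (S : Finset (Fin k → ℤ)) :
    ∃ q : ℕ, NeZero q ∧ ∀ v ∈ S, rdq k q v = 0 ↔ v = 0 := by
  classical
  refine ⟨∑ v ∈ S, ∑ j, (v j).natAbs + 1, ⟨by positivity⟩, fun v hv => ⟨fun h => ?_, fun h => ?_⟩⟩
  · ext j
    have h1 := congrFun h j
    simp only [rdq, Pi.zero_apply] at h1
    rw [ZMod.intCast_zmod_eq_zero_iff_dvd] at h1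
    apply Int.eq_zero_of_abs_lt_dvd h1
    have h2 : (v j).natAbs ≤ ∑ j, (v j).natAbs :=
      single_le_sum (f := fun j => (v j).natAbs) (fun _ _ => Nat.zero_le _) (mem_univ j)
    have h3 : ∑ j, (v j).natAbs ≤ ∑ v ∈ S, ∑ j, (v j).natAbs :=
      single_le_sum (f := fun v : Fin k → ℤ => ∑ j, (v j).natAbs) (fun _ _ => Nat.zero_le _) hv
    have h4 : |v j| = ((v j).natAbs : ℤ) := Int.abs_eq_natAbs _
    rw [h4]
    exact_mod_cast Nat.lt_succ_of_le (h2.trans h3)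
  · subst h; ext j; simp [rdq]

lemma count_fourier (k q : ℕ) [NeZero q] {ι : Type*} (I : Finset ι) (G : ι → Fin k → ℤ)
    (hq : ∀ i ∈ I, rdq k q (G i) = 0 ↔ G i = 0) :
    ((#{i ∈ I | G i = 0} : ℕ) : ℂ) * (q : ℂ) ^ k =
      ∑ ψ : AddChar (Fin k → ZMod q) ℂ, ∑ i ∈ I, ψ (rdq k q (G i)) := by
  classical
  rw [sum_comm, card_filter]
  push_cast
  rw [sum_mul]
  refine sum_congr rfl fun i hi => ?_
  rw [AddChar.sum_apply_eq_ite]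
  by_cases h : G i = 0
  · rw [if_pos h, if_pos ((hq i hi).2 h)]
    simp [ZMod.card]
  · rw [if_neg h, if_neg (fun h' => h ((hq i hi).1 h'))]
    simp

/-- exponential sum -/
noncomputable def fX (k q : ℕ) (X : Finset ℤ) (ψ : AddChar (Fin k → ZMod q) ℂ) : ℂ :=
  ∑ x ∈ X, ψ (rdq k q (vk k x))

lemma addchar_sum (A : Type*) [AddCommGroup A] (ψ : AddChar A ℂ) {ι : Type*} (s : Finset ι)
    (f : ι → A) : ψ (∑ i ∈ s, f i) = ∏ i ∈ s, ψ (f i) := by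
  classical
  induction s using Finset.induction_on with
  | empty => simp
  | insert a s ha ih => rw [sum_insert ha, prod_insert ha, AddChar.map_add_eq_mul, ih]

lemma sum_pi_fX (k q s : ℕ) (X : Finset ℤ) (ψ : AddChar (Fin k → ZMod q) ℂ) :
    ∑ x ∈ Fintype.piFinset (fun _ : Fin s => X), ψ (rdq k q (∑ i, vk k (x i))) = fX k q X ψ ^ s := by
  classical
  have := (Finset.prod_univ_sum (fun _ : Fin s => X) (fun _ x => ψ (rdq k q (vk k x)))).symm
  rw [prod_const, card_univ, Fintype.card_fin] at this
  rw [fX, ← this]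
  refine sum_congr rfl fun x _ => ?_
  rw [rdq_sum, addchar_sum]

lemma char_sub_norm {k q : ℕ} [NeZero q] {ι : Type*} (Z : Finset ι) (g : ι → Fin k → ℤ)
    (ψ : AddChar (Fin k → ZMod q) ℂ) :
    ∑ z ∈ Z ×ˢ Z, ψ (rdq k q (g z.1 - g z.2)) =
      ((‖∑ z ∈ Z, ψ (rdq k q (g z))‖ ^ 2 : ℝ) : ℂ) := by
  classical
  push_cast
  rw [← Complex.mul_conj', map_sum, sum_mul_sum, sum_product]
  refine sum_congr rfl fun x _ => sum_congr rfl fun y _ => ?_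
  rw [rdq_sub, sub_eq_add_neg, AddChar.map_add_eq_mul, AddChar.map_neg_eq_conj]

lemma wn_fourier (k s : ℕ) {ι : Type} (Z : Finset ι) (g : ι → Fin k → ℤ) (X : Finset ℤ) :
    ∃ q : ℕ, ∃ _ : NeZero q, ∀ X' ⊆ X, (Wn k s Z g X' : ℝ) * (q : ℝ) ^ k =
      ∑ ψ : AddChar (Fin k → ZMod q) ℂ, ‖∑ z ∈ Z, ψ (rdq k q (g z))‖ ^ 2 * ‖fX k q X' ψ‖ ^ (2 * s) := by
  classical
  obtain ⟨q, hq0, hq⟩ := exists_detect k (((Z ×ˢ Z) ×ˢ (Fintype.piFinset (fun _ : Fin s => X) ×ˢ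
    Fintype.piFinset (fun _ : Fin s => X))).image
    (fun t => g t.1.1 - g t.1.2 + (∑ i, vk k (t.2.1 i) - ∑ i, vk k (t.2.2 i))))
  refine ⟨q, hq0, fun X' hX' => ?_⟩
  have key := count_fourier k q ((Z ×ˢ Z) ×ˢ (Fintype.piFinset (fun _ : Fin s => X') ×ˢ
    Fintype.piFinset (fun _ : Fin s => X')))
    (fun t => g t.1.1 - g t.1.2 + (∑ i, vk k (t.2.1 i) - ∑ i, vk k (t.2.2 i))) (by
      intro t ht
      apply hq
      apply mem_image_of_mem
      simp only [mem_product, Fintype.mem_piFinset] at ht ⊢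
      exact ⟨ht.1, fun i => hX' (ht.2.1 i), fun i => hX' (ht.2.2 i)⟩)
  have h2 : ((Wn k s Z g X' : ℝ) * (q : ℝ) ^ k : ℝ) =
    ((∑ ψ : AddChar (Fin k → ZMod q) ℂ, ‖∑ z ∈ Z, ψ (rdq k q (g z))‖ ^ 2 * ‖fX k q X' ψ‖ ^ (2 * s) : ℝ) : ℂ) := by
    push_cast
    rw [show (Wn k s Z g X' : ℂ) * (q : ℂ) ^ k = _ from key]
    refine sum_congr rfl fun ψ _ => ?_
    rw [sum_product]
    simp only [rdq_add, AddChar.map_add_eq_mul]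
    rw [← sum_mul_sum]
    rw [char_sub_norm Z g ψ, char_sub_norm (Fintype.piFinset (fun _ : Fin s => X'))
      (fun x => ∑ i, vk k (x i)) ψ, sum_pi_fX]
    push_cast
    rw [norm_pow]
    push_cast
    ring
  exact_mod_cast h2

lemma sum_norm_pow_le {ι : Type*} (T : Finset ι) (f : ι → ℂ) (n : ℕ) :
    ‖∑ a ∈ T, f a‖ ^ (n + 1) ≤ (#T : ℝ) ^ n * ∑ a ∈ T, ‖f a‖ ^ (n + 1) := by
  rcases T.eq_empty_or_nonempty with rfl | hT
  · simp
  have h1 := pow_sum_div_card_le_sum_pow (s := T) (f := fun a => ‖f a‖) (fun _ _ => norm_nonneg _) n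
  have hc : (0 : ℝ) < (#T : ℝ) ^ n := by
    have := hT.card_pos
    positivity
  rw [div_le_iff₀ hc] at h1
  calc _ ≤ (∑ a ∈ T, ‖f a‖) ^ (n + 1) := by gcongr; exact norm_sum_le _ _
    _ ≤ _ := h1
    _ = _ := mul_comm _ _

/-- Hölder step. -/
lemma wn_holder (k s : ℕ) (hs : 0 < s) {ι κ : Type} [DecidableEq κ] (Z : Finset ι)
    (g : ι → Fin k → ℤ) (X : Finset ℤ)
    (T : Finset κ) (c : ℤ → κ) (hc : ∀ x ∈ X, c x ∈ T) (B : ℕ)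
    (hB : ∀ a ∈ T, Wn k s Z g {x ∈ X | c x = a} ≤ B) :
    Wn k s Z g X ≤ #T ^ (2 * s) * B := by
  classical
  obtain ⟨q, hq0, hq⟩ := wn_fourier k s Z g X
  have hqpos : (0 : ℝ) < (q : ℝ) ^ k := by
    have : 0 < q := Nat.pos_of_ne_zero hq0.out
    positivity
  have h1 : (Wn k s Z g X : ℝ) * (q : ℝ) ^ k ≤ ((#T : ℝ) ^ (2 * s) * B) * (q : ℝ) ^ k := by
    rw [hq X subset_rfl]
    obtain ⟨n, hn⟩ : ∃ n, 2 * s = n + 1 := ⟨2 * s - 1, by omega⟩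
    calc _ ≤ ∑ ψ : AddChar (Fin k → ZMod q) ℂ, ‖∑ z ∈ Z, ψ (rdq k q (g z))‖ ^ 2 *
        ((#T : ℝ) ^ n * ∑ a ∈ T, ‖fX k q {x ∈ X | c x = a} ψ‖ ^ (2 * s)) := by
          refine sum_le_sum fun ψ _ => ?_
          gcongr
          have : fX k q X ψ = ∑ a ∈ T, fX k q {x ∈ X | c x = a} ψ := by
            simp only [fX]
            exact (sum_fiberwise_of_maps_to hc _).symm
          rw [this, hn]
          exact sum_norm_pow_le _ _ _
      _ = (#T : ℝ) ^ n * ∑ a ∈ T, (Wn k s Z g {x ∈ X | c x = a} : ℝ) * (q : ℝ) ^ k := by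
          simp_rw [fun a => hq {x ∈ X | c x = a} (filter_subset _ _), mul_sum]
          rw [sum_comm]
          refine sum_congr rfl fun a _ => sum_congr rfl fun ψ _ => ?_
          ring
      _ ≤ (#T : ℝ) ^ n * ∑ a ∈ T, (B : ℝ) * (q : ℝ) ^ k := by
          gcongr with a ha
          exact_mod_cast hB a ha
      _ = _ := by rw [sum_const, hn, nsmul_eq_mul]; ring
  have := le_of_mul_le_mul_right h1 hqpos
  exact_mod_cast this

lemma en_eq_wn (k s : ℕ) (X : Finset ℤ) : En k s X = Wn k s ({()} : Finset Unit) (fun _ => 0) X := by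
  classical
  unfold En Wn
  apply card_bij' (fun t _ => (((), ()), t)) (fun t _ => t.2)
  all_goals simp

lemma max_zero_aux {k s q : ℕ} [NeZero q] (X : Finset ℤ) (h : Fin k → ℤ) {ι : Type*} (I : Finset ι)
    (Φ : ι → Fin k → ℤ) (hq1 : ∀ i ∈ I, rdq k q (h + Φ i) = 0 ↔ h + Φ i = 0)
    (hq2 : ∀ i ∈ I, rdq k q (Φ i) = 0 ↔ Φ i = 0)
    (f1 : ∀ ψ : AddChar (Fin k → ZMod q) ℂ, ∑ t ∈ I, ψ (rdq k q (Φ t)) =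
      ((‖fX k q X ψ ^ s‖ ^ 2 : ℝ) : ℂ)) :
    #{t ∈ I | h + Φ t = 0} ≤ #{t ∈ I | Φ t = 0} := by
  have e1 := count_fourier k q I (fun t => h + Φ t) hq1
  have e2 := count_fourier k q I Φ hq2
  have hqpos : (0 : ℝ) < (q : ℝ) ^ k := by
    have : 0 < q := Nat.pos_of_ne_zero (NeZero.ne q)
    positivity
  have e1a : ∀ ψ : AddChar (Fin k → ZMod q) ℂ,
      ∑ t ∈ I, ψ (rdq k q (h + Φ t)) = ψ (rdq k q h) * ((‖fX k q X ψ ^ s‖ ^ 2 : ℝ) : ℂ) := by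
    intro ψ
    rw [← f1, mul_sum]
    refine sum_congr rfl fun t _ => ?_
    rw [rdq_add, AddChar.map_add_eq_mul]
  rw [sum_congr rfl (fun ψ _ => e1a ψ)] at e1
  rw [sum_congr rfl (fun ψ _ => f1 ψ)] at e2
  have e2' : ((#{t ∈ I | Φ t = 0} : ℕ) : ℝ) * (q : ℝ) ^ k =
      ∑ ψ : AddChar (Fin k → ZMod q) ℂ, ‖fX k q X ψ ^ s‖ ^ 2 := by
    exact_mod_cast e2
  have e3 := congrArg norm e1
  have hle : ((#{t ∈ I | h + Φ t = 0} : ℕ) : ℝ) * (q : ℝ) ^ k ≤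
      ((#{t ∈ I | Φ t = 0} : ℕ) : ℝ) * (q : ℝ) ^ k := by
    rw [e2']
    rw [norm_mul, Complex.norm_natCast, norm_pow, Complex.norm_natCast] at e3
    rw [e3]
    refine (norm_sum_le _ _).trans (sum_le_sum fun ψ _ => ?_)
    rw [norm_mul, AddChar.norm_apply, one_mul, Complex.norm_real, Real.norm_of_nonneg (by positivity)]
  exact_mod_cast le_of_mul_le_mul_right hle hqpos

lemma max_zero (k s : ℕ) (X : Finset ℤ) (h : Fin k → ℤ) :
    #{t ∈ Fintype.piFinset (fun _ : Fin s => X) ×ˢ Fintype.piFinset (fun _ : Fin s => X) |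
      h + (∑ i, vk k (t.1 i) - ∑ i, vk k (t.2 i)) = 0} ≤ En k s X := by
  obtain ⟨I, hI⟩ : ∃ I, I = Fintype.piFinset (fun _ : Fin s => X) ×ˢ
    Fintype.piFinset (fun _ : Fin s => X) := ⟨_, rfl⟩
  obtain ⟨Φ, hΦ⟩ : ∃ Φ : (Fin s → ℤ) × (Fin s → ℤ) → Fin k → ℤ,
    Φ = fun t => ∑ i, vk k (t.1 i) - ∑ i, vk k (t.2 i) := ⟨_, rfl⟩
  obtain ⟨q, hq0, hq⟩ := exists_detect k ((I.image (fun t => h + Φ t)) ∪ (I.image Φ))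
  have := max_zero_aux (q := q) (s := s) X h I Φ
    (fun t ht => hq _ (mem_union_left _ (mem_image.2 ⟨t, ht, rfl⟩)))
    (fun t ht => hq _ (mem_union_right _ (mem_image.2 ⟨t, ht, rfl⟩))) (by
    intro ψ
    rw [hI, hΦ, char_sub_norm (Fintype.piFinset (fun _ : Fin s => X)) (fun x => ∑ i, vk k (x i)) ψ,
      sum_pi_fX])
  rw [hI, hΦ] at this
  exact this

end Wz
end

section
open Finset
namespace Wz

lemma newton_esymm {R : Type*} [CommRing R] {k : ℕ} (x y : Fin k → R)
    (hk : ∀ m : ℕ, 1 ≤ m → m ≤ k → IsUnit (m : R))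
    (h : ∀ m : ℕ, 1 ≤ m → m ≤ k → ∑ i, x i ^ m = ∑ i, y i ^ m) (n : ℕ) (hn : n ≤ k) :
    MvPolynomial.aeval x (MvPolynomial.esymm (Fin k) ℤ n) =
      MvPolynomial.aeval y (MvPolynomial.esymm (Fin k) ℤ n) := by
  induction n using Nat.strong_induction_on with
  | _ n ih =>
    rcases Nat.eq_zero_or_pos n with rfl | hpos
    · simp
    have h1 := congrArg (MvPolynomial.aeval x) (MvPolynomial.mul_esymm_eq_sum (Fin k) ℤ n)
    have h2 := congrArg (MvPolynomial.aeval y) (MvPolynomial.mul_esymm_eq_sum (Fin k) ℤ n)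
    simp only [map_mul, map_sum, map_pow, map_neg, map_one, map_natCast] at h1 h2
    apply (hk n hpos hn).mul_left_cancel
    rw [h1, h2]
    congr 1
    refine sum_congr rfl fun a ha => ?_
    simp only [mem_filter, HasAntidiagonal.mem_antidiagonal] at ha
    rw [ih a.1 ha.2 (by omega)]
    congr 1
    simp only [MvPolynomial.psum, map_sum, map_pow, MvPolynomial.aeval_X]
    exact h a.2 (by omega) (by omega)

lemma newton_prod {R : Type*} [CommRing R] {k : ℕ} (x y : Fin k → R)
    (hk : ∀ m : ℕ, 1 ≤ m → m ≤ k → IsUnit (m : R))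
    (h : ∀ m : ℕ, 1 ≤ m → m ≤ k → ∑ i, x i ^ m = ∑ i, y i ^ m) (r : R) :
    ∏ i, (r - x i) = ∏ i, (r - y i) := by
  have key : ∀ z : Fin k → R, ∏ i, (r - z i) = ∑ j ∈ range (k + 1), (-1) ^ j *
      (MvPolynomial.aeval z (MvPolynomial.esymm (Fin k) ℤ j) * r ^ (k - j)) := by
    intro z
    have h1 := Multiset.prod_X_sub_X_eq_sum_esymm (Multiset.map z (univ : Finset (Fin k)).val)
    have h2 := congrArg (Polynomial.eval r) h1
    simp only [Multiset.map_map, Function.comp_def, Multiset.card_map] at h2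
    rw [show (Multiset.map (fun x => Polynomial.X - Polynomial.C (z x)) univ.val).prod =
      ∏ i, (Polynomial.X - Polynomial.C (z i)) from rfl] at h2
    rw [Polynomial.eval_prod] at h2
    simp only [Polynomial.eval_sub, Polynomial.eval_X, Polynomial.eval_C, Polynomial.eval_finsetSum,
      Polynomial.eval_mul, Polynomial.eval_pow, Polynomial.eval_neg, Polynomial.eval_one] at h2
    rw [h2]
    simp [MvPolynomial.aeval_esymm_eq_multiset_esymm]
  rw [key x, key y]
  refine sum_congr rfl fun j hj => ?_
  rw [newton_esymm x y hk h j (by simpa [Nat.lt_succ_iff] using hj)]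

lemma linnik_fibre {p k : ℕ} (hp : p.Prime) (hkp : k < p) (x y : Fin k → ℤ)
    (hx : ∀ i j, (p : ℤ) ∣ x i - x j → i = j)
    (h : ∀ m : ℕ, 1 ≤ m → m ≤ k → ((p : ℤ) ^ k) ∣ ∑ i, x i ^ m - ∑ i, y i ^ m) (j : Fin k) :
    ∃ i, ((p : ℤ) ^ k) ∣ y j - x i := by
  have hpz : Prime (p : ℤ) := Nat.prime_iff_prime_int.1 hp
  have h1 := newton_prod (R := ZMod (p ^ k)) (fun i => (x i : ZMod (p ^ k))) (fun i => (y i : ZMod (p ^ k)))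
    (by
      intro m hm1 hm2
      rw [ZMod.isUnit_iff_coprime]
      apply Nat.Coprime.pow_right
      exact (Nat.coprime_of_lt_prime (by omega) (by omega) hp).symm)
    (by
      intro m hm1 hm2
      have := h m hm1 hm2
      have h3 : (((∑ i, x i ^ m - ∑ i, y i ^ m : ℤ)) : ZMod (p ^ k)) = 0 := by
        rw [ZMod.intCast_zmod_eq_zero_iff_dvd]
        exact_mod_cast this
      push_cast at h3
      exact sub_eq_zero.1 h3) (y j)
  rw [prod_eq_zero (i := j) (f := fun i => (y j : ZMod (p ^ k)) - y i) (mem_univ j) (by simp)] at h1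
  have h2 : ((p : ℤ) ^ k) ∣ ∏ i, (y j - x i) := by
    have : ((∏ i, (y j - x i) : ℤ) : ZMod (p ^ k)) = 0 := by push_cast; exact h1
    rw [ZMod.intCast_zmod_eq_zero_iff_dvd] at this
    exact_mod_cast this
  have h3 : (p : ℤ) ∣ ∏ i, (y j - x i) :=
    (dvd_pow_self _ (by have := j.2; omega)).trans h2
  obtain ⟨i0, _, hi0⟩ := (Prime.dvd_finsetProd_iff hpz _).1 h3
  refine ⟨i0, ?_⟩
  rw [← mul_prod_erase univ _ (mem_univ i0)] at h2
  refine IsCoprime.dvd_of_dvd_mul_right ?_ h2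
  apply IsCoprime.pow_left
  rw [Prime.coprime_iff_not_dvd hpz]
  intro h4
  obtain ⟨i1, hi1, hd⟩ := (Prime.dvd_finsetProd_iff hpz _).1 h4
  have : i0 = i1 := hx i0 i1 (by
    have := dvd_sub hd hi0
    simpa using this)
  exact (mem_erase.1 hi1).1 this.symm

/-- well-conditioned tuples -/
noncomputable def Zc (k N p : ℕ) : Finset (Fin k → ℤ) :=
  {w ∈ Fintype.piFinset (fun _ : Fin k => Icc (1 : ℤ) N) | ∀ i j, (p : ℤ) ∣ w i - w j → i = j}

lemma prod_pow_aux (p k : ℕ) : ∏ j : Fin k, p ^ (k - 1 - j.val) = p ^ (k * (k - 1) / 2) := by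
  rw [prod_pow_eq_pow_sum, Fin.sum_univ_eq_sum_range (fun j => k - 1 - j) k,
    sum_range_reflect (fun j => j) k, sum_range_id]

lemma linnik_count {p k N : ℕ} (hp : p.Prime) (hkp : k < p) (hN : N ≤ p ^ k) (a : ℤ) (z : Fin k → ℤ) :
    #{w ∈ Zc k N p | ∀ j : Fin k, ((p : ℤ) ^ (j.val + 1)) ∣
      ∑ i, (w i - a) ^ (j.val + 1) - ∑ i, (z i - a) ^ (j.val + 1)} ≤ p ^ (k * (k - 1) / 2) * k ^ k := by
  classical
  have hp0 : 0 < p := hp.pos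
  let F : (Fin k → ℤ) → (Fin k → ℤ) := fun w j =>
    ((∑ i, (w i - a) ^ (j.val + 1) - ∑ i, (z i - a) ^ (j.val + 1)) / (p : ℤ) ^ (j.val + 1)) %
      (p : ℤ) ^ (k - 1 - j.val)
  let T : Finset (Fin k → ℤ) := Fintype.piFinset fun j : Fin k => Ico (0 : ℤ) ((p : ℤ) ^ (k - 1 - j.val))
  have hT : #T = p ^ (k * (k - 1) / 2) := by
    rw [Fintype.card_piFinset]
    rw [← prod_pow_aux]
    refine prod_congr rfl fun j _ => ?_
    rw [Int.card_Ico, sub_zero, ← Nat.cast_pow, Int.toNat_natCast]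
  rw [← hT, mul_comm]
  refine card_le_mul_card_image_of_maps_to (f := F) ?_ _ ?_
  · intro w _
    simp only [T, F, Fintype.mem_piFinset, mem_Ico]
    intro j
    exact ⟨Int.emod_nonneg _ (by positivity), Int.emod_lt_of_pos _ (by positivity)⟩
  · intro b _
    rcases Finset.eq_empty_or_nonempty (filter (fun w => F w = b) (filter (fun w => ∀ j : Fin k,
      ((p : ℤ) ^ (j.val + 1)) ∣ ∑ i, (w i - a) ^ (j.val + 1) - ∑ i, (z i - a) ^ (j.val + 1)) (Zc k N p)))
      with he | ⟨w0, hw0⟩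
    · rw [he]; simp
    rw [mem_filter, mem_filter] at hw0
    calc _ ≤ #((univ : Finset (Fin k → Fin k)).image (fun τ => w0 ∘ τ)) := by
          apply card_le_card
          intro w hw
          rw [mem_filter, mem_filter] at hw
          simp only [Zc, mem_filter, Fintype.mem_piFinset, mem_Icc] at hw hw0
          have hdiv : ∀ m : ℕ, 1 ≤ m → m ≤ k → ((p : ℤ) ^ k) ∣ ∑ i, (w0 i - a) ^ m - ∑ i, (w i - a) ^ m := by
            intro m hm1 hm2
            obtain ⟨j, hj⟩ : ∃ j : Fin k, m = j.val + 1 := ⟨⟨m - 1, by omega⟩, by simp; omega⟩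
            subst hj
            have e1 : F w0 j = F w j := by rw [hw0.2, hw.2]
            simp only [F] at e1
            obtain ⟨u0, hu0⟩ := hw0.1.2 j
            obtain ⟨u, hu⟩ := hw.1.2 j
            have hpp : ((p : ℤ) ^ (j.val + 1)) ≠ 0 := by positivity
            rw [hu0, hu, Int.mul_ediv_cancel_left _ hpp, Int.mul_ediv_cancel_left _ hpp] at e1
            have e2 : (p : ℤ) ^ (k - 1 - j.val) ∣ u0 - u := Int.dvd_of_emod_eq_zero (Int.emod_eq_emod_iff_emod_sub_eq_zero.1 e1)
            have e3 : ∑ i, (w0 i - a) ^ (j.val + 1) - ∑ i, (w i - a) ^ (j.val + 1) =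
              (p : ℤ) ^ (j.val + 1) * (u0 - u) := by linear_combination hu0 - hu
            have e4 : (p : ℤ) ^ k = (p : ℤ) ^ (j.val + 1) * (p : ℤ) ^ (k - 1 - j.val) := by
              rw [← pow_add]; congr 1; omega
            rw [e3, e4]
            exact mul_dvd_mul_left _ e2
          have hex : ∀ j, ∃ i, w j = w0 i := by
            intro j
            obtain ⟨i, hi⟩ := linnik_fibre hp hkp (fun i => w0 i - a) (fun i => w i - a)
              (fun i j h => hw0.1.1.2 i j (by simpa using h)) hdiv j
            refine ⟨i, ?_⟩
            have h1 : ((p : ℤ) ^ k) ∣ w j - w0 i := by simpa using hi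
            have h2 := Int.eq_zero_of_abs_lt_dvd h1 (by
              have a1 := hw.1.1.1 j
              have a2 := hw0.1.1.1 i
              have a3 : (N : ℤ) ≤ (p : ℤ) ^ k := by exact_mod_cast hN
              rw [abs_lt]; constructor <;> linarith)
            linarith
          choose τ hτ using hex
          exact mem_image.2 ⟨τ, mem_univ _, by ext j; simp [hτ]⟩
      _ ≤ #(univ : Finset (Fin k → Fin k)) := card_image_le
      _ = k ^ k := by simp
end Wz
end

section
open Finset
namespace Wz

/-- The interval `[1,N]` of integers. -/
noncomputable def IN (N : ℕ) : Finset ℤ := Icc (1 : ℤ) N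

/-- shift invariance -/
lemma shift_inv {k s r : ℕ} (x y : Fin s → ℤ) (z w : Fin r → ℤ) (b : ℤ)
    (h : ∑ i, vk k (z i) - ∑ i, vk k (w i) + (∑ i, vk k (x i) - ∑ i, vk k (y i)) = 0)
    (m : ℕ) (hm : m ≤ k) :
    ∑ i, (z i + b) ^ m - ∑ i, (w i + b) ^ m + (∑ i, (x i + b) ^ m - ∑ i, (y i + b) ^ m) = 0 := by
  have h0 : ∀ j ≤ k, ∑ i, (z i) ^ j - ∑ i, (w i) ^ j + (∑ i, (x i) ^ j - ∑ i, (y i) ^ j) = 0 := by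
    intro j hj
    rcases Nat.eq_zero_or_pos j with rfl | hpos
    · simp
    have := congrFun h ⟨j - 1, by omega⟩
    simp only [Pi.add_apply, Pi.sub_apply, Finset.sum_apply, vk, Pi.zero_apply] at this
    rwa [Nat.sub_add_cancel hpos] at this
  have e : ∀ {n : ℕ} (u : Fin n → ℤ), ∑ i, (u i + b) ^ m =
      ∑ j ∈ range (m + 1), (∑ i, u i ^ j) * (b ^ (m - j) * (m.choose j : ℤ)) := by
    intro n u
    simp_rw [add_pow, sum_mul]
    rw [sum_comm]
    refine sum_congr rfl fun j _ => sum_congr rfl fun i _ => ?_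
    ring
  rw [e, e, e, e, ← sum_sub_distrib, ← sum_sub_distrib, ← sum_add_distrib]
  refine sum_eq_zero fun j hj => ?_
  have := h0 j (by simp at hj; omega)
  linear_combination (b ^ (m - j) * (m.choose j : ℤ)) * this

lemma en_mono (k s : ℕ) {X Y : Finset ℤ} (h : X ⊆ Y) : En k s X ≤ En k s Y := by
  unfold En
  apply card_le_card
  intro t ht
  simp only [mem_filter, mem_product, Fintype.mem_piFinset] at ht ⊢
  exact ⟨⟨fun i => h (ht.1.1 i), fun i => h (ht.1.2 i)⟩, ht.2⟩

/-- residue class -/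
noncomputable def Xa (N p : ℕ) (a : ℤ) : Finset ℤ := {x ∈ IN N | x % (p : ℤ) = a}

lemma xa_spec {N p : ℕ} (hp : 0 < p) {a x : ℤ} (hx : x ∈ Xa N p a) :
    x + (p - a) = p * ((x - a) / p + 1) ∧ (x - a) / p + 1 ∈ IN (N / p + 1) := by
  simp only [Xa, IN, mem_filter, mem_Icc] at hx ⊢
  obtain ⟨⟨h1, h2⟩, h3⟩ := hx
  have hp' : (0 : ℤ) < p := by exact_mod_cast hp
  have ha : x - a = p * (x / p) := by have := Int.mul_ediv_add_emod x p; linarith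
  have hq : (x - a) / p = x / p := by rw [ha, Int.mul_ediv_cancel_left _ hp'.ne']
  refine ⟨?_, ?_, ?_⟩
  · rw [hq]; linear_combination ha
  · rw [hq]
    have : 0 ≤ x / (p : ℤ) := Int.ediv_nonneg (by linarith) hp'.le
    linarith
  · rw [hq]
    push_cast
    have : x / (p : ℤ) ≤ (N : ℤ) / p := Int.ediv_le_ediv hp' h2
    linarith

/-- for fixed `z,w`, count of the solutions in a residue class -/
lemma class_count {k s r N p : ℕ} (hp : 0 < p) (a : ℤ) (z w : Fin r → ℤ) :
    #{t ∈ Fintype.piFinset (fun _ : Fin s => Xa N p a) ×ˢ Fintype.piFinset (fun _ : Fin s => Xa N p a) |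
      (∑ i, vk k (z i) - ∑ i, vk k (w i)) + (∑ i, vk k (t.1 i) - ∑ i, vk k (t.2 i)) = 0} ≤
      if (∀ j : Fin k, ((p : ℤ) ^ (j.val + 1)) ∣
      ∑ i, (w i - (a - p)) ^ (j.val + 1) - ∑ i, (z i - (a - p)) ^ (j.val + 1)) then
      En k s (IN (N / p + 1)) else 0 := by
  have hp' : (p : ℤ) ≠ 0 := by exact_mod_cast hp.ne'
  have main : ∀ x y : Fin s → ℤ, (∀ i, x i ∈ Xa N p a) → (∀ i, y i ∈ Xa N p a) →
      (∑ i, vk k (z i) - ∑ i, vk k (w i)) + (∑ i, vk k (x i) - ∑ i, vk k (y i)) = 0 →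
      ∀ j : Fin k, ∑ i, (w i - (a - p)) ^ (j.val + 1) - ∑ i, (z i - (a - p)) ^ (j.val + 1) =
      (p : ℤ) ^ (j.val + 1) * (∑ i, ((x i - a) / p + 1) ^ (j.val + 1) -
        ∑ i, ((y i - a) / p + 1) ^ (j.val + 1)) := by
    intro x y hx hy h j
    have h1 := shift_inv x y z w (p - a) h (j.val + 1) (by omega)
    have ex : ∑ i, (x i + (p - a)) ^ (j.val + 1) =
        (p : ℤ) ^ (j.val + 1) * ∑ i, ((x i - a) / p + 1) ^ (j.val + 1) := by
      rw [mul_sum]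
      refine sum_congr rfl fun i _ => ?_
      rw [(xa_spec hp (hx i)).1, mul_pow]
    have ey : ∑ i, (y i + (p - a)) ^ (j.val + 1) =
        (p : ℤ) ^ (j.val + 1) * ∑ i, ((y i - a) / p + 1) ^ (j.val + 1) := by
      rw [mul_sum]
      refine sum_congr rfl fun i _ => ?_
      rw [(xa_spec hp (hy i)).1, mul_pow]
    rw [ex, ey] at h1
    simp only [sub_sub_eq_add_sub, add_sub_assoc] at h1 ⊢
    linear_combination -h1
  split_ifs with hd
  · obtain ⟨h, hh⟩ : ∃ h : Fin k → ℤ, ∀ j : Fin k, ∑ i, (w i - (a - p)) ^ (j.val + 1) -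
      ∑ i, (z i - (a - p)) ^ (j.val + 1) = (p : ℤ) ^ (j.val + 1) * h j := ⟨fun j => (hd j).choose,
        fun j => (hd j).choose_spec⟩
    refine le_trans ?_ (max_zero k s (IN (N / p + 1)) (-h))
    apply card_le_card_of_injOn (fun t => (fun i => (t.1 i - a) / p + 1, fun i => (t.2 i - a) / p + 1))
    · intro t ht
      simp only [mem_filter, mem_product, Fintype.mem_piFinset, coe_filter, Set.mem_setOf_eq] at ht ⊢
      refine ⟨⟨fun i => (xa_spec hp (ht.1.1 i)).2, fun i => (xa_spec hp (ht.1.2 i)).2⟩, ?_⟩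
      ext j
      have h1 := main t.1 t.2 ht.1.1 ht.1.2 ht.2 j
      rw [hh j] at h1
      have h2 := mul_left_cancel₀ (pow_ne_zero _ hp') h1
      simp only [Pi.add_apply, Pi.neg_apply, Pi.sub_apply, Finset.sum_apply, vk, Pi.zero_apply]
      rw [h2]; ring
    · intro t ht t' ht' he
      simp only [mem_filter, mem_product, Fintype.mem_piFinset, coe_filter, Set.mem_setOf_eq] at ht ht'
      simp only [Prod.mk.injEq] at he
      have inj : ∀ x x' : ℤ, x ∈ Xa N p a → x' ∈ Xa N p a → (x - a) / p + 1 = (x' - a) / p + 1 → x = x' := by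
        intro x x' hx hx' hxx
        have a1 := (xa_spec hp hx).1
        have a2 := (xa_spec hp hx').1
        rw [hxx, ← a2] at a1
        linarith
      ext i
      · exact inj _ _ (ht.1.1 i) (ht'.1.1 i) (congrFun he.1 i)
      · exact inj _ _ (ht.1.2 i) (ht'.1.2 i) (congrFun he.2 i)
  · rw [Nat.le_zero, card_eq_zero, filter_eq_empty_iff]
    intro t ht h
    simp only [mem_product, Fintype.mem_piFinset] at ht
    exact hd fun j => ⟨_, main t.1 t.2 ht.1 ht.2 h j⟩

lemma en_class {k s N p : ℕ} (hp : 0 < p) (a : ℤ) :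
    En k s (Xa N p a) ≤ En k s (IN (N / p + 1)) := by
  have h := class_count (k := k) (s := s) (N := N) hp a (fun _ : Fin 0 => 0) (fun _ => 0)
  simp only [univ_eq_empty, sum_empty, sub_zero, zero_add, dvd_zero, implies_true, if_true] at h
  exact h

lemma wn_class {k s N p : ℕ} (hp : p.Prime) (hkp : k < p) (hN : N ≤ p ^ k) (a : ℤ) :
    Wn k s (Zc k N p) (fun z => ∑ i, vk k (z i)) (Xa N p a) ≤
      N ^ k * (p ^ (k * (k - 1) / 2) * k ^ k * En k s (IN (N / p + 1))) := by
  unfold Wn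
  rw [card_filter, sum_product, sum_product]
  have hZ : #(Zc k N p) ≤ N ^ k := by
    refine (card_filter_le _ _).trans ?_
    simp [Fintype.card_piFinset]
  calc _ ≤ ∑ z ∈ Zc k N p, ∑ w ∈ Zc k N p, (if (∀ j : Fin k, ((p : ℤ) ^ (j.val + 1)) ∣
      ∑ i, (w i - (a - p)) ^ (j.val + 1) - ∑ i, (z i - (a - p)) ^ (j.val + 1)) then
      En k s (IN (N / p + 1)) else 0) := by
        refine sum_le_sum fun z _ => sum_le_sum fun w _ => ?_
        rw [← card_filter]
        exact class_count hp.pos a z w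
    _ ≤ ∑ z ∈ Zc k N p, (p ^ (k * (k - 1) / 2) * k ^ k * En k s (IN (N / p + 1))) := by
        refine sum_le_sum fun z _ => ?_
        rw [← sum_filter, sum_const, smul_eq_mul]
        gcongr
        exact linnik_count hp hkp hN (a - p) z
    _ ≤ _ := by
        rw [sum_const, smul_eq_mul]
        gcongr

lemma wn_bound {k s N p : ℕ} (hs : 0 < s) (hp : p.Prime) (hkp : k < p) (hN : N ≤ p ^ k) :
    Wn k s (Zc k N p) (fun z => ∑ i, vk k (z i)) (IN N) ≤
      p ^ (2 * s) * (N ^ k * (p ^ (k * (k - 1) / 2) * k ^ k * En k s (IN (N / p + 1)))) := by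
  have hp' : (0 : ℤ) < p := by exact_mod_cast hp.pos
  have := wn_holder k s hs (Zc k N p) (fun z => ∑ i, vk k (z i)) (IN N) (Ico (0 : ℤ) p)
    (fun x => x % (p : ℤ)) (fun x _ => by
      rw [mem_Ico]; exact ⟨Int.emod_nonneg _ hp'.ne', Int.emod_lt_of_pos _ hp'⟩) _
    (fun a _ => wn_class hp hkp hN a)
  simpa using this

lemma en_bound {k s N p : ℕ} (hs : 0 < s) (hp : 0 < p) (T : Finset ℤ) :
    En k s {x ∈ IN N | x % (p : ℤ) ∈ T} ≤ #T ^ (2 * s) * En k s (IN (N / p + 1)) := by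
  rw [en_eq_wn]
  refine wn_holder k s hs _ _ _ T (fun x => x % (p : ℤ)) (fun x hx => (mem_filter.1 hx).2) _ ?_
  intro a _
  rw [← en_eq_wn]
  refine (en_mono k s ?_).trans (en_class hp a)
  intro x hx
  simp only [mem_filter, Xa] at hx ⊢
  exact ⟨hx.1.1, hx.2⟩

/-- energy -/
def Eg {ι : Type*} {V : Type*} [DecidableEq V] (S : Finset ι) (Φ : ι → V) : ℕ :=
  #{t ∈ S ×ˢ S | Φ t.1 = Φ t.2}

lemma eg_eq {ι V : Type*} [DecidableEq V] (S : Finset ι) (Φ : ι → V) (U : Finset V)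
    (hU : ∀ x ∈ S, Φ x ∈ U) : Eg S Φ = ∑ v ∈ U, #{x ∈ S | Φ x = v} ^ 2 := by
  classical
  unfold Eg
  rw [card_eq_sum_card_fiberwise (f := fun t => Φ t.1) (t := U)
    (fun t ht => by
      simp only [coe_filter, mem_product, Set.mem_setOf_eq] at ht
      exact hU _ ht.1.1)]
  refine sum_congr rfl fun v _ => ?_
  rw [sq, ← card_product]
  congr 1
  ext t
  simp only [mem_filter, mem_product]
  constructor
  · rintro ⟨⟨⟨h1, h2⟩, h3⟩, h4⟩
    exact ⟨⟨h1, h4⟩, h2, h3 ▸ h4⟩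
  · rintro ⟨⟨h1, h4⟩, h2, h3⟩
    exact ⟨⟨⟨h1, h2⟩, h4.trans h3.symm⟩, h4⟩

lemma eg_cover {ι V κ : Type*} [DecidableEq V] (S : Finset ι) (Φ : ι → V) (C : Finset κ)
    (Sc : κ → Finset ι) (hc : ∀ x ∈ S, ∃ c ∈ C, x ∈ Sc c) :
    Eg S Φ ≤ #C * ∑ c ∈ C, Eg (Sc c) Φ := by
  classical
  let U : Finset V := S.image Φ ∪ C.biUnion fun c => (Sc c).image Φ
  rw [eg_eq S Φ U (fun x hx => mem_union_left _ (mem_image_of_mem _ hx))]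
  have e : ∀ c ∈ C, Eg (Sc c) Φ = ∑ v ∈ U, #{x ∈ Sc c | Φ x = v} ^ 2 := fun c hcC =>
    eg_eq _ _ _ (fun x hx => mem_union_right _ (mem_biUnion.2 ⟨c, hcC, mem_image_of_mem _ hx⟩))
  rw [sum_congr rfl e, sum_comm, mul_sum]
  refine sum_le_sum fun v _ => ?_
  calc _ ≤ (∑ c ∈ C, #{x ∈ Sc c | Φ x = v}) ^ 2 := by
        gcongr
        refine le_trans (card_le_card ?_) card_biUnion_le
        intro x hx
        simp only [mem_filter, mem_biUnion] at hx ⊢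
        obtain ⟨c, hcC, hxc⟩ := hc x hx.1
        exact ⟨c, hcC, hxc, hx.2⟩
    _ ≤ _ := sq_sum_le_card_mul_sum_sq

lemma en_eq_eg (k s : ℕ) (X : Finset ℤ) :
    En k s X = Eg (Fintype.piFinset (fun _ : Fin s => X)) (fun x => ∑ i, vk k (x i)) := by
  unfold En Eg
  congr 1
  ext t
  simp only [mem_filter, sub_eq_zero]

lemma split_equiv {k s : ℕ} (σ : Fin k → Fin (s + k)) (hσ : Function.Injective σ) :
    ∃ e : Fin k ⊕ Fin s ≃ Fin (s + k), ∀ i, e (Sum.inl i) = σ i := by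
  classical
  have hcard : Fintype.card ((Set.range σ)ᶜ : Set (Fin (s + k))) = s := by
    rw [Fintype.card_compl_set, Set.card_range_of_injective hσ]; simp
  refine ⟨(Equiv.sumCongr (Equiv.ofInjective σ hσ) (Fintype.equivFinOfCardEq hcard).symm).trans
    (Equiv.Set.sumCompl (Set.range σ)), fun i => by simp⟩

lemma eg_sigma {k s N p : ℕ} (σ : Fin k → Fin (s + k)) (hσ : Function.Injective σ) :
    Eg {x ∈ Fintype.piFinset (fun _ : Fin (s + k) => IN N) |
      ∀ i j, (p : ℤ) ∣ x (σ i) - x (σ j) → i = j} (fun x => ∑ i, vk k (x i)) ≤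
    Wn k s (Zc k N p) (fun z => ∑ i, vk k (z i)) (IN N) := by
  classical
  obtain ⟨e, he⟩ := split_equiv σ hσ
  have hsum : ∀ x : Fin (s + k) → ℤ, ∑ i, vk k (x i) =
      ∑ i, vk k (x (σ i)) + ∑ i, vk k (x (e (Sum.inr i))) := by
    intro x
    rw [← e.sum_comp, Fintype.sum_sum_type]
    simp [he]
  unfold Eg Wn
  apply card_le_card_of_injOn (fun t => ((fun i => t.1 (σ i), fun i => t.2 (σ i)),
    (fun i => t.1 (e (Sum.inr i)), fun i => t.2 (e (Sum.inr i)))))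
  · intro t ht
    simp only [mem_filter, mem_product, Fintype.mem_piFinset, coe_filter, Set.mem_setOf_eq, Zc] at ht ⊢
    obtain ⟨⟨⟨h1, h2⟩, h3, h4⟩, h5⟩ := ht
    refine ⟨⟨⟨⟨fun i => h1 _, h2⟩, fun i => h3 _, h4⟩, fun i => h1 _, fun i => h3 _⟩, ?_⟩
    rw [hsum, hsum] at h5
    rw [← sub_eq_zero] at h5
    rw [← h5]; abel
  · intro t _ t' _ hh
    simp only [Prod.mk.injEq] at hh
    have inj : ∀ x x' : Fin (s + k) → ℤ, (fun i => x (σ i)) = (fun i => x' (σ i)) →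
        (fun i => x (e (Sum.inr i))) = (fun i => x' (e (Sum.inr i))) → x = x' := by
      intro x x' h1 h2
      ext i
      obtain ⟨i, rfl⟩ := e.surjective i
      rcases i with i | i
      · rw [he]; exact congrFun h1 i
      · exact congrFun h2 i
    exact Prod.ext (inj _ _ hh.1.1 hh.2.1) (inj _ _ hh.1.2 hh.2.2)

/-- main recurrence -/
lemma en_rec {k s N p : ℕ} (hk : 1 ≤ k) (hs : 0 < s) (hp : p.Prime) (hkp : k < p) (hN : N ≤ p ^ k) :
    En k (s + k) (IN N) ≤ 2 * (p ^ (2 * (k - 1)) * (k ^ (2 * (s + k)) * En k (s + k) (IN (N / p + 1)))) +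
      2 * ((s + k) ^ (2 * k) * (p ^ (2 * s) * (N ^ k * (p ^ (k * (k - 1) / 2) * k ^ k *
        En k s (IN (N / p + 1)))))) := by
  classical
  have hp' : (0 : ℤ) < p := by exact_mod_cast hp.pos
  let S := Fintype.piFinset (fun _ : Fin (s + k) => IN N)
  let Φ : (Fin (s + k) → ℤ) → Fin k → ℤ := fun x => ∑ i, vk k (x i)
  let R : (Fin (s + k) → ℤ) → Finset ℤ := fun x => univ.image (fun i => x i % (p : ℤ))
  let Sc : Bool → Finset (Fin (s + k) → ℤ) := fun b =>
    if b then {x ∈ S | #(R x) ≤ k - 1} else {x ∈ S | k ≤ #(R x)}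
  have h1 : Eg S Φ ≤ 2 * ∑ c : Bool, Eg (Sc c) Φ := by
    have := eg_cover S Φ (univ : Finset Bool) Sc (by
      intro x hx
      by_cases h : #(R x) ≤ k - 1
      · exact ⟨true, mem_univ _, by simp [Sc, hx, h]⟩
      · exact ⟨false, mem_univ _, by simp only [Sc, Bool.false_eq_true, if_false, mem_filter]; exact ⟨hx, by omega⟩⟩)
    simpa using this
  rw [en_eq_eg]
  refine h1.trans ?_
  rw [Fintype.sum_bool, mul_add]
  refine add_le_add (Nat.mul_le_mul_left 2 ?_) (Nat.mul_le_mul_left 2 ?_)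
  · have h2 := eg_cover (Sc true) Φ (powersetCard (k - 1) (Ico (0 : ℤ) p))
      (fun T => Fintype.piFinset (fun _ : Fin (s + k) => {x ∈ IN N | x % (p : ℤ) ∈ T})) (by
        intro x hx
        simp only [Sc, if_true, mem_filter, S, Fintype.mem_piFinset] at hx
        have hsub : R x ⊆ Ico (0 : ℤ) p := by
          intro y hy
          simp only [R, mem_image, mem_univ, true_and] at hy
          obtain ⟨i, rfl⟩ := hy
          rw [mem_Ico]; exact ⟨Int.emod_nonneg _ hp'.ne', Int.emod_lt_of_pos _ hp'⟩
        obtain ⟨T, hT1, hT2, hT3⟩ := exists_subsuperset_card_eq hsub hx.2 (by simp; omega)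
        refine ⟨T, mem_powersetCard.2 ⟨hT2, hT3⟩, ?_⟩
        rw [Fintype.mem_piFinset]
        intro i
        rw [mem_filter]
        exact ⟨hx.1 i, hT1 (mem_image_of_mem _ (mem_univ i))⟩)
    have hC : #(powersetCard (k - 1) (Ico (0 : ℤ) p)) ≤ p ^ (k - 1) := by
      rw [card_powersetCard]; simp only [Int.card_Ico, sub_zero, Int.toNat_natCast]
      exact Nat.choose_le_pow _ _
    refine h2.trans ?_
    calc _ ≤ p ^ (k - 1) * ∑ T ∈ powersetCard (k - 1) (Ico (0 : ℤ) p),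
          (k ^ (2 * (s + k)) * En k (s + k) (IN (N / p + 1))) := by
          gcongr with T hT
          rw [← en_eq_eg]
          refine (en_bound (by omega) hp.pos T).trans ?_
          rw [(mem_powersetCard.1 hT).2]
          gcongr
          omega
      _ ≤ p ^ (k - 1) * (p ^ (k - 1) * (k ^ (2 * (s + k)) * En k (s + k) (IN (N / p + 1)))) := by
          rw [sum_const, smul_eq_mul]
          gcongr
      _ = _ := by rw [two_mul, pow_add]; ring
  · have h2 := eg_cover (Sc false) Φ ({σ : Fin k → Fin (s + k) | Function.Injective σ})
      (fun σ => {x ∈ Fintype.piFinset (fun _ : Fin (s + k) => IN N) |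
      ∀ i j, (p : ℤ) ∣ x (σ i) - x (σ j) → i = j}) (by
        intro x hx
        simp only [Sc, Bool.false_eq_true, if_false, mem_filter, S] at hx
        obtain ⟨T, hT1, hT2⟩ := exists_subset_card_eq hx.2
        have hch : ∀ y : T, ∃ i, x i % (p : ℤ) = y := by
          intro y
          have := hT1 y.2
          simpa only [R, mem_image, mem_univ, true_and] using this
        choose f hf using hch
        let eT : Fin k ≃ T := (Fintype.equivFinOfCardEq (by simp [hT2])).symm
        have key : ∀ i j, (p : ℤ) ∣ x (f (eT i)) - x (f (eT j)) → i = j := by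
          intro i j hij
          have : x (f (eT i)) % (p : ℤ) = x (f (eT j)) % (p : ℤ) :=
            (Int.emod_emod_of_dvd _ dvd_rfl).symm.trans (by
              rw [Int.emod_emod_of_dvd _ dvd_rfl]
              exact Int.emod_eq_emod_iff_emod_sub_eq_zero.2 (Int.emod_eq_zero_of_dvd hij))
          rw [hf, hf] at this
          exact eT.injective (Subtype.ext this)
        refine ⟨fun i => f (eT i), ?_, ?_⟩
        · simp only [mem_filter, mem_univ, true_and]
          intro i j hij
          apply key i j
          simp only at hij
          rw [hij]; simp
        · rw [mem_filter]
          exact ⟨hx.1, key⟩)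
    have hC : #({σ : Fin k → Fin (s + k) | Function.Injective σ} : Finset _) ≤ (s + k) ^ k := by
      refine (card_filter_le _ _).trans ?_
      simp
    refine h2.trans ?_
    calc _ ≤ (s + k) ^ k * ∑ σ ∈ ({σ : Fin k → Fin (s + k) | Function.Injective σ} : Finset _),
          (p ^ (2 * s) * (N ^ k * (p ^ (k * (k - 1) / 2) * k ^ k * En k s (IN (N / p + 1))))) := by
          gcongr with σ hσ
          exact (eg_sigma σ (mem_filter.1 hσ).2).trans (wn_bound hs hp hkp hN)
      _ ≤ (s + k) ^ k * ((s + k) ^ k * (p ^ (2 * s) * (N ^ k * (p ^ (k * (k - 1) / 2) * k ^ k *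
            En k s (IN (N / p + 1)))))) := by
          rw [sum_const, smul_eq_mul]
          gcongr
      _ = _ := by rw [two_mul k, pow_add]; ring
end Wz
end

section
open Finset
namespace Wz

lemma en_trivial (k s N : ℕ) : En k s (IN N) ≤ N ^ (2 * s) := by
  unfold En
  refine (card_filter_le _ _).trans ?_
  rw [card_product, Fintype.card_piFinset]
  simp [IN, two_mul, pow_add]

/-- numeric: degenerate term -/
lemma vm_deg {k s p : ℕ} {N E : ℝ} (hk : 2 ≤ k) (hs : k ^ 2 ≤ s)
    (hp : 64 * k ^ 4 ≤ p) (hN : 0 < N) (hE1 : ((2 * k - 2 + s + 2 : ℕ) : ℝ) ≤ E)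
    (hE2 : E ≤ 3 * (s + k : ℕ)) :
    2 * ((p:ℝ) ^ (2 * (k - 1)) * ((k:ℝ) ^ (2 * (s + k)) * (2 * N / p) ^ E)) ≤ 1 / 2 * N ^ E := by
  have hp0 : (0:ℝ) < p := by
    have : 0 < p := lt_of_lt_of_le (by positivity) hp
    exact_mod_cast this
  have hp1 : (1:ℝ) ≤ p := by
    have : 1 ≤ p := by exact_mod_cast hp0
    exact_mod_cast this
  have e1 : (2 * N / p) ^ E = 2 ^ E * N ^ E / (p:ℝ) ^ E := by
    rw [Real.div_rpow (by positivity) hp0.le, Real.mul_rpow (by norm_num) hN.le]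
  rw [e1]
  have h2 : (2:ℝ) ^ E ≤ 2 ^ (3 * (s + k)) := by
    rw [← Real.rpow_natCast]
    apply Real.rpow_le_rpow_of_exponent_le (by norm_num)
    push_cast at hE2 ⊢; exact hE2
  have h3 : (p:ℝ) ^ (2 * k - 2 + s + 2 : ℕ) ≤ (p:ℝ) ^ E := by
    rw [← Real.rpow_natCast]
    exact Real.rpow_le_rpow_of_exponent_le hp1 hE1
  have hsk : s + k ≤ 2 * s := by nlinarith
  have h4 : (4:ℝ) * ((k:ℝ) ^ (2 * (s + k)) * 2 ^ (3 * (s + k))) ≤ (p:ℝ) ^ (s + 2) := by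
    have a1 : k ^ (2 * (s + k)) * 2 ^ (3 * (s + k)) ≤ p ^ s := by
      calc k ^ (2 * (s + k)) * 2 ^ (3 * (s + k)) = (8 * k ^ 2) ^ (s + k) := by
            rw [pow_mul, pow_mul, ← mul_pow]; norm_num [mul_comm]
        _ ≤ (8 * k ^ 2) ^ (2 * s) := Nat.pow_le_pow_right (by positivity) hsk
        _ = (64 * k ^ 4) ^ s := by rw [pow_mul]; congr 1; ring
        _ ≤ p ^ s := Nat.pow_le_pow_left hp s
    have a2 : 4 ≤ p ^ 2 := by
      have : 2 ≤ p := by nlinarith [Nat.one_le_pow 4 k (by omega)]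
      nlinarith
    have : 4 * (k ^ (2 * (s + k)) * 2 ^ (3 * (s + k))) ≤ p ^ (s + 2) := by
      rw [pow_add, mul_comm (p ^ s)]
      exact Nat.mul_le_mul a2 a1
    exact_mod_cast this
  have e2 : 2 * (k - 1) = 2 * k - 2 := by omega
  rw [e2]
  have hpE : 0 < (p:ℝ) ^ E := Real.rpow_pos_of_pos hp0 _
  have hNE : 0 < N ^ E := Real.rpow_pos_of_pos hN _
  have h5 : 4 * ((p:ℝ) ^ (2 * k - 2) * ((k:ℝ) ^ (2 * (s + k)) * 2 ^ E)) ≤ (p:ℝ) ^ E := by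
    calc 4 * ((p:ℝ) ^ (2 * k - 2) * ((k:ℝ) ^ (2 * (s + k)) * 2 ^ E))
        ≤ 4 * ((p:ℝ) ^ (2 * k - 2) * ((k:ℝ) ^ (2 * (s + k)) * 2 ^ (3 * (s + k)))) := by gcongr
      _ = (p:ℝ) ^ (2 * k - 2) * (4 * ((k:ℝ) ^ (2 * (s + k)) * 2 ^ (3 * (s + k)))) := by ring
      _ ≤ (p:ℝ) ^ (2 * k - 2) * (p:ℝ) ^ (s + 2) := by gcongr
      _ = (p:ℝ) ^ (2 * k - 2 + s + 2 : ℕ) := by rw [← pow_add]; rfl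
      _ ≤ _ := h3
  calc 2 * ((p:ℝ) ^ (2 * k - 2) * ((k:ℝ) ^ (2 * (s + k)) * (2 ^ E * N ^ E / (p:ℝ) ^ E)))
      = (4 * ((p:ℝ) ^ (2 * k - 2) * ((k:ℝ) ^ (2 * (s + k)) * 2 ^ E))) * (N ^ E / (p:ℝ) ^ E) / 2 := by
        ring
    _ ≤ (p:ℝ) ^ E * (N ^ E / (p:ℝ) ^ E) / 2 := by gcongr
    _ = _ := by field_simp

lemma two_pow_ge (k : ℕ) : k ≤ 2 ^ k := Nat.lt_two_pow_self.le

/-- numeric: main term -/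
lemma vm_main {k s p : ℕ} {N δ : ℝ} (hk : 2 ≤ k) (hs : k ^ 2 ≤ s) (hs2 : s + k ≤ 8 * k ^ 2)
    (hN : 0 < N) (hp0 : (0:ℝ) < p) (hp : (p:ℝ) ≤ 4 * N ^ (1 / k : ℝ)) (hδ : 0 ≤ δ) (hδ2 : δ ≤ (k:ℝ) ^ 2) :
    2 * (((s + k : ℕ):ℝ) ^ (2 * k) * ((p:ℝ) ^ (2 * s) * (N ^ k * ((p:ℝ) ^ (k * (k - 1) / 2) * (k:ℝ) ^ k *
      (2 * N / p) ^ (2 * s - k * (k + 1) / 2 + δ : ℝ))))) ≤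
    1 / 2 * 2 ^ (39 * k ^ 2) * N ^ (2 * (s + k : ℕ) - k * (k + 1) / 2 + δ * (1 - 1 / k) : ℝ) := by
  have hk0 : (0:ℝ) < k := by exact_mod_cast (by omega : 0 < k)
  obtain ⟨E, hE⟩ : ∃ E : ℝ, E = 2 * s - k * (k + 1) / 2 + δ := ⟨_, rfl⟩
  have hsR : (k:ℝ) ^ 2 ≤ s := by exact_mod_cast hs
  have hE3 : E ≤ (3 * s : ℕ) := by push_cast; rw [hE]; nlinarith
  rw [← hE]
  have e1 : (2 * N / p) ^ E = 2 ^ E * N ^ E / (p:ℝ) ^ E := by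
    rw [Real.div_rpow (by positivity) hp0.le, Real.mul_rpow (by norm_num) hN.le]
  have h2 : (2:ℝ) ^ E ≤ 2 ^ (3 * s) := by
    rw [← Real.rpow_natCast]
    exact Real.rpow_le_rpow_of_exponent_le (by norm_num) hE3
  have hkk : ((k * (k - 1) / 2 : ℕ) : ℝ) = k * (k - 1) / 2 := by
    rw [Nat.cast_div (Nat.even_mul_pred_self k).two_dvd (by norm_num)]
    push_cast [Nat.cast_sub (by omega : 1 ≤ k)]; ring
  have e3 : (p:ℝ) ^ (2 * s) * (p:ℝ) ^ (k * (k - 1) / 2) / (p:ℝ) ^ E = (p:ℝ) ^ ((k:ℝ) ^ 2 - δ) := by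
    rw [← Real.rpow_natCast, ← Real.rpow_natCast, ← Real.rpow_add hp0, ← Real.rpow_sub hp0, hkk, hE]
    congr 1; push_cast; ring
  have h4 : (p:ℝ) ^ ((k:ℝ) ^ 2 - δ) ≤ 4 ^ (k ^ 2) * N ^ (k - δ / k : ℝ) := by
    calc (p:ℝ) ^ ((k:ℝ) ^ 2 - δ) ≤ (4 * N ^ (1 / k : ℝ)) ^ ((k:ℝ) ^ 2 - δ) :=
          Real.rpow_le_rpow hp0.le hp (by linarith)
      _ = 4 ^ ((k:ℝ) ^ 2 - δ) * N ^ (k - δ / k : ℝ) := by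
          rw [Real.mul_rpow (by norm_num) (by positivity), ← Real.rpow_mul hN.le]
          congr 2; field_simp
      _ ≤ 4 ^ (k ^ 2) * N ^ (k - δ / k : ℝ) := by
          gcongr
          rw [← Real.rpow_natCast 4 (k ^ 2)]
          apply Real.rpow_le_rpow_of_exponent_le (by norm_num)
          push_cast; linarith
  have e5 : N ^ (2 * (s + k : ℕ) - k * (k + 1) / 2 + δ * (1 - 1 / k) : ℝ) =
      N ^ k * N ^ E * N ^ (k - δ / k : ℝ) := by
    rw [← Real.rpow_natCast, ← Real.rpow_add hN, ← Real.rpow_add hN, hE]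
    congr 1; push_cast; field_simp; ring
  have h6 : (4:ℝ) * (((s + k : ℕ):ℝ) ^ (2 * k) * (k:ℝ) ^ k * 2 ^ (3 * s) * 4 ^ (k ^ 2)) ≤ 2 ^ (39 * k ^ 2) := by
    have a1 : s + k ≤ 2 ^ (5 * k) := by
      calc s + k ≤ 8 * k ^ 2 := hs2
        _ ≤ 2 ^ 3 * (2 ^ k) ^ 2 := by gcongr; · norm_num
                                      · exact two_pow_ge k
        _ = 2 ^ (3 + 2 * k) := by rw [pow_add, ← pow_mul, mul_comm 2 k]
        _ ≤ 2 ^ (5 * k) := Nat.pow_le_pow_right (by norm_num) (by omega)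
    have : 4 * ((s + k) ^ (2 * k) * k ^ k * 2 ^ (3 * s) * 4 ^ (k ^ 2)) ≤ 2 ^ (39 * k ^ 2) := by
      calc 4 * ((s + k) ^ (2 * k) * k ^ k * 2 ^ (3 * s) * 4 ^ (k ^ 2))
          ≤ 2 ^ 2 * ((2 ^ (5 * k)) ^ (2 * k) * (2 ^ k) ^ k * 2 ^ (24 * k ^ 2) * (2 ^ 2) ^ (k ^ 2)) := by
            have b : 3 * s ≤ 24 * k ^ 2 := by omega
            have b4 : 4 = 2 ^ 2 := by norm_num
            rw [← b4]
            gcongr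
            · exact two_pow_ge k
            · norm_num
        _ = 2 ^ (2 + (5 * k * (2 * k) + k * k + 24 * k ^ 2 + 2 * k ^ 2)) := by
            simp only [← pow_mul, pow_add]
        _ ≤ 2 ^ (39 * k ^ 2) := Nat.pow_le_pow_right (by norm_num) (by nlinarith)
    exact_mod_cast this
  rw [e1, e5]
  calc _ = 2 * (((s + k : ℕ):ℝ) ^ (2 * k) * (k:ℝ) ^ k * 2 ^ E * ((p:ℝ) ^ (2 * s) * (p:ℝ) ^ (k * (k - 1) / 2) / (p:ℝ) ^ E)
        * (N ^ k * N ^ E)) := by ring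
    _ ≤ 2 * (((s + k : ℕ):ℝ) ^ (2 * k) * (k:ℝ) ^ k * 2 ^ (3 * s) * (4 ^ (k ^ 2) * N ^ (k - δ / k : ℝ))
        * (N ^ k * N ^ E)) := by
        rw [e3]; gcongr
    _ = 1 / 2 * (4 * (((s + k : ℕ):ℝ) ^ (2 * k) * (k:ℝ) ^ k * 2 ^ (3 * s) * 4 ^ (k ^ 2))) *
        (N ^ k * N ^ E * N ^ (k - δ / k : ℝ)) := by ring
    _ ≤ _ := by gcongr

set_option maxHeartbeats 1000000 in
lemma vm_step {k s : ℕ} (hk : 2 ≤ k) (hs : k ^ 2 ≤ s) (hs2 : s + k ≤ 8 * k ^ 2) {δ C C' : ℝ}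
    (hδ : 0 ≤ δ) (hδ2 : δ ≤ (k:ℝ) ^ 2) (hC0 : 0 ≤ C)
    (hC : ∀ N : ℕ, 1 ≤ N → (En k s (IN N) : ℝ) ≤ C * (N:ℝ) ^ (2 * s - k * (k + 1) / 2 + δ : ℝ))
    (h1 : 2 ^ (10 * k ^ 4) ≤ C') (h2 : 2 ^ (39 * k ^ 2) * C ≤ C') :
    ∀ N : ℕ, 1 ≤ N → (En k (s + k) (IN N) : ℝ) ≤
      C' * (N:ℝ) ^ (2 * (s + k : ℕ) - k * (k + 1) / 2 + δ * (1 - 1 / k) : ℝ) := by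
  have hk0 : (0:ℝ) < k := by exact_mod_cast (by omega : 0 < k)
  have hk2 : (2:ℝ) ≤ k := by exact_mod_cast hk
  have hC' : 0 < C' := lt_of_lt_of_le (by positivity) h1
  have hsR : (k:ℝ) ^ 2 ≤ s := by exact_mod_cast hs
  obtain ⟨E, hE⟩ : ∃ E : ℝ, E = 2 * (s + k : ℕ) - k * (k + 1) / 2 + δ * (1 - 1 / k) := ⟨_, rfl⟩
  have hd0 : 0 ≤ δ * (1 - 1 / k) := by
    apply mul_nonneg hδ
    rw [sub_nonneg, div_le_one hk0]; linarith
  have hd1 : δ * (1 - 1 / k) ≤ (k:ℝ) ^ 2 := by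
    refine le_trans (mul_le_of_le_one_right hδ ?_) hδ2
    have : (0:ℝ) ≤ 1 / k := by positivity
    linarith
  rw [← hE]
  intro N
  induction N using Nat.strong_induction_on with
  | _ N ih =>
  intro hN1
  have hNr : (1:ℝ) ≤ N := by exact_mod_cast hN1
  by_cases hsmall : N < (64 * k ^ 4) ^ k
  · have t1 : (En k (s + k) (IN N) : ℝ) ≤ (N:ℝ) ^ (2 * (s + k)) := by exact_mod_cast en_trivial k (s + k) N
    have t2 : (N:ℝ) ^ (2 * (s + k)) ≤ (N:ℝ) ^ (k ^ 2) * (N:ℝ) ^ E := by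
      rw [← Real.rpow_natCast, ← Real.rpow_natCast, ← Real.rpow_add (by linarith)]
      apply Real.rpow_le_rpow_of_exponent_le hNr
      rw [hE]; push_cast; nlinarith
    have t3 : (N:ℝ) ^ (k ^ 2) ≤ C' := by
      refine le_trans ?_ h1
      have : N ^ (k ^ 2) ≤ 2 ^ (10 * k ^ 4) := by
        calc N ^ (k ^ 2) ≤ ((64 * k ^ 4) ^ k) ^ (k ^ 2) := Nat.pow_le_pow_left hsmall.le _
          _ ≤ ((2 ^ 6 * (2 ^ k) ^ 4) ^ k) ^ (k ^ 2) := by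
              gcongr
              · norm_num
              · exact two_pow_ge k
          _ = 2 ^ ((6 + k * 4) * k * k ^ 2) := by rw [← pow_mul 2 k 4, ← pow_add, ← pow_mul, ← pow_mul, mul_assoc]
          _ ≤ 2 ^ (10 * k ^ 4) := Nat.pow_le_pow_right (by norm_num) (by
              have : (6 + k * 4) ≤ 10 * k := by omega
              calc (6 + k * 4) * k * k ^ 2 ≤ (10 * k) * k * k ^ 2 := by gcongr
                _ = _ := by ring)
      exact_mod_cast this
    refine t1.trans (t2.trans ?_)
    gcongr
  push Not at hsmall
  obtain ⟨R, hR⟩ : ∃ R : ℝ, R = (N:ℝ) ^ (1 / k : ℝ) := ⟨_, rfl⟩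
  have hRk : R ^ k = N := by
    rw [hR, ← Real.rpow_natCast, ← Real.rpow_mul (by positivity)]
    rw [one_div_mul_cancel hk0.ne', Real.rpow_one]
  have hR0 : 0 ≤ R := by rw [hR]; positivity
  have hRb : (64 * (k:ℝ) ^ 4) ≤ R := by
    apply le_of_pow_le_pow_left₀ (n := k) (by omega) hR0
    rw [hRk]; exact_mod_cast hsmall
  have hk4 : (16:ℝ) ≤ (k:ℝ) ^ 4 := by
    calc (16:ℝ) = 2 ^ 4 := by norm_num
      _ ≤ _ := by gcongr
  obtain ⟨p, hpp, hp1, hp2⟩ := Nat.exists_prime_lt_and_le_two_mul ⌈R⌉₊ (by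
    have : 0 < ⌈R⌉₊ := Nat.ceil_pos.2 (by linarith)
    omega)
  have hRp : R < p := lt_of_le_of_lt (Nat.le_ceil R) (by exact_mod_cast hp1)
  have hp4 : (p:ℝ) ≤ 4 * R := by
    have a : (p:ℝ) ≤ 2 * (⌈R⌉₊ : ℝ) := by exact_mod_cast hp2
    have b := Nat.ceil_lt_add_one hR0
    linarith
  have hp0 : (0:ℝ) < p := by linarith
  have hpN : (p:ℝ) ≤ N := by
    have : R ^ 2 ≤ R ^ k := pow_le_pow_right₀ (by linarith) hk
    rw [hRk] at this
    nlinarith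
  have hNp : N ≤ p ^ k := by
    have : (N:ℝ) ≤ (p:ℝ) ^ k := by rw [← hRk]; gcongr
    exact_mod_cast this
  have hkp : k < p := by
    have : (k:ℝ) < p := by
      have : (k:ℝ) ≤ k ^ 4 := le_self_pow₀ (by linarith) (by norm_num)
      linarith
    exact_mod_cast this
  have hp64 : 64 * k ^ 4 ≤ p := by
    have : (64 * (k:ℝ) ^ 4) ≤ p := by linarith
    exact_mod_cast this
  have hrec := en_rec (k := k) (s := s) (N := N) (p := p) (by omega) (by nlinarith) hpp hkp hNp
  have hrec' := (Nat.cast_le (α := ℝ)).2 hrec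
  push_cast at hrec'
  have hN' : ((N / p + 1 : ℕ) : ℝ) ≤ 2 * N / p := by
    push_cast
    have a : ((N / p : ℕ) : ℝ) ≤ N / p := Nat.cast_div_le
    have b : 1 ≤ (N:ℝ) / p := by rw [le_div_iff₀ hp0]; linarith
    have : 2 * (N:ℝ) / p = N / p + N / p := by ring
    linarith
  have hlt : N / p + 1 < N := by
    have : 2 * (N:ℝ) / p < N := by rw [div_lt_iff₀ hp0]; nlinarith
    have : ((N / p + 1 : ℕ) : ℝ) < N := lt_of_le_of_lt hN' this
    exact_mod_cast this
  have hE0 : ((2 * k - 2 + s + 2 : ℕ) : ℝ) ≤ E := by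
    have e : 2 * k - 2 + s + 2 = 2 * k + s := by omega
    rw [e, hE]; push_cast; nlinarith
  have hEn : 0 ≤ E := le_trans (Nat.cast_nonneg _) hE0
  have hEs : 0 ≤ (2 * s - k * (k + 1) / 2 + δ : ℝ) := by nlinarith
  have i1 := (ih _ hlt (Nat.succ_pos _)).trans (mul_le_mul_of_nonneg_left
    (Real.rpow_le_rpow (by positivity) hN' hEn) hC'.le)
  have i2 := (hC (N / p + 1) (Nat.succ_pos _)).trans (mul_le_mul_of_nonneg_left
    (Real.rpow_le_rpow (by positivity) hN' hEs) hC0)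
  have j1 := vm_deg (N := (N:ℝ)) (E := E) hk hs hp64 (by linarith) hE0 (by
    rw [hE]; push_cast; nlinarith)
  have j2 := vm_main (N := (N:ℝ)) hk hs hs2 (by linarith) hp0 (by rw [← hR]; exact hp4) hδ hδ2
  rw [← hE] at j2
  refine hrec'.trans ?_
  have q1 : 2 * ((p:ℝ) ^ (2 * (k - 1)) * ((k:ℝ) ^ (2 * (s + k)) * (En k (s + k) (IN (N / p + 1)) : ℝ))) ≤
      C' * (1 / 2 * (N:ℝ) ^ E) := by
    calc _ ≤ 2 * ((p:ℝ) ^ (2 * (k - 1)) * ((k:ℝ) ^ (2 * (s + k)) * (C' * (2 * N / p) ^ E))) := by gcongr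
      _ = C' * (2 * ((p:ℝ) ^ (2 * (k - 1)) * ((k:ℝ) ^ (2 * (s + k)) * (2 * N / p) ^ E))) := by ring
      _ ≤ _ := by gcongr
  have q2 : 2 * (((s + k : ℕ):ℝ) ^ (2 * k) * ((p:ℝ) ^ (2 * s) * ((N:ℝ) ^ k * ((p:ℝ) ^ (k * (k - 1) / 2) * (k:ℝ) ^ k *
      (En k s (IN (N / p + 1)) : ℝ))))) ≤ C' * (1 / 2 * (N:ℝ) ^ E) := by
    calc _ ≤ 2 * (((s + k : ℕ):ℝ) ^ (2 * k) * ((p:ℝ) ^ (2 * s) * ((N:ℝ) ^ k * ((p:ℝ) ^ (k * (k - 1) / 2) * (k:ℝ) ^ k *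
            (C * (2 * N / p) ^ (2 * s - k * (k + 1) / 2 + δ : ℝ)))))) := by gcongr
      _ = C * (2 * (((s + k : ℕ):ℝ) ^ (2 * k) * ((p:ℝ) ^ (2 * s) * ((N:ℝ) ^ k * ((p:ℝ) ^ (k * (k - 1) / 2) * (k:ℝ) ^ k *
            (2 * N / p) ^ (2 * s - k * (k + 1) / 2 + δ : ℝ)))))) := by ring
      _ ≤ C * (1 / 2 * 2 ^ (39 * k ^ 2) * (N:ℝ) ^ E) := by gcongr
      _ = 2 ^ (39 * k ^ 2) * C * (1 / 2 * (N:ℝ) ^ E) := by ring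
      _ ≤ _ := by gcongr
  push_cast at q2
  push_cast
  linarith

lemma vm_iter {k : ℕ} (hk : 2 ≤ k) (l : ℕ) (hl : l ≤ 7 * k) :
    ∀ N : ℕ, 1 ≤ N → (En k (k ^ 2 + k * l) (IN N) : ℝ) ≤
      (2 ^ (10 * k ^ 4) * (2 ^ (39 * k ^ 2)) ^ l) *
        (N:ℝ) ^ (2 * (k ^ 2 + k * l : ℕ) - k * (k + 1) / 2 + (k:ℝ) ^ 2 * (1 - 1 / k) ^ l : ℝ) := by
  have hk0 : (0:ℝ) < k := by exact_mod_cast (by omega : 0 < k)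
  have hk2 : (2:ℝ) ≤ k := by exact_mod_cast hk
  have hd0 : 0 ≤ (1 - 1 / k : ℝ) := by
    rw [sub_nonneg, div_le_one hk0]; linarith
  have hd1 : (1 - 1 / k : ℝ) ≤ 1 := by
    have : (0:ℝ) ≤ 1 / k := by positivity
    linarith
  induction l with
  | zero =>
    intro N hN
    have hNr : (1:ℝ) ≤ N := by exact_mod_cast hN
    have t1 : (En k (k ^ 2 + k * 0) (IN N) : ℝ) ≤ (N:ℝ) ^ (2 * (k ^ 2)) := by
      exact_mod_cast en_trivial k (k ^ 2) N
    refine t1.trans ?_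
    rw [← Real.rpow_natCast]
    refine le_trans (Real.rpow_le_rpow_of_exponent_le hNr ?_)
      (le_mul_of_one_le_left (by positivity) ?_)
    · push_cast; nlinarith
    · rw [pow_zero, mul_one]; exact one_le_pow₀ (by norm_num)
  | succ l ih =>
    have := vm_step (C' := 2 ^ (10 * k ^ 4) * (2 ^ (39 * k ^ 2)) ^ (l + 1)) hk
      (by nlinarith : k ^ 2 ≤ k ^ 2 + k * l) (by nlinarith) (by positivity)
      (mul_le_of_le_one_right (by positivity) (pow_le_one₀ hd0 hd1)) (by positivity) (ih (by omega))
      (le_mul_of_one_le_right (by positivity) (one_le_pow₀ (one_le_pow₀ (by norm_num))))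
      (le_of_eq (by ring))
    intro N hN
    have h := this N hN
    have e : k ^ 2 + k * l + k = k ^ 2 + k * (l + 1) := by ring
    rw [e, mul_assoc ((k:ℝ) ^ 2), ← pow_succ] at h
    exact h

/-- Vinogradov mean value theorem, in the form needed. -/
theorem vmvt {k : ℕ} (hk : 2 ≤ k) (N : ℕ) (hN : 1 ≤ N) :
    (En k (8 * k ^ 2) (IN N) : ℝ) ≤ 2 ^ (283 * k ^ 4) *
      (N:ℝ) ^ (2 * (8 * k ^ 2 : ℕ) - k * (k + 1) / 2 + (k:ℝ) ^ 2 / 1000 : ℝ) := by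
  have hk0 : (0:ℝ) < k := by exact_mod_cast (by omega : 0 < k)
  have hk2 : (2:ℝ) ≤ k := by exact_mod_cast hk
  have hNr : (1:ℝ) ≤ N := by exact_mod_cast hN
  have h := vm_iter hk (7 * k) le_rfl N hN
  have e : k ^ 2 + k * (7 * k) = 8 * k ^ 2 := by ring
  rw [e] at h
  refine h.trans ?_
  have hd0 : 0 ≤ (1 - 1 / k : ℝ) := by
    rw [sub_nonneg, div_le_one hk0]; linarith
  have h7 : (1 - 1 / k : ℝ) ^ (7 * k) ≤ 1 / 1000 := by
    have a : (1 - 1 / k : ℝ) ≤ Real.exp (-(1 / k)) := by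
      have := Real.add_one_le_exp (-(1 / k : ℝ)); linarith
    calc (1 - 1 / k : ℝ) ^ (7 * k) ≤ Real.exp (-(1 / k)) ^ (7 * k) := by gcongr
      _ = (Real.exp 1 ^ 7)⁻¹ := by
        rw [← Real.exp_nat_mul, ← Real.exp_nat_mul, ← Real.exp_neg]
        congr 1; push_cast; field_simp
      _ ≤ (2.71 ^ 7)⁻¹ := by
        have := Real.exp_one_gt_d9
        gcongr; linarith
      _ ≤ 1 / 1000 := by norm_num
  have hc : (2:ℝ) ^ (10 * k ^ 4) * (2 ^ (39 * k ^ 2)) ^ (7 * k) ≤ 2 ^ (283 * k ^ 4) := by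
    rw [← pow_mul, ← pow_add]
    apply pow_le_pow_right₀ (by norm_num)
    have : 39 * k ^ 2 * (7 * k) ≤ 273 * k ^ 4 := by
      calc 39 * k ^ 2 * (7 * k) = 273 * k ^ 3 := by ring
        _ ≤ _ := by gcongr <;> omega
    omega
  gcongr
  rw [div_eq_mul_one_div ((k:ℝ) ^ 2)]; gcongr
end Wz
end

section
open Finset
namespace Wz

/-- additive character with real frequencies -/
noncomputable def ev {k : ℕ} (β : Fin k → ℝ) (v : Fin k → ℤ) : ℂ :=
  Complex.exp (((2 * Real.pi * ∑ j, β j * v j : ℝ) : ℂ) * Complex.I)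

lemma ev_norm {k : ℕ} (β : Fin k → ℝ) (v : Fin k → ℤ) : ‖ev β v‖ = 1 := Complex.norm_exp_ofReal_mul_I _

lemma ev_add {k : ℕ} (β : Fin k → ℝ) (v w : Fin k → ℤ) : ev β (v + w) = ev β v * ev β w := by
  unfold ev
  rw [← Complex.exp_add, ← add_mul, ← Complex.ofReal_add, ← mul_add, ← Finset.sum_add_distrib]
  congr 5; ext j; simp; ring

lemma ev_zero {k : ℕ} (β : Fin k → ℝ) : ev β 0 = 1 := by simp [ev]

lemma ev_neg {k : ℕ} (β : Fin k → ℝ) (v : Fin k → ℤ) : ev β (-v) = (starRingEnd ℂ) (ev β v) := by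
  unfold ev
  rw [← Complex.exp_conj]
  rw [map_mul, Complex.conj_ofReal, Complex.conj_I]
  simp

lemma ev_sum {k : ℕ} (β : Fin k → ℝ) {ι : Type*} (T : Finset ι) (g : ι → Fin k → ℤ) :
    ev β (∑ i ∈ T, g i) = ∏ i ∈ T, ev β (g i) := by
  classical
  induction T using Finset.induction_on with
  | empty => simp [ev_zero]
  | insert a T ha ih => rw [sum_insert ha, prod_insert ha, ev_add, ih]

/-- index set -/
noncomputable def II (s M : ℕ) : Finset ((Fin s → ℤ) × (Fin s → ℤ)) :=
  Fintype.piFinset (fun _ : Fin s => IN M) ×ˢ Fintype.piFinset (fun _ : Fin s => IN M)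

/-- difference map -/
def Ph (k s : ℕ) (t : (Fin s → ℤ) × (Fin s → ℤ)) : Fin k → ℤ := ∑ i, vk k (t.1 i) - ∑ i, vk k (t.2 i)

/-- box -/
noncomputable def bx (k s M : ℕ) : Finset (Fin k → ℤ) :=
  Fintype.piFinset (fun j : Fin k => Icc (-((s * M ^ (j.val + 1) : ℕ) : ℤ)) ((s * M ^ (j.val + 1) : ℕ) : ℤ))

lemma card_II (s M : ℕ) : #(II s M) = M ^ (2 * s) := by
  unfold II
  rw [card_product, Fintype.card_piFinset]
  simp [IN, two_mul, pow_add]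

lemma ev_expand {k : ℕ} (β : Fin k → ℝ) (s M : ℕ) :
    ((‖∑ y ∈ IN M, ev β (vk k y)‖ ^ (2 * s) : ℝ) : ℂ) = ∑ t ∈ II s M, ev β (Ph k s t) := by
  have h1 : ∀ y : Fin s → ℤ, ev β (∑ i, vk k (y i)) = ∏ i, ev β (vk k (y i)) := fun y => ev_sum β _ _
  have h2 : (∑ y ∈ IN M, ev β (vk k y)) ^ s = ∑ y ∈ Fintype.piFinset (fun _ : Fin s => IN M),
      ev β (∑ i, vk k (y i)) := by
    simp only [h1]
    have := (Finset.prod_univ_sum (fun _ : Fin s => IN M) (fun _ x => ev β (vk k x))).symm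
    rw [prod_const, card_univ, Fintype.card_fin] at this
    exact this.symm
  have h3 : ∑ t ∈ II s M, ev β (Ph k s t) =
      (∑ y ∈ Fintype.piFinset (fun _ : Fin s => IN M), ev β (∑ i, vk k (y i))) *
      (starRingEnd ℂ) (∑ y ∈ Fintype.piFinset (fun _ : Fin s => IN M), ev β (∑ i, vk k (y i))) := by
    unfold II Ph
    rw [sum_product, map_sum, sum_mul_sum]
    refine sum_congr rfl fun y _ => sum_congr rfl fun z _ => ?_
    rw [sub_eq_add_neg, ev_add, ev_neg]
  rw [h3, ← h2, Complex.mul_conj, Complex.normSq_eq_norm_sq, norm_pow]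
  congr 1
  rw [← pow_mul, mul_comm]

lemma ph_mem (k s M : ℕ) {t : (Fin s → ℤ) × (Fin s → ℤ)} (ht : t ∈ II s M) : Ph k s t ∈ bx k s M := by
  unfold II at ht
  simp only [mem_product, Fintype.mem_piFinset, IN, mem_Icc] at ht
  simp only [bx, Fintype.mem_piFinset, mem_Icc]
  intro j
  have hb : ∀ y : Fin s → ℤ, (∀ i, 1 ≤ y i ∧ y i ≤ M) →
      0 ≤ ∑ i, y i ^ (j.val + 1) ∧ ∑ i, y i ^ (j.val + 1) ≤ ((s * M ^ (j.val + 1) : ℕ) : ℤ) := by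
    intro y hy
    constructor
    · exact sum_nonneg fun i _ => pow_nonneg (by linarith [(hy i).1]) _
    · calc ∑ i, y i ^ (j.val + 1) ≤ ∑ i : Fin s, (M:ℤ) ^ (j.val + 1) :=
            sum_le_sum fun i _ => pow_le_pow_left₀ (by linarith [(hy i).1]) (hy i).2 _
        _ = _ := by simp
  have h1 := hb _ ht.1
  have h2 := hb _ ht.2
  simp only [Ph, Pi.sub_apply, Finset.sum_apply, vk]
  constructor <;> linarith [h1.1, h1.2, h2.1, h2.2]

lemma fib_le (k s M : ℕ) (F : (Fin k → ℤ) → ℝ) (hF : ∀ v, 0 ≤ F v) :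
    ∑ t ∈ II s M, F (Ph k s t) ≤ En k s (IN M) * ∑ h ∈ bx k s M, F h := by
  rw [← sum_fiberwise_of_maps_to (fun t ht => ph_mem k s M ht), mul_sum]
  refine sum_le_sum fun h _ => ?_
  have : ∑ t ∈ II s M with Ph k s t = h, F (Ph k s t) = (#{t ∈ II s M | Ph k s t = h} : ℝ) * F h := by
    rw [sum_congr rfl (g := fun _ => F h) (fun t ht => by rw [(mem_filter.1 ht).2])]
    simp
  rw [this]
  refine mul_le_mul_of_nonneg_right ?_ (hF h)
  have h0 := max_zero k s (IN M) (-h)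
  refine le_trans ?_ (Nat.cast_le.2 h0)
  rw [Nat.cast_le]
  apply card_le_card
  intro t ht
  rw [mem_filter] at ht ⊢
  refine ⟨ht.1, ?_⟩
  have := ht.2
  unfold Ph at this
  rw [this]; simp

/-- Dirichlet kernel sum -/
noncomputable def PP (α : ℝ) (V : ℕ) : ℝ :=
  ∑ v ∈ Icc (-(V:ℤ)) V, ‖∑ h ∈ Icc (-(V:ℤ)) V, Complex.exp (((2 * Real.pi * (α * h * v) : ℝ) : ℂ) * Complex.I)‖

lemma bx_sum (k s M : ℕ) (α : Fin k → ℝ) :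
    ∑ g ∈ bx k s M, ‖∑ h ∈ bx k s M, ev (fun j => α j * h j) g‖ = ∏ j, PP (α j) (s * M ^ (j.val + 1)) := by
  unfold PP
  have e : ∀ g h : Fin k → ℤ, ev (fun j => α j * h j) g =
      ∏ j, Complex.exp (((2 * Real.pi * (α j * h j * g j) : ℝ) : ℂ) * Complex.I) := by
    intro g h
    unfold ev
    rw [← Complex.exp_sum, ← sum_mul, ← Complex.ofReal_sum, ← mul_sum]
  rw [Finset.prod_univ_sum]
  unfold bx
  refine sum_congr rfl fun g _ => ?_
  rw [← norm_prod, Finset.prod_univ_sum]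
  congr 1
  exact sum_congr rfl fun h _ => e g h

theorem bilinear (k s M : ℕ) (hs : 0 < s) (α : Fin k → ℝ) :
    ‖∑ x ∈ IN M, ∑ y ∈ IN M, ev α (fun j => x ^ (j.val + 1) * y ^ (j.val + 1))‖ ^ (4 * s ^ 2) ≤
      (M:ℝ) ^ (8 * s ^ 2 - 4 * s) * (En k s (IN M)) ^ 2 * ∏ j, PP (α j) (s * M ^ (j.val + 1)) := by
  obtain ⟨W, hW⟩ : ∃ W, W = ∑ x ∈ IN M, ∑ y ∈ IN M, ev α (fun j => x ^ (j.val + 1) * y ^ (j.val + 1)) :=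
    ⟨_, rfl⟩
  rw [← hW]
  have hcard : #(IN M) = M := by simp [IN]
  have e1 : ∀ x y : ℤ, ev α (fun j => x ^ (j.val + 1) * y ^ (j.val + 1)) =
      ev (fun j => α j * (vk k x) j) (vk k y) := by
    intro x y
    unfold ev vk
    congr 5; ext j; push_cast; ring
  have e2 : ∀ x h : Fin k → ℤ, ev (fun j => α j * x j) h = ev (fun j => α j * h j) x := by
    intro x h
    unfold ev
    congr 5; ext j; ring
  obtain ⟨U, hU⟩ : ∃ U : (Fin k → ℤ) → ℂ, U = fun h => ∑ x ∈ IN M, ev (fun j => α j * h j) (vk k x) := ⟨_, rfl⟩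
  have s1 : ‖W‖ ^ (2 * s) ≤ (M:ℝ) ^ (2 * s - 1) * ∑ t ∈ II s M, ‖U (Ph k s t)‖ := by
    have := sum_norm_pow_le (IN M) (fun x => ∑ y ∈ IN M, ev (fun j => α j * (vk k x) j) (vk k y)) (2 * s - 1)
    rw [show 2 * s - 1 + 1 = 2 * s by omega, hcard] at this
    have hW' : W = ∑ x ∈ IN M, ∑ y ∈ IN M, ev (fun j => α j * (vk k x) j) (vk k y) := by
      rw [hW]; exact sum_congr rfl fun x _ => sum_congr rfl fun y _ => e1 x y
    rw [← hW'] at this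
    refine this.trans ?_
    gcongr
    have h3 : ((∑ x ∈ IN M, ‖∑ y ∈ IN M, ev (fun j => α j * (vk k x) j) (vk k y)‖ ^ (2 * s) : ℝ) : ℂ) =
        ∑ t ∈ II s M, U (Ph k s t) := by
      rw [Complex.ofReal_sum, hU]
      simp only [ev_expand]
      rw [sum_comm]
      exact sum_congr rfl fun t _ => sum_congr rfl fun x _ => e2 _ _
    have h4 : ∑ x ∈ IN M, ‖∑ y ∈ IN M, ev (fun j => α j * (vk k x) j) (vk k y)‖ ^ (2 * s) =
        ‖∑ t ∈ II s M, U (Ph k s t)‖ := by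
      rw [← h3, Complex.norm_real, Real.norm_of_nonneg]
      exact sum_nonneg fun _ _ => by positivity
    rw [h4]
    exact norm_sum_le _ _
  have s2 : (∑ t ∈ II s M, ‖U (Ph k s t)‖) ^ (2 * s) ≤
      ((M:ℝ) ^ (2 * s)) ^ (2 * s - 1) * (En k s (IN M) * ∑ h ∈ bx k s M, ‖U h‖ ^ (2 * s)) := by
    have := sum_norm_pow_le (II s M) (fun t => ((‖U (Ph k s t)‖ : ℝ) : ℂ)) (2 * s - 1)
    rw [show 2 * s - 1 + 1 = 2 * s by omega, card_II, ← Complex.ofReal_sum] at this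
    simp only [Complex.norm_real, norm_norm] at this
    rw [Real.norm_of_nonneg (sum_nonneg fun _ _ => norm_nonneg _)] at this
    refine this.trans ?_
    push_cast
    gcongr
    exact fib_le k s M (fun h => ‖U h‖ ^ (2 * s)) (fun _ => by positivity)
  have s3 : ∑ h ∈ bx k s M, ‖U h‖ ^ (2 * s) ≤ En k s (IN M) * ∏ j, PP (α j) (s * M ^ (j.val + 1)) := by
    rw [← bx_sum]
    have h3 : ((∑ h ∈ bx k s M, ‖U h‖ ^ (2 * s) : ℝ) : ℂ) =
        ∑ t ∈ II s M, ∑ h ∈ bx k s M, ev (fun j => α j * h j) (Ph k s t) := by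
      rw [Complex.ofReal_sum, hU]
      simp only [ev_expand]
      rw [sum_comm]
    have h4 : ∑ h ∈ bx k s M, ‖U h‖ ^ (2 * s) =
        ‖∑ t ∈ II s M, ∑ h ∈ bx k s M, ev (fun j => α j * h j) (Ph k s t)‖ := by
      rw [← h3, Complex.norm_real, Real.norm_of_nonneg]
      exact sum_nonneg fun _ _ => by positivity
    rw [h4]
    refine (norm_sum_le _ _).trans ?_
    exact fib_le k s M (fun g => ‖∑ h ∈ bx k s M, ev (fun j => α j * h j) g‖) (fun _ => norm_nonneg _)
  have hP : 0 ≤ ∑ t ∈ II s M, ‖U (Ph k s t)‖ := sum_nonneg fun _ _ => norm_nonneg _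
  calc ‖W‖ ^ (4 * s ^ 2) = (‖W‖ ^ (2 * s)) ^ (2 * s) := by rw [← pow_mul]; congr 1; ring
    _ ≤ ((M:ℝ) ^ (2 * s - 1) * ∑ t ∈ II s M, ‖U (Ph k s t)‖) ^ (2 * s) := by gcongr
    _ = ((M:ℝ) ^ (2 * s - 1)) ^ (2 * s) * (∑ t ∈ II s M, ‖U (Ph k s t)‖) ^ (2 * s) := mul_pow _ _ _
    _ ≤ ((M:ℝ) ^ (2 * s - 1)) ^ (2 * s) * (((M:ℝ) ^ (2 * s)) ^ (2 * s - 1) * (En k s (IN M) *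
          (En k s (IN M) * ∏ j, PP (α j) (s * M ^ (j.val + 1))))) := by
        refine mul_le_mul_of_nonneg_left (s2.trans ?_) (by positivity)
        gcongr
    _ = _ := by
        have : 8 * s ^ 2 - 4 * s = (2 * s - 1) * (2 * s) + (2 * s) * (2 * s - 1) := by
          obtain ⟨r, rfl⟩ : ∃ r, s = r + 1 := ⟨s - 1, by omega⟩
          rw [show 2 * (r + 1) - 1 = 2 * r + 1 by omega, Nat.sub_eq_iff_eq_add (by nlinarith)]
          ring
        rw [this, pow_add, pow_mul, pow_mul]; ring
end Wz
end

section
open Finset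
namespace Wz

lemma card_iccV (V : ℕ) : #(Icc (-(V:ℤ)) V) = 2 * V + 1 := by
  rw [Int.card_Icc]; omega

lemma pp_inner_triv (β : ℝ) (V : ℕ) :
    ‖∑ h ∈ Icc (-(V:ℤ)) V, Complex.exp (((2 * Real.pi * (β * h) : ℝ) : ℂ) * Complex.I)‖ ≤ 2 * V + 1 := by
  refine (norm_sum_le _ _).trans ?_
  simp only [Complex.norm_exp_ofReal_mul_I]
  rw [sum_const, card_iccV]; simp

lemma pp_inner_triv' (α : ℝ) (v : ℤ) (V : ℕ) :
    ‖∑ h ∈ Icc (-(V:ℤ)) V, Complex.exp (((2 * Real.pi * (α * h * v) : ℝ) : ℂ) * Complex.I)‖ ≤ 2 * V + 1 := by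
  have := pp_inner_triv (α * v) V
  simp only [mul_right_comm α (v:ℝ)] at this
  exact this

lemma pp_triv (α : ℝ) (V : ℕ) : PP α V ≤ (2 * V + 1) ^ 2 := by
  unfold PP
  calc _ ≤ ∑ v ∈ Icc (-(V:ℤ)) V, (2 * V + 1 : ℝ) := by
        refine sum_le_sum fun v _ => ?_
        exact pp_inner_triv' α v V
    _ = _ := by rw [sum_const, card_iccV]; push_cast [nsmul_eq_mul]; ring

lemma geom_int (β : ℝ) (V : ℕ) :
    (Complex.exp (((2 * Real.pi * β : ℝ) : ℂ) * Complex.I) - 1) *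
      ∑ h ∈ Icc (-(V:ℤ)) V, Complex.exp (((2 * Real.pi * (β * h) : ℝ) : ℂ) * Complex.I) =
    Complex.exp (((2 * Real.pi * (β * (V + 1)) : ℝ) : ℂ) * Complex.I) -
      Complex.exp (((2 * Real.pi * (β * (-V)) : ℝ) : ℂ) * Complex.I) := by
  induction V with
  | zero => simp
  | succ V ih =>
    have e : Icc (-((V + 1 : ℕ):ℤ)) ((V + 1 : ℕ) : ℤ) =
        insert (-((V:ℤ) + 1)) (insert ((V:ℤ) + 1) (Icc (-(V:ℤ)) V)) := by
      ext x; simp only [mem_Icc, mem_insert]; push_cast; omega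
    rw [e, sum_insert, sum_insert, mul_add, mul_add, ih]
    · simp only [sub_mul, one_mul, ← Complex.exp_add, ← add_mul, ← Complex.ofReal_add]
      push_cast
      ring_nf
    · simp only [mem_Icc]; omega
    · simp only [mem_Icc, mem_insert]; omega

lemma exp_sub_one_lower (β : ℝ) :
    4 * |β - round β| ≤ ‖Complex.exp (((2 * Real.pi * β : ℝ) : ℂ) * Complex.I) - 1‖ := by
  obtain ⟨r, hr⟩ : ∃ r : ℝ, r = β - round β := ⟨_, rfl⟩
  have hr2 : |r| ≤ 1 / 2 := by rw [hr]; exact abs_sub_round β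
  have e : Complex.exp (((2 * Real.pi * β : ℝ) : ℂ) * Complex.I) =
      Complex.exp (((2 * Real.pi * r : ℝ) : ℂ) * Complex.I) := by
    rw [Complex.exp_eq_exp_iff_exists_int]
    exact ⟨round β, by rw [hr]; push_cast; ring⟩
  rw [e, ← hr, mul_comm _ Complex.I, Complex.norm_exp_I_mul_ofReal_sub_one]
  have h := Real.mul_abs_le_abs_sin (x := 2 * Real.pi * r / 2) (by
    rw [show 2 * Real.pi * r / 2 = Real.pi * r by ring, abs_mul, abs_of_pos Real.pi_pos]
    nlinarith [Real.pi_pos])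
  rw [norm_mul, Real.norm_eq_abs, Real.norm_eq_abs, abs_two]
  have : 2 / Real.pi * |2 * Real.pi * r / 2| = 2 * |r| := by
    rw [show 2 * Real.pi * r / 2 = Real.pi * r by ring, abs_mul, abs_of_pos Real.pi_pos]
    field_simp
  linarith

lemma card_le_of_diff (S : Finset ℤ) (D : ℝ) (hD : 0 ≤ D)
    (h : ∀ a ∈ S, ∀ b ∈ S, ((a - b : ℤ) : ℝ) ≤ D) : (#S : ℝ) ≤ D + 1 := by
  rcases S.eq_empty_or_nonempty with rfl | hS
  · simp; linarith
  have hsub : S ⊆ Icc (S.min' hS) (S.max' hS) := fun x hx =>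
    mem_Icc.2 ⟨min'_le _ _ hx, le_max' _ _ hx⟩
  have h1 := card_le_card hsub
  rw [Int.card_Icc] at h1
  have h2 := h _ (S.max'_mem hS) _ (S.min'_mem hS)
  have h3 : S.min' hS ≤ S.max' hS := min'_le _ _ (max'_mem _ _)
  have h4 : (#S : ℤ) ≤ S.max' hS - S.min' hS + 1 := by omega
  have h5 : (#S : ℝ) ≤ ((S.max' hS - S.min' hS + 1 : ℤ) : ℝ) := by exact_mod_cast h4
  push_cast at h5 h2
  linarith

lemma count_close (α Δ : ℝ) (hα : α ≠ 0) (hΔ : 0 ≤ Δ) (V : ℕ) :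
    (#((Icc (-(V:ℤ)) V).filter (fun v : ℤ => |α * (v:ℝ) - round (α * (v:ℝ))| < Δ)) : ℝ) ≤
      (2 * |α| * V + 3) * (2 * Δ / |α| + 1) := by
  have hα' : 0 < |α| := abs_pos.2 hα
  obtain ⟨R, hR⟩ : ∃ R : ℕ, R = ⌊|α| * V + 1⌋₊ := ⟨_, rfl⟩
  have hR1 : (R:ℝ) ≤ |α| * V + 1 := by rw [hR]; exact Nat.floor_le (by positivity)
  have hmap : ∀ v ∈ ((Icc (-(V:ℤ)) V).filter (fun v : ℤ => |α * (v:ℝ) - round (α * (v:ℝ))| < Δ)),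
      (fun v : ℤ => round (α * (v:ℝ))) v ∈ Icc (-(R:ℤ)) R := by
    intro v hv
    simp only [mem_filter, mem_Icc] at hv
    have h1 : |(v:ℝ)| ≤ V := by rw [abs_le]; exact_mod_cast hv.1
    have h2 : |(round (α * (v:ℝ)) : ℝ)| ≤ |α| * V + 1 := by
      have a := abs_sub_round (α * (v:ℝ))
      have b : |α * (v:ℝ)| ≤ |α| * V := by rw [abs_mul]; gcongr
      have c := abs_sub_abs_le_abs_sub (round (α * (v:ℝ)) : ℝ) (α * v)
      rw [abs_sub_comm] at c
      linarith
    have h3 : ((|round (α * (v:ℝ))| : ℤ) : ℝ) ≤ |α| * V + 1 := by push_cast; exact h2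
    have h4 : |round (α * (v:ℝ))| ≤ (R:ℤ) := by
      have := Nat.le_floor (n := |round (α * (v:ℝ))|.toNat) (a := |α| * V + 1) (by
        have : ((|round (α * (v:ℝ))|.toNat : ℤ) : ℝ) ≤ |α| * V + 1 := by
          rw [Int.toNat_of_nonneg (abs_nonneg _)]; exact h3
        exact_mod_cast this)
      rw [← hR] at this
      omega
    simp only [mem_Icc]
    exact abs_le.1 h4
  rw [card_eq_sum_card_fiberwise hmap]
  push_cast
  calc _ ≤ ∑ m ∈ Icc (-(R:ℤ)) R, (2 * Δ / |α| + 1) := by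
        refine sum_le_sum fun m _ => ?_
        apply card_le_of_diff _ _ (by positivity)
        intro a ha b hb
        simp only [mem_filter] at ha hb
        rw [le_div_iff₀ hα']
        have h1 := ha.1.2; have h2 := hb.1.2
        rw [ha.2] at h1; rw [hb.2] at h2
        have : |α * ((a:ℝ) - b)| ≤ 2 * Δ := by
          rw [show α * ((a:ℝ) - b) = (α * a - m) - (α * b - m) by ring]
          refine (abs_sub _ _).trans ?_
          linarith
        rw [abs_mul] at this
        push_cast
        calc ((a:ℝ) - b) * |α| ≤ |(a:ℝ) - b| * |α| := by gcongr; exact le_abs_self _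
          _ ≤ _ := by linarith
    _ = (2 * R + 1) * (2 * Δ / |α| + 1) := by
        rw [sum_const, card_iccV]; push_cast [nsmul_eq_mul]; ring
    _ ≤ _ := by
        refine mul_le_mul_of_nonneg_right ?_ (by positivity)
        linarith

lemma pp_bound (α a : ℝ) (ha : 0 < a) (ha1 : a ≤ 1) (hα : |α| = a ^ 2) (V : ℕ) (hV : 1 ≤ V) :
    PP α V ≤ (2 * V + 1) ^ 2 * (3 * a + 5 / (a * V)) := by
  have hV' : (1:ℝ) ≤ V := by exact_mod_cast hV
  have hα0 : α ≠ 0 := by rw [← abs_pos, hα]; positivity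
  have h1 : PP α V ≤ (2 * V + 1) * ((2 * |α| * V + 3) * (2 * a / |α| + 1)) + (2 * V + 1) * (1 / (2 * a)) := by
    unfold PP
    rw [← sum_filter_add_sum_filter_not _ (fun v : ℤ => |α * (v:ℝ) - round (α * (v:ℝ))| < a)]
    apply add_le_add
    · calc _ ≤ ∑ v ∈ (Icc (-(V:ℤ)) V).filter (fun v : ℤ => |α * (v:ℝ) - round (α * (v:ℝ))| < a), (2 * V + 1 : ℝ) := by
            refine sum_le_sum fun v _ => ?_
            exact pp_inner_triv' α v V
        _ = (2 * V + 1) * (#((Icc (-(V:ℤ)) V).filter (fun v : ℤ => |α * (v:ℝ) - round (α * (v:ℝ))| < a)) : ℝ) := by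
            rw [sum_const, nsmul_eq_mul, mul_comm]
        _ ≤ _ := by
            gcongr
            exact count_close α a hα0 ha.le V
    · calc _ ≤ ∑ v ∈ (Icc (-(V:ℤ)) V).filter (fun v : ℤ => ¬ |α * (v:ℝ) - round (α * (v:ℝ))| < a), (1 / (2 * a) : ℝ) := by
            refine sum_le_sum fun v hv => ?_
            rw [mem_filter, not_lt] at hv
            have g := congrArg norm (geom_int (α * v) V)
            rw [norm_mul] at g
            have g2 := norm_sub_le (Complex.exp (((2 * Real.pi * (α * v * (V + 1)) : ℝ) : ℂ) * Complex.I))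
              (Complex.exp (((2 * Real.pi * (α * v * (-V)) : ℝ) : ℂ) * Complex.I))
            rw [← g, Complex.norm_exp_ofReal_mul_I, Complex.norm_exp_ofReal_mul_I] at g2
            have g3 := exp_sub_one_lower (α * v)
            have e : ∑ h ∈ Icc (-(V:ℤ)) V, Complex.exp (((2 * Real.pi * (α * h * v) : ℝ) : ℂ) * Complex.I) =
                ∑ h ∈ Icc (-(V:ℤ)) V, Complex.exp (((2 * Real.pi * (α * v * h) : ℝ) : ℂ) * Complex.I) := by
              refine sum_congr rfl fun h _ => ?_
              rw [mul_right_comm α (h:ℝ)]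
            rw [e, le_div_iff₀ (by positivity)]
            have g4 : 4 * a ≤ ‖Complex.exp (((2 * Real.pi * (α * v) : ℝ) : ℂ) * Complex.I) - 1‖ := by
              linarith [hv.2]
            nlinarith [norm_nonneg (∑ h ∈ Icc (-(V:ℤ)) V, Complex.exp (((2 * Real.pi * (α * v * h) : ℝ) : ℂ) * Complex.I))]
        _ = (#((Icc (-(V:ℤ)) V).filter (fun v : ℤ => ¬ |α * (v:ℝ) - round (α * (v:ℝ))| < a)) : ℝ) * (1 / (2 * a)) := by
            rw [sum_const, nsmul_eq_mul]
        _ ≤ _ := by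
            gcongr
            have := card_filter_le (Icc (-(V:ℤ)) V) (fun v : ℤ => ¬ |α * (v:ℝ) - round (α * (v:ℝ))| < a)
            rw [card_iccV] at this
            exact_mod_cast this
  refine h1.trans ?_
  rw [hα, ← mul_add, sq (2 * (V:ℝ) + 1), mul_assoc (2 * (V:ℝ) + 1)]
  have hV1 : (0:ℝ) ≤ 2 * (V:ℝ) + 1 := by positivity
  refine mul_le_mul_of_nonneg_left ?_ hV1
  have e1 : 2 * a / a ^ 2 = 2 / a := by field_simp
  rw [e1]
  have e2 : (2 * a ^ 2 * V + 3) * (2 / a + 1) + 1 / (2 * a) = 4 * a * V + 2 * a ^ 2 * V + 3 + 13 / 2 * (1 / a) := by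
    field_simp; ring
  have e3 : (2 * (V:ℝ) + 1) * (3 * a + 5 / (a * V)) = 6 * a * V + 3 * a + 10 * (1 / a) + 5 / (a * V) := by
    field_simp; ring
  rw [e2, e3]
  have i1 : 1 ≤ 1 / a := by rw [le_div_iff₀ ha]; linarith
  have i2 : a ^ 2 * V ≤ a * V := by gcongr; nlinarith
  have i3 : 0 ≤ 5 / (a * V) := by positivity
  nlinarith
end Wz
end

section
open Finset
namespace Wz

lemma pp_good {N s J M n : ℕ} {κ α : ℝ} (hN : 2 ≤ N) (hκ : 1 / 2 ≤ κ) (hs : 1 ≤ s) (hJ : 1 ≤ J)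
    (hM : M = ⌊(N:ℝ) ^ (2 / 5 : ℝ)⌋₊) (hn1 : N < n) (hn2 : n ≤ 2 * N)
    (hα : |α| = (N:ℝ) ^ κ / (2 * Real.pi * J * (n:ℝ) ^ J)) (hJ1 : 3 / 2 * κ ≤ J) (hJ2 : J ≤ 4 * κ) :
    PP α (s * M ^ J) ≤ (3 * (s * M ^ J : ℕ)) ^ 2 * 64 ^ J * (N:ℝ) ^ (-κ / 10) := by
  have hN' : (2:ℝ) ≤ N := by exact_mod_cast hN
  have hN0 : (0:ℝ) < N := by linarith
  have hNn : (N:ℝ) ≤ n := by exact_mod_cast hn1.le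
  have hn2' : (n:ℝ) ≤ 2 * N := by exact_mod_cast hn2
  have hn0 : (0:ℝ) < n := by linarith
  have hJ' : (1:ℝ) ≤ J := by exact_mod_cast hJ
  have hpi := Real.pi_gt_three
  have hpi4 := Real.pi_le_four
  have hM1 : 1 ≤ M := by
    rw [hM]; apply Nat.le_floor; push_cast
    exact Real.one_le_rpow (by linarith) (by norm_num)
  have hM2 : (N:ℝ) ^ (2 / 5 : ℝ) / 2 ≤ M := by
    have := Nat.lt_floor_add_one ((N:ℝ) ^ (2 / 5 : ℝ))
    rw [← hM] at this
    have h1 : (1:ℝ) ≤ M := by exact_mod_cast hM1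
    linarith
  obtain ⟨V, hV⟩ : ∃ V, V = s * M ^ J := ⟨_, rfl⟩
  have hV1 : 1 ≤ V := by rw [hV]; exact Nat.mul_pos hs (pow_pos hM1 _)
  have hV1' : (1:ℝ) ≤ V := by exact_mod_cast hV1
  rw [← hV]
  have hVM : ((N:ℝ) ^ (2 / 5 : ℝ) / 2) ^ J ≤ V := by
    rw [hV]; push_cast
    have h1 : (1:ℝ) ≤ s := by exact_mod_cast hs
    calc ((N:ℝ) ^ (2 / 5 : ℝ) / 2) ^ J ≤ (M:ℝ) ^ J := by gcongr
      _ ≤ s * (M:ℝ) ^ J := le_mul_of_one_le_left (by positivity) h1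
  obtain ⟨a, ha⟩ : ∃ a, a = √|α| := ⟨_, rfl⟩
  have hα0 : 0 < |α| := by rw [hα]; positivity
  have ha0 : 0 < a := by rw [ha]; exact Real.sqrt_pos.2 hα0
  have ha2 : |α| = a ^ 2 := by rw [ha, Real.sq_sqrt hα0.le]
  have hup : a ^ 2 ≤ ((N:ℝ) ^ (-κ / 10)) ^ 2 := by
    rw [← ha2, hα]
    calc (N:ℝ) ^ κ / (2 * Real.pi * J * (n:ℝ) ^ J) ≤ (N:ℝ) ^ κ / (1 * (N:ℝ) ^ J) := by
          gcongr; nlinarith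
      _ = (N:ℝ) ^ (κ - J) := by rw [one_mul, ← Real.rpow_natCast, ← Real.rpow_sub hN0]
      _ ≤ (N:ℝ) ^ (-κ / 10 * (2:ℕ)) := by
          apply Real.rpow_le_rpow_of_exponent_le (by linarith)
          push_cast; linarith
      _ = _ := by rw [Real.rpow_mul_natCast hN0.le]
  have hq0 : 0 < (N:ℝ) ^ (-κ / 10) := by positivity
  have hup' : a ≤ (N:ℝ) ^ (-κ / 10) := le_of_sq_le_sq hup hq0.le
  have hq1 : (N:ℝ) ^ (-κ / 10) ≤ 1 := Real.rpow_le_one_of_one_le_of_nonpos (by linarith) (by linarith)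
  have h8 : 2 * Real.pi * J ≤ 8 ^ J := by
    have h1 : (J:ℝ) ≤ 8 ^ (J - 1) := by
      have : J - 1 < 8 ^ (J - 1) := Nat.lt_pow_self (by norm_num)
      have h2 : J ≤ 8 ^ (J - 1) := by omega
      exact_mod_cast h2
    calc 2 * Real.pi * J ≤ 8 * 8 ^ (J - 1) := by gcongr; linarith
      _ = 8 ^ J := by rw [← pow_succ']; congr 1; omega
  have hlow : ((N:ℝ) ^ (κ / 10) / 8 ^ J) ^ 2 ≤ (a * V) ^ 2 := by
    rw [mul_pow, ← ha2, hα]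
    calc ((N:ℝ) ^ (κ / 10) / 8 ^ J) ^ 2 = (N:ℝ) ^ (κ / 5) / 8 ^ J / 8 ^ J := by
          rw [div_pow, sq ((8:ℝ) ^ J), ← div_div, ← Real.rpow_mul_natCast hN0.le]
          rw [show κ / 10 * ((2:ℕ):ℝ) = κ / 5 by push_cast; ring]
      _ ≤ (N:ℝ) ^ (κ - J / 5) / 8 ^ J / 8 ^ J := by
          gcongr
          · linarith
          · linarith
      _ = (N:ℝ) ^ κ / (8 ^ J * (2 * N) ^ J) * (((N:ℝ) ^ (2 / 5 : ℝ) / 2) ^ J) ^ 2 := by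
          have e1 : (N:ℝ) ^ (κ - J / 5) = (N:ℝ) ^ κ / (N:ℝ) ^ J * ((N:ℝ) ^ (2 / 5 : ℝ)) ^ (J * 2) := by
            rw [← Real.rpow_mul_natCast hN0.le, ← Real.rpow_natCast (N:ℝ) J, ← Real.rpow_sub hN0,
              ← Real.rpow_add hN0]
            congr 1; push_cast; ring
          rw [e1, ← pow_mul, div_pow, mul_pow]
          have e2 : (8:ℝ) ^ J = 2 ^ J * 2 ^ (J * 2) := by
            rw [← pow_add, show (8:ℝ) = 2 ^ 3 by norm_num, ← pow_mul]; congr 1; ring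
          rw [e2]; field_simp
      _ ≤ (N:ℝ) ^ κ / (2 * Real.pi * J * (n:ℝ) ^ J) * (V:ℝ) ^ 2 := by gcongr
  have hlow' : (N:ℝ) ^ (κ / 10) / 8 ^ J ≤ a * V := le_of_sq_le_sq hlow (by positivity)
  have h1 := pp_bound α a ha0 (hup'.trans hq1) ha2 V hV1
  have h2 : 5 / (a * V) ≤ 5 * 8 ^ J * (N:ℝ) ^ (-κ / 10) := by
    calc 5 / (a * V) ≤ 5 / ((N:ℝ) ^ (κ / 10) / 8 ^ J) := by gcongr
      _ = _ := by rw [neg_div, Real.rpow_neg hN0.le]; field_simp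
  refine h1.trans ?_
  have h64 : (8:ℝ) * 8 ^ J ≤ 64 ^ J := by
    rw [show (64:ℝ) = 8 * 8 by norm_num, mul_pow]
    gcongr
    exact le_self_pow₀ (by norm_num) (by omega)
  have h8' : (1:ℝ) ≤ 8 ^ J := one_le_pow₀ (by norm_num)
  rw [mul_assoc]
  gcongr
  · linarith
  · nlinarith

lemma count_good {κ : ℝ} (hκ : 1 / 2 ≤ κ) {k : ℕ} (hk : k = ⌈5 * κ⌉₊) :
    κ / 2 ≤ (#{j : Fin k | 3 / 2 * κ ≤ ((j.val + 1 : ℕ) : ℝ) ∧ ((j.val + 1 : ℕ) : ℝ) ≤ 4 * κ} : ℝ) := by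
  obtain ⟨a, ha⟩ : ∃ a, a = ⌈3 / 2 * κ⌉₊ := ⟨_, rfl⟩
  obtain ⟨b, hb⟩ : ∃ b, b = ⌊4 * κ⌋₊ := ⟨_, rfl⟩
  have ha1 : (a:ℝ) < 3 / 2 * κ + 1 := by rw [ha]; exact Nat.ceil_lt_add_one (by linarith)
  have hb1 : 4 * κ < b + 1 := by rw [hb]; exact Nat.lt_floor_add_one _
  have hb2 : (b:ℝ) ≤ 4 * κ := by rw [hb]; exact Nat.floor_le (by linarith)
  have hk1 : 5 * κ ≤ k := by rw [hk]; exact Nat.le_ceil _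
  have ha0 : 1 ≤ a := by rw [ha]; exact Nat.one_le_ceil_iff.2 (by linarith)
  have hbk : b ≤ k := by
    have : (b:ℝ) ≤ k := by linarith
    exact_mod_cast this
  have hsub : Icc a b ⊆ ({j : Fin k | 3 / 2 * κ ≤ ((j.val + 1 : ℕ) : ℝ) ∧ ((j.val + 1 : ℕ) : ℝ) ≤ 4 * κ} :
      Finset (Fin k)).image (fun j => j.val + 1) := by
    intro x hx
    rw [mem_Icc] at hx
    rw [mem_image]
    refine ⟨⟨x - 1, by omega⟩, ?_, by simp; omega⟩
    rw [mem_filter]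
    refine ⟨mem_univ _, ?_⟩
    have : x - 1 + 1 = x := by omega
    simp only [this]
    constructor
    · exact (Nat.le_ceil _).trans (by rw [← ha]; exact_mod_cast hx.1)
    · exact le_trans (by exact_mod_cast hx.2) hb2
  have h := (card_le_card hsub).trans card_image_le
  rw [Nat.card_Icc] at h
  have h2 : ((b + 1 - a : ℕ) : ℝ) ≤ _ := Nat.cast_le.2 h
  refine le_trans ?_ h2
  have h3 : (b:ℝ) + 1 - a ≤ ((b + 1 - a : ℕ) : ℝ) := by
    rw [sub_le_iff_le_add]
    exact_mod_cast (by omega : b + 1 ≤ b + 1 - a + a)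
  linarith

lemma prod_pp {N k M n s : ℕ} {κ : ℝ} (hN : 2 ≤ N) (hκ : 1 / 2 ≤ κ) (hk : k = ⌈5 * κ⌉₊) (hs : 1 ≤ s)
    (hM : M = ⌊(N:ℝ) ^ (2 / 5 : ℝ)⌋₊) (hn1 : N < n) (hn2 : n ≤ 2 * N) (α : Fin k → ℝ)
    (hα : ∀ j, |α j| = (N:ℝ) ^ κ / (2 * Real.pi * (j.val + 1 : ℕ) * (n:ℝ) ^ (j.val + 1))) :
    ∏ j, PP (α j) (s * M ^ (j.val + 1)) ≤
      ((3 * (s:ℝ)) ^ 2 * 64 ^ k) ^ k * (M:ℝ) ^ (k * (k + 1)) * (N:ℝ) ^ (-κ ^ 2 / 20) := by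
  classical
  have hN' : (2:ℝ) ≤ N := by exact_mod_cast hN
  have hN0 : (0:ℝ) < N := by linarith
  have hM1 : 1 ≤ M := by
    rw [hM]; apply Nat.le_floor; push_cast
    exact Real.one_le_rpow (by linarith) (by norm_num)
  obtain ⟨G, hG⟩ : ∃ G : Finset (Fin k), G =
    ({j : Fin k | 3 / 2 * κ ≤ ((j.val + 1 : ℕ) : ℝ) ∧ ((j.val + 1 : ℕ) : ℝ) ≤ 4 * κ} : Finset (Fin k)) := ⟨_, rfl⟩
  have hg := count_good hκ hk
  rw [← hG] at hg
  have hj : ∀ j : Fin k, PP (α j) (s * M ^ (j.val + 1)) ≤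
      ((3 * (s:ℝ)) ^ 2 * 64 ^ k) * (M:ℝ) ^ (2 * (j.val + 1)) * (if j ∈ G then (N:ℝ) ^ (-κ / 10) else 1) := by
    intro j
    have e : (3 * ((s * M ^ (j.val + 1) : ℕ) : ℝ)) ^ 2 = (3 * (s:ℝ)) ^ 2 * (M:ℝ) ^ (2 * (j.val + 1)) := by
      push_cast; rw [mul_comm 2 (j.val + 1), pow_mul]; ring
    split_ifs with hjG
    · rw [hG, mem_filter] at hjG
      refine (pp_good hN hκ hs (by omega) hM hn1 hn2 (hα j) hjG.2.1 hjG.2.2).trans ?_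
      rw [e]
      have : (64:ℝ) ^ (j.val + 1) ≤ 64 ^ k := pow_le_pow_right₀ (by norm_num) j.isLt
      calc _ ≤ (3 * (s:ℝ)) ^ 2 * (M:ℝ) ^ (2 * (j.val + 1)) * 64 ^ k * (N:ℝ) ^ (-κ / 10) := by gcongr
        _ = _ := by ring
    · refine (pp_triv _ _).trans ?_
      have hV1 : 1 ≤ s * M ^ (j.val + 1) := Nat.mul_pos hs (pow_pos hM1 _)
      have hV1' : (1:ℝ) ≤ (s * M ^ (j.val + 1) : ℕ) := by exact_mod_cast hV1
      calc _ ≤ (3 * ((s * M ^ (j.val + 1) : ℕ) : ℝ)) ^ 2 := by gcongr; linarith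
        _ = (3 * (s:ℝ)) ^ 2 * 1 * (M:ℝ) ^ (2 * (j.val + 1)) := by rw [e]; ring
        _ ≤ (3 * (s:ℝ)) ^ 2 * 64 ^ k * (M:ℝ) ^ (2 * (j.val + 1)) := by
            gcongr; exact one_le_pow₀ (by norm_num)
        _ = _ := by ring
  have hP0 : ∀ j : Fin k, 0 ≤ PP (α j) (s * M ^ (j.val + 1)) := fun j =>
    sum_nonneg fun _ _ => norm_nonneg _
  refine (prod_le_prod (fun j _ => hP0 j) (fun j _ => hj j)).trans ?_
  rw [prod_mul_distrib, prod_mul_distrib, prod_const, card_univ, Fintype.card_fin, prod_pow_eq_pow_sum]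
  have e1 : ∑ j : Fin k, 2 * (j.val + 1) = k * (k + 1) := by
    rw [Fin.sum_univ_eq_sum_range (fun j => 2 * (j + 1)) k]
    clear * -
    induction k with
    | zero => simp
    | succ k ih => rw [sum_range_succ, ih]; ring
  rw [e1]
  gcongr
  rw [prod_ite_mem, univ_inter, prod_const, ← Real.rpow_mul_natCast hN0.le]
  apply Real.rpow_le_rpow_of_exponent_le (by linarith)
  nlinarith

theorem W_bound {N k M n : ℕ} {κ : ℝ} (hN : 2 ≤ N) (hκ : 1 / 2 ≤ κ) (hk : k = ⌈5 * κ⌉₊)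
    (hM : M = ⌊(N:ℝ) ^ (2 / 5 : ℝ)⌋₊) (hn1 : N < n) (hn2 : n ≤ 2 * N) (α : Fin k → ℝ)
    (hα : ∀ j, |α j| = (N:ℝ) ^ κ / (2 * Real.pi * (j.val + 1 : ℕ) * (n:ℝ) ^ (j.val + 1))) :
    ‖∑ x ∈ IN M, ∑ y ∈ IN M, ev α (fun j => x ^ (j.val + 1) * y ^ (j.val + 1))‖ ≤
      8 * (M:ℝ) ^ 2 * (N:ℝ) ^ (-1 / (1177600 * (k:ℝ) ^ 2)) := by
  have hN' : (2:ℝ) ≤ N := by exact_mod_cast hN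
  have hN0 : (0:ℝ) < N := by linarith
  have hM1 : 1 ≤ M := by
    rw [hM]; apply Nat.le_floor; push_cast
    exact Real.one_le_rpow (by linarith) (by norm_num)
  have hM1' : (1:ℝ) ≤ M := by exact_mod_cast hM1
  have hM0 : (0:ℝ) < M := by linarith
  have hMN : (M:ℝ) ≤ (N:ℝ) ^ (2 / 5 : ℝ) := by rw [hM]; exact Nat.floor_le (by positivity)
  have hk3 : 3 ≤ k := by
    have : (2:ℝ) < k := by
      have : 5 * κ ≤ k := by rw [hk]; exact Nat.le_ceil _
      linarith
    exact_mod_cast this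
  have hk0 : (0:ℝ) < k := by exact_mod_cast (by omega : 0 < k)
  have hk7 : (k:ℝ) ≤ 7 * κ := by
    have : (k:ℝ) < 5 * κ + 1 := by rw [hk]; exact Nat.ceil_lt_add_one (by linarith)
    linarith
  obtain ⟨s, hs⟩ : ∃ s, s = 8 * k ^ 2 := ⟨_, rfl⟩
  have hs0 : 0 < s := by rw [hs]; positivity
  have hsR : (s:ℝ) = 8 * (k:ℝ) ^ 2 := by rw [hs]; push_cast; ring
  have hbil := bilinear k s M hs0 α
  have hprod := prod_pp (s := s) hN hκ hk hs0 hM hn1 hn2 α hα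
  have hJ := vmvt (k := k) (by omega) M hM1
  rw [← hs] at hJ
  apply le_of_pow_le_pow_left₀ (n := 4 * s ^ 2) (by positivity) (by positivity)
  refine hbil.trans ?_
  have hc : ((3 * (s:ℝ)) ^ 2 * 64 ^ k) ^ k ≤ 2 ^ (15 * k ^ 4) := by
    have h1 : (3 * s) ^ 2 * 64 ^ k ≤ 2 ^ (15 * k) := by
      calc (3 * s) ^ 2 * 64 ^ k ≤ (2 ^ 5 * (2 ^ k) ^ 2) ^ 2 * (2 ^ 6) ^ k := by
            have h3 : 3 * s ≤ 2 ^ 5 * (2 ^ k) ^ 2 := by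
              rw [hs, ← mul_assoc]
              exact Nat.mul_le_mul (by norm_num) (Nat.pow_le_pow_left (two_pow_ge k) 2)
            have h4 : (64:ℕ) = 2 ^ 6 := by norm_num
            rw [h4]
            gcongr
        _ = 2 ^ (10 + 10 * k) := by rw [mul_pow, ← pow_mul, ← pow_mul, ← pow_mul, ← pow_mul, ← pow_add, ← pow_add]
                                    congr 1; ring
        _ ≤ _ := Nat.pow_le_pow_right (by norm_num) (by omega)
    have : ((3 * s) ^ 2 * 64 ^ k) ^ k ≤ 2 ^ (15 * k ^ 4) := by
      calc ((3 * s) ^ 2 * 64 ^ k) ^ k ≤ (2 ^ (15 * k)) ^ k := Nat.pow_le_pow_left h1 k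
        _ = 2 ^ (15 * k ^ 2) := by rw [← pow_mul]; congr 1; ring
        _ ≤ _ := Nat.pow_le_pow_right (by norm_num) (by gcongr <;> omega)
    exact_mod_cast this
  have hMk : (M:ℝ) ^ ((k:ℝ) ^ 2 / 500) ≤ (N:ℝ) ^ ((k:ℝ) ^ 2 / 1250) := by
    calc (M:ℝ) ^ ((k:ℝ) ^ 2 / 500) ≤ ((N:ℝ) ^ (2 / 5 : ℝ)) ^ ((k:ℝ) ^ 2 / 500) := by gcongr
      _ = _ := by rw [← Real.rpow_mul hN0.le]; congr 1; ring
  have hMM : (M:ℝ) ^ (8 * s ^ 2 - 4 * s) * (M:ℝ) ^ (k * (k + 1)) *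
      ((M:ℝ) ^ (2 * (s:ℝ) - k * (k + 1) / 2 + (k:ℝ) ^ 2 / 1000 : ℝ)) ^ 2 =
      (M:ℝ) ^ (8 * s ^ 2) * (M:ℝ) ^ ((k:ℝ) ^ 2 / 500) := by
    have hle : 4 * s ≤ 8 * s ^ 2 := by nlinarith
    rw [← Real.rpow_mul_natCast hM0.le, ← Real.rpow_natCast (M:ℝ) (8 * s ^ 2 - 4 * s), ← Real.rpow_natCast (M:ℝ) (k * (k + 1)),
      ← Real.rpow_natCast (M:ℝ) (8 * s ^ 2),
      ← Real.rpow_add hM0, ← Real.rpow_add hM0, ← Real.rpow_add hM0]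
    congr 1; push_cast [Nat.cast_sub hle]; ring
  have hNN : (N:ℝ) ^ ((k:ℝ) ^ 2 / 1250) * (N:ℝ) ^ (-κ ^ 2 / 20) ≤
      ((N:ℝ) ^ (-1 / (1177600 * (k:ℝ) ^ 2))) ^ (4 * s ^ 2) := by
    rw [← Real.rpow_add hN0, ← Real.rpow_mul_natCast hN0.le]
    apply Real.rpow_le_rpow_of_exponent_le (by linarith)
    have : -1 / (1177600 * (k:ℝ) ^ 2) * ((4 * s ^ 2 : ℕ) : ℝ) = - (k:ℝ) ^ 2 / 4600 := by
      push_cast; rw [hsR]; field_simp; norm_num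
    rw [this]
    have : (k:ℝ) ^ 2 ≤ 49 * κ ^ 2 := by nlinarith
    nlinarith [sq_nonneg (k:ℝ)]
  calc (M:ℝ) ^ (8 * s ^ 2 - 4 * s) * (En k s (IN M)) ^ 2 * ∏ j, PP (α j) (s * M ^ (j.val + 1))
      ≤ (M:ℝ) ^ (8 * s ^ 2 - 4 * s) * (2 ^ (283 * k ^ 4) *
          (M:ℝ) ^ (2 * (s:ℝ) - k * (k + 1) / 2 + (k:ℝ) ^ 2 / 1000 : ℝ)) ^ 2 *
          (2 ^ (15 * k ^ 4) * (M:ℝ) ^ (k * (k + 1)) * (N:ℝ) ^ (-κ ^ 2 / 20)) := by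
        have hP0 : 0 ≤ ∏ j, PP (α j) (s * M ^ (j.val + 1)) :=
          prod_nonneg fun j _ => sum_nonneg fun _ _ => norm_nonneg _
        have hprod' := hprod.trans (mul_le_mul_of_nonneg_right (mul_le_mul_of_nonneg_right hc
          (by positivity)) (by positivity))
        gcongr
    _ = (2 ^ (283 * k ^ 4)) ^ 2 * 2 ^ (15 * k ^ 4) * ((M:ℝ) ^ (8 * s ^ 2 - 4 * s) * (M:ℝ) ^ (k * (k + 1)) *
      ((M:ℝ) ^ (2 * (s:ℝ) - k * (k + 1) / 2 + (k:ℝ) ^ 2 / 1000 : ℝ)) ^ 2) * (N:ℝ) ^ (-κ ^ 2 / 20) := by ring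
    _ = (2 ^ (283 * k ^ 4)) ^ 2 * 2 ^ (15 * k ^ 4) * ((M:ℝ) ^ (8 * s ^ 2) * (M:ℝ) ^ ((k:ℝ) ^ 2 / 500)) *
         (N:ℝ) ^ (-κ ^ 2 / 20) := by rw [hMM]
    _ ≤ 8 ^ (4 * s ^ 2) * ((M:ℝ) ^ (8 * s ^ 2) * (N:ℝ) ^ ((k:ℝ) ^ 2 / 1250)) * (N:ℝ) ^ (-κ ^ 2 / 20) := by
        gcongr
        rw [← pow_mul, ← pow_add, show (8:ℝ) = 2 ^ 3 by norm_num, ← pow_mul]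
        apply pow_le_pow_right₀ (by norm_num)
        rw [hs]; ring_nf; omega
    _ = 8 ^ (4 * s ^ 2) * (M:ℝ) ^ (8 * s ^ 2) * ((N:ℝ) ^ ((k:ℝ) ^ 2 / 1250) * (N:ℝ) ^ (-κ ^ 2 / 20)) := by ring
    _ ≤ 8 ^ (4 * s ^ 2) * (M:ℝ) ^ (8 * s ^ 2) * ((N:ℝ) ^ (-1 / (1177600 * (k:ℝ) ^ 2))) ^ (4 * s ^ 2) := by gcongr
    _ = _ := by
        rw [mul_pow, mul_pow, ← pow_mul (M:ℝ)]; congr 3; ring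
end Wz
end

section
open Finset
namespace Wz

lemma shift_one (g : ℕ → ℂ) (N N' : ℕ) (h : N ≤ N') :
    ∑ n ∈ Ioc N N', g n - ∑ n ∈ Ioc N N', g (n + 1) = g (N + 1) - g (N' + 1) := by
  induction N', h using Nat.le_induction with
  | base => simp
  | succ m hm ih =>
    rw [sum_Ioc_succ_top (by omega), sum_Ioc_succ_top (by omega)]
    linear_combination ih

lemma shift_h (g : ℕ → ℂ) (hg : ∀ n, ‖g n‖ ≤ 1) (N N' : ℕ) (hN : N ≤ N') (h : ℕ) :
    ‖∑ n ∈ Ioc N N', g n - ∑ n ∈ Ioc N N', g (n + h)‖ ≤ 2 * h := by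
  induction h with
  | zero => simp
  | succ h ih =>
    have h1 := shift_one (fun n => g (n + h)) N N' hN
    have e : ∑ n ∈ Ioc N N', g n - ∑ n ∈ Ioc N N', g (n + (h + 1)) =
        (∑ n ∈ Ioc N N', g n - ∑ n ∈ Ioc N N', g (n + h)) + (g (N + 1 + h) - g (N' + 1 + h)) := by
      rw [← h1]
      have : ∀ n, n + (h + 1) = n + 1 + h := fun n => by ring
      simp only [this]; ring
    rw [e]
    refine (norm_add_le _ _).trans ?_
    have := (norm_sub_le (g (N + 1 + h)) (g (N' + 1 + h))).trans (add_le_add (hg _) (hg _))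
    push_cast; linarith

/-- n^{-it} on integers -/
noncomputable def nit (t : ℝ) (n : ℤ) : ℂ := Complex.exp (((-(t * Real.log n) : ℝ) : ℂ) * Complex.I)

lemma nit_norm (t : ℝ) (n : ℤ) : ‖nit t n‖ = 1 := Complex.norm_exp_ofReal_mul_I _

lemma average (t : ℝ) (N N' M : ℕ) (hN : N ≤ N') :
    (M:ℝ) ^ 2 * ‖∑ n ∈ Ioc N N', nit t n‖ ≤
      ∑ n ∈ Ioc N N', ‖∑ x ∈ IN M, ∑ y ∈ IN M, nit t (n + x * y)‖ + 2 * (M:ℝ) ^ 4 := by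
  have hcard : #(IN M) = M := by simp [IN]
  have h1 : ∀ x ∈ IN M, ∀ y ∈ IN M,
      ‖∑ n ∈ Ioc N N', nit t n - ∑ n ∈ Ioc N N', nit t (n + x * y)‖ ≤ 2 * (M:ℝ) ^ 2 := by
    intro x hx y hy
    simp only [IN, mem_Icc] at hx hy
    obtain ⟨a, rfl⟩ := Int.eq_ofNat_of_zero_le (by omega : 0 ≤ x)
    obtain ⟨b, rfl⟩ := Int.eq_ofNat_of_zero_le (by omega : 0 ≤ y)
    have := shift_h (fun n => nit t n) (fun n => (nit_norm t n).le) N N' hN (a * b)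
    push_cast at this
    refine this.trans ?_
    have ha : (a:ℝ) ≤ M := by exact_mod_cast hx.2
    have hb : (b:ℝ) ≤ M := by exact_mod_cast hy.2
    rw [sq]; gcongr
  have h2 : (M:ℂ) ^ 2 * ∑ n ∈ Ioc N N', nit t n =
      ∑ x ∈ IN M, ∑ y ∈ IN M, (∑ n ∈ Ioc N N', nit t n - ∑ n ∈ Ioc N N', nit t (n + x * y)) +
      ∑ n ∈ Ioc N N', ∑ x ∈ IN M, ∑ y ∈ IN M, nit t (n + x * y) := by
    simp only [sum_sub_distrib, sum_const, hcard]
    rw [sum_comm (s := Ioc N N')]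
    have : ∀ x ∈ IN M, ∑ n ∈ Ioc N N', ∑ y ∈ IN M, nit t (n + x * y) =
        ∑ y ∈ IN M, ∑ n ∈ Ioc N N', nit t (n + x * y) := fun x _ => sum_comm
    rw [sum_congr rfl this]
    simp only [nsmul_eq_mul]; ring
  have h3 : (M:ℝ) ^ 2 * ‖∑ n ∈ Ioc N N', nit t n‖ = ‖(M:ℂ) ^ 2 * ∑ n ∈ Ioc N N', nit t n‖ := by
    rw [norm_mul, norm_pow, Complex.norm_natCast]
  rw [h3, h2]
  refine (norm_add_le _ _).trans ?_
  rw [add_comm]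
  gcongr
  · exact norm_sum_le _ _
  · calc _ ≤ ∑ x ∈ IN M, ∑ y ∈ IN M, 2 * (M:ℝ) ^ 2 := by
          refine (norm_sum_le _ _).trans (sum_le_sum fun x hx => ?_)
          exact (norm_sum_le _ _).trans (sum_le_sum fun y hy => h1 x hx y hy)
      _ = _ := by simp only [sum_const, hcard, nsmul_eq_mul]; ring

lemma exp_lip (a b : ℝ) : ‖Complex.exp ((a:ℂ) * Complex.I) - Complex.exp ((b:ℂ) * Complex.I)‖ ≤ |a - b| := by
  have h := Real.norm_exp_I_mul_ofReal_sub_one_le (x := a - b)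
  have e : Complex.exp ((a:ℂ) * Complex.I) - Complex.exp ((b:ℂ) * Complex.I) =
      Complex.exp ((b:ℂ) * Complex.I) * (Complex.exp (Complex.I * ((a - b : ℝ) : ℂ)) - 1) := by
    rw [mul_sub, ← Complex.exp_add, mul_one]; congr 2; push_cast; ring
  rw [e, norm_mul, Complex.norm_exp_ofReal_mul_I, one_mul]
  exact h

/-- frequencies -/
noncomputable def al (k : ℕ) (t : ℝ) (n : ℕ) : Fin k → ℝ := fun j =>
  -(-1) ^ j.val * (t / (2 * Real.pi * (j.val + 1 : ℕ) * (n:ℝ) ^ (j.val + 1)))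

lemma taylor (k : ℕ) (t : ℝ) (ht : 0 ≤ t) (n : ℕ) (hn : 1 ≤ n) (x y : ℤ) (q : ℝ)
    (hx : 1 ≤ x) (hy : 1 ≤ y) (hu : ((x * y : ℤ) : ℝ) / n ≤ q) (hq : q ≤ 9 / 10) :
    ‖nit t (n + x * y) - nit t n * ev (al k t n) (fun j => x ^ (j.val + 1) * y ^ (j.val + 1))‖ ≤
      10 * t * q ^ (k + 1) := by
  have hn0 : (0:ℝ) < n := by exact_mod_cast hn
  obtain ⟨u, hu'⟩ : ∃ u : ℝ, u = ((x * y : ℤ) : ℝ) / n := ⟨_, rfl⟩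
  have hxy : (0:ℝ) < ((x * y : ℤ) : ℝ) := by
    have : 0 < x * y := by positivity
    exact_mod_cast this
  have hu0 : 0 < u := by rw [hu']; positivity
  rw [← hu'] at hu
  have hlog : Real.log (((n:ℤ) + x * y : ℤ) : ℝ) = Real.log n + Real.log (1 + u) := by
    rw [← Real.log_mul (by positivity) (by positivity), hu']
    congr 1; push_cast; field_simp
  have hT := Real.abs_log_sub_add_sum_range_le (x := -u) (by rw [abs_neg, abs_of_pos hu0]; linarith) k
  rw [abs_neg, abs_of_pos hu0, sub_neg_eq_add] at hT
  have hsum : 2 * Real.pi * ∑ j : Fin k, al k t n j * ((x ^ (j.val + 1) * y ^ (j.val + 1) : ℤ) : ℝ) =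
      t * ∑ i ∈ range k, (-u) ^ (i + 1) / ((i:ℝ) + 1) := by
    rw [← Fin.sum_univ_eq_sum_range (fun i => (-u) ^ (i + 1) / ((i:ℝ) + 1)) k, mul_sum, mul_sum]
    refine sum_congr rfl fun j _ => ?_
    unfold al
    have hpi := Real.pi_pos
    have hj : ((j.val:ℝ) + 1) ≠ 0 := by positivity
    rw [hu', neg_pow (((x * y : ℤ) : ℝ) / n), div_pow, pow_succ (-1 : ℝ)]
    push_cast
    rw [mul_pow]
    field_simp
  have e : nit t n * ev (al k t n) (fun j => x ^ (j.val + 1) * y ^ (j.val + 1)) =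
      Complex.exp (((-(t * Real.log n) + t * ∑ i ∈ range k, (-u) ^ (i + 1) / ((i:ℝ) + 1) : ℝ) : ℂ) * Complex.I) := by
    unfold nit ev
    rw [← Complex.exp_add, ← add_mul, ← Complex.ofReal_add, hsum]; simp
  rw [e, nit, hlog]
  refine (exp_lip _ _).trans ?_
  have e2 : -(t * (Real.log n + Real.log (1 + u))) - (-(t * Real.log n) + t * ∑ i ∈ range k, (-u) ^ (i + 1) / ((i:ℝ) + 1)) =
      -(t * (∑ i ∈ range k, (-u) ^ (i + 1) / ((i:ℝ) + 1) + Real.log (1 + u))) := by ring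
  rw [e2, abs_neg, abs_mul, abs_of_nonneg ht]
  calc t * |∑ i ∈ range k, (-u) ^ (i + 1) / ((i:ℝ) + 1) + Real.log (1 + u)| ≤ t * (u ^ (k + 1) / (1 - u)) := by gcongr
    _ ≤ t * (q ^ (k + 1) / (1 / 10)) := by
        have hq0 : 0 ≤ q := hu0.le.trans hu
        have h1 : 0 ≤ q ^ (k + 1) := by positivity
        have h2 : (1 / 10 : ℝ) ≤ 1 - u := by linarith
        gcongr
    _ = _ := by ring

lemma al_abs (k : ℕ) (t : ℝ) (ht : 0 ≤ t) (n : ℕ) (j : Fin k) :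
    |al k t n j| = t / (2 * Real.pi * (j.val + 1 : ℕ) * (n:ℝ) ^ (j.val + 1)) := by
  unfold al
  rw [abs_mul, abs_neg, abs_pow, abs_neg, abs_one, one_pow, one_mul, abs_of_nonneg]
  have := Real.pi_pos
  positivity

lemma expsum_core {N N' : ℕ} {t κ : ℝ} (hN : 2 ≤ N) (hκ : 1 / 2 ≤ κ) (ht : t = (N:ℝ) ^ κ)
    (h1 : N ≤ N') (h2 : N' ≤ 2 * N) :
    ‖∑ n ∈ Ioc N N', nit t n‖ ≤ 20 * N * (N:ℝ) ^ (-1 / (1177600 * (7 * κ) ^ 2)) := by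
  have hN' : (2:ℝ) ≤ N := by exact_mod_cast hN
  have hN0 : (0:ℝ) < N := by linarith
  obtain ⟨k, hk⟩ : ∃ k, k = ⌈5 * κ⌉₊ := ⟨_, rfl⟩
  obtain ⟨M, hM⟩ : ∃ M, M = ⌊(N:ℝ) ^ (2 / 5 : ℝ)⌋₊ := ⟨_, rfl⟩
  have ht0 : 0 ≤ t := by rw [ht]; positivity
  have hM1 : 1 ≤ M := by
    rw [hM]; apply Nat.le_floor; push_cast
    exact Real.one_le_rpow (by linarith) (by norm_num)
  have hM1' : (1:ℝ) ≤ M := by exact_mod_cast hM1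
  have hMN : (M:ℝ) ≤ (N:ℝ) ^ (2 / 5 : ℝ) := by rw [hM]; exact Nat.floor_le (by positivity)
  have hM2 : (M:ℝ) ^ 2 ≤ (N:ℝ) ^ (4 / 5 : ℝ) := by
    calc (M:ℝ) ^ 2 ≤ ((N:ℝ) ^ (2 / 5 : ℝ)) ^ 2 := by gcongr
      _ = _ := by rw [← Real.rpow_mul_natCast hN0.le]; congr 1; push_cast; norm_num
  have hk5 : 5 * κ ≤ k := by rw [hk]; exact Nat.le_ceil _
  have hk7 : (k:ℝ) ≤ 7 * κ := by
    have : (k:ℝ) < 5 * κ + 1 := by rw [hk]; exact Nat.ceil_lt_add_one (by linarith)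
    linarith
  have hk0 : (0:ℝ) < k := by linarith
  obtain ⟨q, hq⟩ : ∃ q, q = (N:ℝ) ^ (-1 / 5 : ℝ) := ⟨_, rfl⟩
  have hq9 : q ≤ 9 / 10 := by
    apply le_of_pow_le_pow_left₀ (n := 5) (by norm_num) (by norm_num)
    rw [hq, ← Real.rpow_mul_natCast hN0.le]
    norm_num
    rw [Real.rpow_neg_one]
    calc (N:ℝ)⁻¹ ≤ 2⁻¹ := by gcongr
      _ ≤ _ := by norm_num
  have hq0 : 0 ≤ q := by rw [hq]; positivity
  have hcard : #(IN M) = M := by simp [IN]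
  have hqt : t * q ^ (k + 1) ≤ (N:ℝ) ^ (-1 / 5 : ℝ) := by
    rw [ht, hq, ← Real.rpow_mul_natCast hN0.le, ← Real.rpow_add hN0]
    apply Real.rpow_le_rpow_of_exponent_le (by linarith)
    push_cast; linarith
  have hW : ∀ n ∈ Ioc N N', ‖∑ x ∈ IN M, ∑ y ∈ IN M, nit t (n + x * y)‖ ≤
      8 * (M:ℝ) ^ 2 * (N:ℝ) ^ (-1 / (1177600 * (k:ℝ) ^ 2)) + (M:ℝ) ^ 2 * (10 * (N:ℝ) ^ (-1 / 5 : ℝ)) := by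
    intro n hn
    rw [mem_Ioc] at hn
    have hb := W_bound hN hκ hk hM hn.1 (hn.2.trans h2) (al k t n) (fun j => by
      rw [al_abs k t ht0 n j, ht])
    have hn0 : (0:ℝ) < n := by
      have : (N:ℝ) < n := by exact_mod_cast hn.1
      linarith
    have hd : ‖∑ x ∈ IN M, ∑ y ∈ IN M, nit t (n + x * y) -
        nit t n * ∑ x ∈ IN M, ∑ y ∈ IN M, ev (al k t n) (fun j => x ^ (j.val + 1) * y ^ (j.val + 1))‖ ≤
        (M:ℝ) ^ 2 * (10 * (N:ℝ) ^ (-1 / 5 : ℝ)) := by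
      simp only [mul_sum, ← sum_sub_distrib]
      calc _ ≤ ∑ x ∈ IN M, ∑ y ∈ IN M, 10 * (N:ℝ) ^ (-1 / 5 : ℝ) := by
            refine (norm_sum_le _ _).trans (sum_le_sum fun x hx => ?_)
            refine (norm_sum_le _ _).trans (sum_le_sum fun y hy => ?_)
            simp only [IN, mem_Icc] at hx hy
            refine (taylor k t ht0 n (by omega) x y q hx.1 hy.1 ?_ hq9).trans ?_
            · rw [div_le_iff₀ hn0, hq]
              have hx' : (x:ℝ) ≤ M := by exact_mod_cast hx.2
              have hy' : (y:ℝ) ≤ M := by exact_mod_cast hy.2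
              have hy0 : (0:ℝ) ≤ y := by exact_mod_cast (by omega : 0 ≤ y)
              have hNn : (N:ℝ) ≤ n := by exact_mod_cast hn.1.le
              push_cast
              calc (x:ℝ) * y ≤ M * M := by gcongr
                _ = (M:ℝ) ^ 2 := by ring
                _ ≤ (N:ℝ) ^ (4 / 5 : ℝ) := hM2
                _ = (N:ℝ) ^ (-1 / 5 : ℝ) * N := by
                    rw [← Real.rpow_add_one hN0.ne']; norm_num
                _ ≤ _ := by gcongr
            · linarith
        _ = _ := by simp only [sum_const, hcard, nsmul_eq_mul]; ring
    have := norm_le_norm_add_norm_sub' (∑ x ∈ IN M, ∑ y ∈ IN M, nit t (n + x * y))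
      (nit t n * ∑ x ∈ IN M, ∑ y ∈ IN M, ev (al k t n) (fun j => x ^ (j.val + 1) * y ^ (j.val + 1)))
    rw [norm_mul, nit_norm, one_mul] at this
    linarith
  have hav := average t N N' M h1
  have hsum : ∑ n ∈ Ioc N N', ‖∑ x ∈ IN M, ∑ y ∈ IN M, nit t (n + x * y)‖ ≤
      N * (8 * (M:ℝ) ^ 2 * (N:ℝ) ^ (-1 / (1177600 * (k:ℝ) ^ 2)) + (M:ℝ) ^ 2 * (10 * (N:ℝ) ^ (-1 / 5 : ℝ))) := by
    refine (sum_le_sum hW).trans ?_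
    rw [sum_const, Nat.card_Ioc, nsmul_eq_mul]
    gcongr
    omega
  obtain ⟨Q, hQ⟩ : ∃ Q, Q = (N:ℝ) ^ (-1 / (1177600 * (7 * κ) ^ 2)) := ⟨_, rfl⟩
  have hQ1 : (N:ℝ) ^ (-1 / (1177600 * (k:ℝ) ^ 2)) ≤ Q := by
    rw [hQ]
    apply Real.rpow_le_rpow_of_exponent_le (by linarith)
    rw [neg_div, neg_div, neg_le_neg_iff]
    gcongr
  have hQ2 : (N:ℝ) ^ (-1 / 5 : ℝ) ≤ Q := by
    rw [hQ]
    apply Real.rpow_le_rpow_of_exponent_le (by linarith)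
    rw [neg_div, neg_div, neg_le_neg_iff]
    gcongr
    nlinarith
  rw [← hQ]
  have hM4 : (M:ℝ) ^ 4 ≤ (M:ℝ) ^ 2 * (N * (N:ℝ) ^ (-1 / 5 : ℝ)) := by
    have : N * (N:ℝ) ^ (-1 / 5 : ℝ) = (N:ℝ) ^ (4 / 5 : ℝ) := by
      rw [mul_comm, ← Real.rpow_add_one hN0.ne']; norm_num
    rw [this, show (M:ℝ) ^ 4 = (M:ℝ) ^ 2 * (M:ℝ) ^ 2 by ring]
    gcongr
  have hfin : (M:ℝ) ^ 2 * ‖∑ n ∈ Ioc N N', nit t n‖ ≤ (M:ℝ) ^ 2 * (20 * N * Q) := by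
    calc _ ≤ _ := hav
      _ ≤ N * (8 * (M:ℝ) ^ 2 * Q + (M:ℝ) ^ 2 * (10 * Q)) + 2 * ((M:ℝ) ^ 2 * (N * Q)) := by
          refine add_le_add (hsum.trans ?_) ?_
          · gcongr
          · gcongr
            exact hM4.trans (by gcongr)
      _ = _ := by ring
  exact le_of_mul_le_mul_left hfin (by positivity)

/-- Vinogradov bound for the zeta exponential sum -/
theorem expsum : ∃ C c : ℝ, 1 ≤ C ∧ 0 < c ∧ ∀ (N N' : ℕ) (t : ℝ), 1 ≤ N → 2 ≤ t → (N:ℝ) ≤ t ^ 2 → N ≤ N' →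
    N' ≤ 2 * N → ‖∑ n ∈ Ioc N N', nit t n‖ ≤ C * N * Real.exp (-c * Real.log N ^ 3 / Real.log t ^ 2) := by
  refine ⟨20, 1 / (1177600 * 49), by norm_num, by norm_num, ?_⟩
  intro N N' t hN ht hNt h1 h2
  rcases hN.eq_or_lt with rfl | hN2
  · simp only [Nat.cast_one, Real.log_one]
    refine (norm_sum_le _ _).trans ?_
    simp only [nit_norm, sum_const, Nat.card_Ioc, nsmul_eq_mul, mul_one]
    norm_num
    have : N' ≤ 21 := by omega
    exact_mod_cast this
  have hN' : (2:ℝ) ≤ N := by exact_mod_cast hN2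
  have hl : 0 < Real.log N := Real.log_pos (by linarith)
  have hlt : 0 < Real.log t := Real.log_pos (by linarith)
  have hκ : 1 / 2 ≤ Real.log t / Real.log N := by
    rw [le_div_iff₀ hl]
    have := Real.log_le_log (by linarith) hNt
    rw [Real.log_pow] at this
    push_cast at this
    linarith
  have := expsum_core (t := t) hN2 hκ (by
    rw [Real.rpow_def_of_pos (by linarith), mul_div_cancel₀ _ hl.ne', Real.exp_log (by linarith)]) h1 h2
  refine this.trans (le_of_eq ?_)
  rw [Real.rpow_def_of_pos (by linarith)]
  congr 2
  field_simp
  norm_num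
end Wz
end

section
open Finset
namespace Wz

/-- terms of the continuation of (s-1) zeta -/
noncomputable def bz (n : ℕ) (s : ℂ) : ℂ := (s - 1) * (n:ℂ) ^ (-s) + ((n:ℂ) + 1) ^ (1 - s) - (n:ℂ) ^ (1 - s)

lemma cpow_diff (n : ℕ) (hn : 1 ≤ n) (s : ℂ) (hs : 0 < s.re) (x : ℝ) (hx : x ∈ Set.Icc (n:ℝ) (n+1)) :
    ‖(x:ℂ) ^ (-s) - (n:ℂ) ^ (-s)‖ ≤ ‖s‖ * (n:ℝ) ^ (-s.re - 1) := by
  have hn0 : (0:ℝ) < n := by exact_mod_cast hn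
  have h := Convex.norm_image_sub_le_of_norm_hasDerivWithin_le (𝕜 := ℝ)
    (f := fun u : ℝ => (u:ℂ) ^ (-s)) (f' := fun u : ℝ => (-s) * (u:ℂ) ^ (-s - 1)) (s := Set.Icc (n:ℝ) (n+1))
    (C := ‖s‖ * (n:ℝ) ^ (-s.re - 1)) (x := (n:ℝ)) (y := x) ?_ ?_ (convex_Icc _ _) (by simp) hx
  · simp only [Complex.ofReal_natCast] at h
    refine h.trans ?_
    have : ‖x - n‖ ≤ 1 := by
      rw [Real.norm_eq_abs, abs_le]; constructor <;> linarith [hx.1, hx.2]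
    exact mul_le_of_le_one_right (by positivity) this
  · intro u hu
    have hu0 : 0 < u := hn0.trans_le hu.1
    have hs0 : -s ≠ 0 := by
      intro h0
      have := congrArg Complex.re h0
      simp at this; linarith
    exact (hasDerivAt_ofReal_cpow_const hu0.ne' hs0).hasDerivWithinAt
  · intro u hu
    have hu0 : 0 < u := hn0.trans_le hu.1
    rw [norm_mul, norm_neg, Complex.norm_cpow_eq_rpow_re_of_pos hu0]
    gcongr
    simp only [Complex.sub_re, Complex.neg_re, Complex.one_re]
    exact Real.rpow_le_rpow_of_nonpos hn0 hu.1 (by linarith)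

lemma bz_norm (n : ℕ) (hn : 1 ≤ n) (s : ℂ) (hs : 0 < s.re) :
    ‖bz n s‖ ≤ ‖s - 1‖ * (‖s‖ * (n:ℝ) ^ (-s.re - 1)) := by
  have hn0 : (0:ℝ) < n := by exact_mod_cast hn
  by_cases hs1 : s = 1
  · subst hs1; simp [bz]
  have h := Convex.norm_image_sub_le_of_norm_hasDerivWithin_le (𝕜 := ℝ)
    (f := fun u : ℝ => (u:ℂ) ^ (1-s) + (u:ℂ) * ((s - 1) * (n:ℂ)^(-s)))
    (f' := fun u : ℝ => (1-s) * (u:ℂ) ^ (1 - s - 1) + 1 * ((s - 1) * (n:ℂ)^(-s))) (s := Set.Icc (n:ℝ) (n+1))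
    (C := ‖s - 1‖ * (‖s‖ * (n:ℝ) ^ (-s.re - 1))) (x := (n:ℝ)) (y := (n:ℝ)+1) ?_ ?_ (convex_Icc _ _) (by simp) (by simp)
  · have e : ‖(n:ℝ) + 1 - n‖ = 1 := by simp
    rw [e, mul_one] at h
    refine le_trans (le_of_eq ?_) h
    congr 1
    unfold bz
    push_cast
    ring
  · intro u hu
    have hu0 : 0 < u := hn0.trans_le hu.1
    refine HasDerivAt.hasDerivWithinAt ?_
    refine HasDerivAt.add ?_ ?_
    · exact hasDerivAt_ofReal_cpow_const hu0.ne' (by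
        intro h1; apply hs1
        linear_combination -h1)
    · exact (Complex.ofRealCLM.hasDerivAt (x := u)).mul_const _
  · intro u hu
    have e : (1-s) * (u:ℂ) ^ (1 - s - 1) + 1 * ((s - 1) * (n:ℂ)^(-s)) = -((s - 1) * ((u:ℂ) ^ (-s) - (n:ℂ)^(-s))) := by
      rw [show (1:ℂ) - s - 1 = -s by ring]; ring
    rw [e, norm_neg, norm_mul]
    gcongr
    exact cpow_diff n hn s hs u hu


lemma bz_diff (n : ℕ) (hn : 1 ≤ n) : Differentiable ℂ (bz n) := by
  have h0 : (n:ℂ) ≠ 0 := by exact_mod_cast (by omega : n ≠ 0)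
  have h1 : (n:ℂ) + 1 ≠ 0 := by exact_mod_cast (by omega : n + 1 ≠ 0)
  intro s
  unfold bz
  refine DifferentiableAt.sub (DifferentiableAt.add (DifferentiableAt.mul (by fun_prop) ?_) ?_) ?_
  · exact DifferentiableAt.const_cpow (by fun_prop) (Or.inl h0)
  · exact DifferentiableAt.const_cpow (by fun_prop) (Or.inl h1)
  · exact DifferentiableAt.const_cpow (by fun_prop) (Or.inl h0)

lemma bz_summable (s : ℂ) (hs : 0 < s.re) : Summable (fun n : ℕ => bz (n + 1) s) := by
  have h : Summable (fun n : ℕ => ‖s - 1‖ * (‖s‖ * ((n + 1 : ℕ):ℝ) ^ (-s.re - 1))) := by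
    refine Summable.mul_left _ (Summable.mul_left _ ?_)
    exact (summable_nat_add_iff (f := fun n : ℕ => (n:ℝ) ^ (-s.re - 1)) 1).2 (Real.summable_nat_rpow.2 (by linarith))
  exact Summable.of_norm_bounded h (fun n => bz_norm (n+1) (by omega) s hs)

lemma bz_tsum_diff (s : ℂ) (hs : 0 < s.re) : DifferentiableAt ℂ (fun s => ∑' n : ℕ, bz (n + 1) s) s := by
  obtain ⟨ε, hε, hε2⟩ := exists_between hs
  let U : Set ℂ := {z | ε < z.re} ∩ Metric.ball 0 (‖s‖ + 1)
  have hU : IsOpen U := (isOpen_lt continuous_const Complex.continuous_re).inter Metric.isOpen_ball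
  have hsU : s ∈ U := ⟨hε2, by simp⟩
  have h : Summable (fun n : ℕ => (‖s‖ + 2) * ((‖s‖ + 1) * ((n + 1 : ℕ):ℝ) ^ (-ε - 1))) := by
    refine Summable.mul_left _ (Summable.mul_left _ ?_)
    exact (summable_nat_add_iff (f := fun n : ℕ => (n:ℝ) ^ (-ε - 1)) 1).2 (Real.summable_nat_rpow.2 (by linarith))
  have := Complex.differentiableOn_tsum_of_summable_norm (U := U) (F := fun n : ℕ => bz (n + 1)) h
    (fun n => (bz_diff (n+1) (by omega)).differentiableOn) hU (by
      intro n z hz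
      have hz1 : ‖z‖ < ‖s‖ + 1 := by simpa using hz.2
      have hz2 : ε < z.re := hz.1
      refine (bz_norm (n+1) (by omega) z (hε.trans hz.1)).trans ?_
      have h3 : ‖z - 1‖ ≤ ‖s‖ + 2 := by
        have := norm_sub_le z 1
        rw [norm_one] at this; linarith
      have h4 : ((n + 1 : ℕ):ℝ) ^ (-z.re - 1) ≤ ((n + 1 : ℕ):ℝ) ^ (-ε - 1) :=
        Real.rpow_le_rpow_of_exponent_le (by push_cast; linarith [Nat.cast_nonneg (α := ℝ) n]) (by linarith)
      gcongr)
  exact (this s hsU).differentiableAt (hU.mem_nhds hsU)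

lemma bz_partial (N : ℕ) (s : ℂ) : ∑ n ∈ range N, bz (n + 1) s =
    (s - 1) * ∑ n ∈ range N, ((n + 1 : ℕ):ℂ) ^ (-s) + ((N:ℂ) + 1) ^ (1 - s) - 1 := by
  induction N with
  | zero => simp
  | succ N ih =>
    rw [sum_range_succ, ih, sum_range_succ, bz]
    push_cast
    ring

lemma zeta1_re_gt (s : ℂ) (hs : 1 < s.re) : riemannZeta₁ s = 1 + ∑' n : ℕ, bz (n + 1) s := by
  have hs1 : s ≠ 1 := by rintro rfl; simp at hs
  have h1 := (bz_summable s (by linarith)).hasSum.tendsto_sum_nat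
  have hz := zeta_eq_tsum_one_div_nat_add_one_cpow hs
  have hsum : Summable (fun n : ℕ => 1 / ((n:ℂ) + 1) ^ s) := by
    have := (summable_nat_add_iff 1).2 (Complex.summable_one_div_nat_cpow.2 hs)
    simpa using this
  have h2 := hsum.hasSum.tendsto_sum_nat
  rw [← hz] at h2
  have h3 : Filter.Tendsto (fun N : ℕ => ((N:ℂ) + 1) ^ (1 - s)) Filter.atTop (nhds 0) := by
    rw [tendsto_zero_iff_norm_tendsto_zero]
    have : ∀ N : ℕ, ‖((N:ℂ) + 1) ^ (1 - s)‖ = ((N + 1 : ℕ):ℝ) ^ (-(s.re - 1)) := by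
      intro N
      have := Complex.norm_natCast_cpow_of_pos (n := N + 1) (by omega) (1 - s)
      push_cast at this ⊢
      rw [this]; simp
    simp only [this]
    exact (((tendsto_rpow_neg_atTop (y := s.re - 1) (by linarith)).comp tendsto_natCast_atTop_atTop).comp
      (Filter.tendsto_add_atTop_nat 1))
  have h4 : Filter.Tendsto (fun N : ℕ => ∑ n ∈ range N, bz (n + 1) s) Filter.atTop
      (nhds ((s - 1) * riemannZeta s + 0 - 1)) := by
    simp only [bz_partial]
    refine Filter.Tendsto.sub_const (Filter.Tendsto.add (Filter.Tendsto.const_mul _ ?_) h3) _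
    refine h2.congr fun N => sum_congr rfl fun n _ => ?_
    rw [Complex.cpow_neg, one_div]; push_cast; rfl
  rw [tendsto_nhds_unique h1 h4, riemannZeta_eq_inv_sub_mul hs1, mul_inv_cancel_left₀ (sub_ne_zero.2 hs1)]
  ring

lemma zeta1_eq (s : ℂ) (hs : 0 < s.re) : riemannZeta₁ s = 1 + ∑' n : ℕ, bz (n + 1) s := by
  let U : Set ℂ := {z | 0 < z.re}
  have hU : IsOpen U := isOpen_lt continuous_const Complex.continuous_re
  have h1 : AnalyticOnNhd ℂ riemannZeta₁ U :=
    differentiable_riemannZeta₁.differentiableOn.analyticOnNhd hU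
  have h2 : AnalyticOnNhd ℂ (fun s => 1 + ∑' n : ℕ, bz (n + 1) s) U := by
    refine DifferentiableOn.analyticOnNhd (fun z hz => ?_) hU
    exact ((bz_tsum_diff z hz).const_add 1).differentiableWithinAt
  have hc : IsPreconnected U := (convex_halfSpace_re_gt 0).isPreconnected
  refine h1.eqOn_of_preconnected_of_eventuallyEq h2 hc (z₀ := 2) (by simp [U]) ?_ hs
  have : {z : ℂ | 1 < z.re} ∈ nhds (2:ℂ) :=
    (isOpen_lt continuous_const Complex.continuous_re).mem_nhds (by simp)
  filter_upwards [this] with z hz using zeta1_re_gt z hz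

lemma zeta1_approx (s : ℂ) (hs : 0 < s.re) (N : ℕ) : riemannZeta₁ s =
    (s - 1) * ∑ n ∈ range N, ((n + 1 : ℕ):ℂ) ^ (-s) + ((N:ℂ) + 1) ^ (1 - s) + ∑' n : ℕ, bz (n + N + 1) s := by
  rw [zeta1_eq s hs, ← (bz_summable s hs).sum_add_tsum_nat_add N, bz_partial]
  ring

lemma tail32 (N : ℕ) : Summable (fun n : ℕ => ((n + N + 1 : ℕ):ℝ) ^ (-(3/2) : ℝ)) ∧
    ∑' n : ℕ, ((n + N + 1 : ℕ):ℝ) ^ (-(3/2) : ℝ) ≤ 4 / Real.sqrt (N + 1) := by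
  have hs : Summable (fun n : ℕ => ((n + N + 1 : ℕ):ℝ) ^ (-(3/2) : ℝ)) :=
    (summable_nat_add_iff (f := fun n : ℕ => (n:ℝ) ^ (-(3/2):ℝ)) (N+1)).2 (Real.summable_nat_rpow.2 (by norm_num))
  refine ⟨hs, hs.tsum_le_of_sum_range_le fun K => ?_⟩
  have key : ∀ K : ℕ, ∑ n ∈ range K, ((n + N + 1 : ℕ):ℝ) ^ (-(3/2) : ℝ) ≤
      4 / Real.sqrt (N + 1) - 4 / Real.sqrt (K + N + 1) := by
    intro K
    induction K with
    | zero => simp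
    | succ K ih =>
      rw [sum_range_succ]
      obtain ⟨x, hx⟩ : ∃ x : ℝ, x = (K:ℝ) + N + 1 := ⟨_, rfl⟩
      have hx1 : 1 ≤ x := by rw [hx]; linarith [Nat.cast_nonneg (α := ℝ) K, Nat.cast_nonneg (α := ℝ) N]
      have e1 : ((K + N + 1 : ℕ):ℝ) = x := by rw [hx]; push_cast; ring
      have e2 : ((K + 1 : ℕ):ℝ) + N + 1 = x + 1 := by rw [hx]; push_cast; ring
      rw [e1, e2]
      rw [← hx] at ih
      suffices h : x ^ (-(3/2):ℝ) ≤ 4 / Real.sqrt x - 4 / Real.sqrt (x + 1) by linarith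
      obtain ⟨a, ha⟩ : ∃ a, a = Real.sqrt x := ⟨_, rfl⟩
      obtain ⟨b, hb⟩ : ∃ b, b = Real.sqrt (x + 1) := ⟨_, rfl⟩
      have ha0 : 0 < a := by rw [ha]; positivity
      have hb0 : 0 < b := by rw [hb]; positivity
      have ha2 : a ^ 2 = x := by rw [ha]; exact Real.sq_sqrt (by linarith)
      have hb2 : b ^ 2 = x + 1 := by rw [hb]; exact Real.sq_sqrt (by linarith)
      have h3 : x ^ (-(3/2):ℝ) = 1 / a ^ 3 := by
        rw [Real.rpow_neg (by linarith), ← ha2, ← Real.rpow_natCast a 2, ← Real.rpow_mul ha0.le]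
        norm_num
      rw [← ha, ← hb, h3, div_sub_div _ _ ha0.ne' hb0.ne', div_le_div_iff₀ (by positivity) (by positivity)]
      have hab : a < b := by nlinarith
      have h5 : (b - a) * (b + a) = 1 := by nlinarith
      have hb3 : b ≤ 3/2 * a := by nlinarith
      -- need a * b ≤ 4 (b - a) a^3
      have h6 : b * (b + a) ≤ 4 * a ^ 2 := by nlinarith
      have h7 : b ≤ 4 * a ^ 2 * (b - a) := by
        calc b = b * (b + a) * (b - a) := by rw [mul_assoc, mul_comm (b + a), h5, mul_one]
          _ ≤ _ := by gcongr
      nlinarith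
  refine (key K).trans ?_
  have : 0 ≤ 4 / Real.sqrt ((K:ℝ) + N + 1) := by positivity
  linarith

lemma bz_tail (s : ℂ) (hs : 1/2 ≤ s.re) (N : ℕ) :
    ‖∑' n : ℕ, bz (n + N + 1) s‖ ≤ ‖s - 1‖ * (‖s‖ * (4 / Real.sqrt (N + 1))) := by
  obtain ⟨h1, h2⟩ := tail32 N
  have h3 : HasSum (fun n : ℕ => ‖s - 1‖ * (‖s‖ * ((n + N + 1 : ℕ):ℝ) ^ (-(3/2) : ℝ))) _ :=
    (h1.hasSum.mul_left ‖s‖).mul_left ‖s - 1‖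
  refine (tsum_of_norm_bounded h3 fun n => ?_).trans (by gcongr)
  refine (bz_norm _ (by omega) s (by linarith)).trans ?_
  have : ((n + N + 1 : ℕ):ℝ) ^ (-s.re - 1) ≤ ((n + N + 1 : ℕ):ℝ) ^ (-(3/2) : ℝ) :=
    Real.rpow_le_rpow_of_exponent_le (by exact_mod_cast (by omega : 1 ≤ n + N + 1)) (by linarith)
  gcongr

/-- approximation of zeta by partial sums -/
lemma zeta_approx (s : ℂ) (hs : 1/2 ≤ s.re) (hs1 : s ≠ 1) (N : ℕ) :
    ‖riemannZeta s‖ ≤ ‖∑ n ∈ range N, ((n + 1 : ℕ):ℂ) ^ (-s)‖ + ((N:ℝ) + 1) ^ (1 - s.re) / ‖s - 1‖ +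
      ‖s‖ * (4 / Real.sqrt (N + 1)) := by
  have h0 : 0 < ‖s - 1‖ := norm_pos_iff.2 (sub_ne_zero.2 hs1)
  rw [riemannZeta_eq_inv_sub_mul hs1, zeta1_approx s (by linarith) N, norm_mul, norm_inv, inv_mul_le_iff₀ h0]
  refine (norm_add₃_le).trans ?_
  have h2 : ‖((N:ℂ) + 1) ^ (1 - s)‖ = ((N:ℝ) + 1) ^ (1 - s.re) := by
    have := Complex.norm_natCast_cpow_of_pos (n := N + 1) (by omega) (1 - s)
    push_cast at this
    rw [this]; simp
  rw [h2, norm_mul]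
  have h3 := bz_tail s hs N
  have : ‖s - 1‖ * (((N:ℝ) + 1) ^ (1 - s.re) / ‖s - 1‖) = ((N:ℝ) + 1) ^ (1 - s.re) := by
    field_simp
  rw [mul_add, mul_add, this]
  gcongr

end Wz
end

section
open Finset
namespace Wz

lemma abel_bound (a : ℕ → ℝ) (z : ℕ → ℂ) (B : ℝ) (K : ℕ)
    (ha : ∀ i < K, 0 ≤ a i) (hanti : ∀ i, i + 1 < K → a (i+1) ≤ a i)
    (hB : ∀ k, k ≤ K → ‖∑ i ∈ range k, z i‖ ≤ B) :
    ‖∑ i ∈ range K, (a i : ℂ) * z i‖ ≤ a 0 * B ∨ K = 0 := by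
  rcases K with _ | K
  · right; rfl
  left
  have key : ∀ k, k ≤ K → ‖∑ i ∈ range (k+1), (a i : ℂ) * z i - a k * ∑ i ∈ range (k+1), z i‖ ≤ (a 0 - a k) * B := by
    intro k hk
    induction k with
    | zero => simp
    | succ k ih =>
      have e : ∑ i ∈ range (k+1+1), (a i : ℂ) * z i - a (k+1) * ∑ i ∈ range (k+1+1), z i =
        (∑ i ∈ range (k+1), (a i : ℂ) * z i - a k * ∑ i ∈ range (k+1), z i) +
          ((a k - a (k+1) : ℝ):ℂ) * ∑ i ∈ range (k+1), z i := by
        rw [sum_range_succ _ (k+1), sum_range_succ _ (k+1)]; push_cast; ring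
      rw [e]
      refine (norm_add_le _ _).trans ?_
      have h1 := ih (by omega)
      have h2 : 0 ≤ a k - a (k+1) := by linarith [hanti k (by omega)]
      rw [norm_mul, Complex.norm_real, Real.norm_of_nonneg h2]
      have h3 := mul_le_mul_of_nonneg_left (hB (k+1) (by omega)) h2
      linarith
  have h1 := key K le_rfl
  have h2 : ‖(a K : ℂ) * ∑ i ∈ range (K+1), z i‖ ≤ a K * B := by
    rw [norm_mul, Complex.norm_real, Real.norm_of_nonneg (ha K (by omega))]
    exact mul_le_mul_of_nonneg_left (hB _ le_rfl) (ha K (by omega))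
  have h3 := norm_add_le (∑ i ∈ range (K+1), (a i : ℂ) * z i - a K * ∑ i ∈ range (K+1), z i) ((a K : ℂ) * ∑ i ∈ range (K+1), z i)
  rw [sub_add_cancel] at h3
  linarith

lemma cpow_split (n : ℕ) (hn : 1 ≤ n) (σ t : ℝ) :
    ((n:ℕ):ℂ) ^ (-((σ:ℂ) + t * Complex.I)) = (((n:ℝ) ^ (-σ) : ℝ) : ℂ) * nit t n := by
  have hn0 : (0:ℝ) < n := by exact_mod_cast hn
  have hn1 : (n:ℂ) ≠ 0 := by exact_mod_cast hn0.ne'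
  rw [Complex.ofReal_cpow hn0.le, nit, neg_add, Complex.cpow_add _ _ hn1]
  congr 1
  · simp
  · rw [Complex.cpow_def_of_ne_zero hn1]
    congr 1
    have : Complex.log (n:ℂ) = (Real.log n : ℝ) := by
      rw [Complex.natCast_log]
    rw [this]
    push_cast
    ring

/-- one dyadic block -/
lemma dyadic (C c : ℝ) (hC : 1 ≤ C)
    (h : ∀ (N N' : ℕ) (t : ℝ), 1 ≤ N → 2 ≤ t → (N:ℝ) ≤ t ^ 2 → N ≤ N' →
      N' ≤ 2 * N → ‖∑ n ∈ Ioc N N', nit t n‖ ≤ C * N * Real.exp (-c * Real.log N ^ 3 / Real.log t ^ 2))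
    (σ t : ℝ) (hσ : 0 ≤ σ) (ht : 2 ≤ t) (N : ℕ) (hN : 1 ≤ N) (hNt : (N:ℝ) ≤ t ^ 2) :
    ‖∑ n ∈ range N, ((N + n + 1 : ℕ):ℂ) ^ (-((σ:ℂ) + t * Complex.I))‖ ≤
      C * Real.exp ((1 - σ) * Real.log N - c * Real.log N ^ 3 / Real.log t ^ 2) := by
  have hN0 : (0:ℝ) < N := by exact_mod_cast hN
  have h1 : ∑ n ∈ range N, ((N + n + 1 : ℕ):ℂ) ^ (-((σ:ℂ) + t * Complex.I)) =
      ∑ n ∈ range N, ((((N + n + 1 : ℕ):ℝ) ^ (-σ) : ℝ) : ℂ) * nit t ((N + n + 1 : ℕ):ℤ) :=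
    sum_congr rfl fun n _ => cpow_split _ (by omega) σ t
  rw [h1]
  have hmono : ∀ a b : ℕ, 1 ≤ a → a ≤ b → (b:ℝ) ^ (-σ) ≤ (a:ℝ) ^ (-σ) := by
    intro a b ha hab
    exact Real.rpow_le_rpow_of_nonpos (by exact_mod_cast ha) (by exact_mod_cast hab) (by linarith)
  have h2 := abel_bound (fun n => ((N + n + 1 : ℕ):ℝ) ^ (-σ)) (fun n => nit t ((N + n + 1 : ℕ):ℤ))
    (C * N * Real.exp (-c * Real.log N ^ 3 / Real.log t ^ 2)) N (fun i _ => by positivity)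
    (fun i _ => hmono _ _ (by omega) (by omega)) (by
      intro k hk
      have := h N (N + k) t hN ht hNt (by omega) (by omega)
      convert this using 2
      have e : Ioc N (N + k) = Ico (N + 1) (N + k + 1) := by ext; simp
      rw [e, sum_Ico_eq_sum_range]
      rw [show (N + k + 1) - (N + 1) = k by omega]
      refine sum_congr rfl fun i _ => ?_
      congr 2
      omega)
  rcases h2 with h2 | h2
  · refine h2.trans ?_
    have h3 := hmono N (N + 0 + 1) hN (by omega)
    calc _ ≤ (N:ℝ) ^ (-σ) * (C * N * Real.exp (-c * Real.log N ^ 3 / Real.log t ^ 2)) := by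
          gcongr
      _ = _ := by
          rw [Real.rpow_def_of_pos hN0, sub_eq_add_neg, Real.exp_add, sub_mul, one_mul, Real.exp_sub, Real.exp_log hN0,
            show Real.log N * -σ = -(σ * Real.log N) by ring, Real.exp_neg]
          rw [show -c * Real.log N ^ 3 / Real.log t ^ 2 = -(c * Real.log N ^ 3 / Real.log t ^ 2) by ring]
          field_simp
  · omega

lemma opt_bound (c θ L u : ℝ) (hc : 0 < c) (hθ : 0 ≤ θ) (hL : 0 < L) (hu : 0 ≤ u) :
    θ * u - c * u ^ 3 / L ^ 2 ≤ (1 / Real.sqrt c) * θ ^ (3/2 : ℝ) * L := by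
  have h0 : 0 ≤ (1 / Real.sqrt c) * θ ^ (3/2 : ℝ) * L := by positivity
  by_cases h : θ * u ≤ c * u ^ 3 / L ^ 2
  · linarith
  push Not at h
  have hu0 : 0 < u := by
    rcases hu.eq_or_lt with rfl | h'
    · simp at h
    · exact h'
  have h1 : c * u ^ 2 < θ * L ^ 2 := by
    rw [div_lt_iff₀ (by positivity)] at h
    by_contra h2
    push Not at h2
    nlinarith
  have h2 : Real.sqrt c * u ≤ Real.sqrt θ * L := by
    refine abs_le_of_sq_le_sq' ?_ (by positivity) |>.2
    rw [mul_pow, mul_pow, Real.sq_sqrt hc.le, Real.sq_sqrt hθ]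
    exact h1.le
  have hsc : 0 < Real.sqrt c := Real.sqrt_pos.2 hc
  have h3 : θ ^ (3/2 : ℝ) = θ * Real.sqrt θ := by
    rw [Real.sqrt_eq_rpow]
    rcases hθ.eq_or_lt with rfl | h'
    · norm_num
    · nth_rewrite 2 [← Real.rpow_one θ]
      rw [← Real.rpow_add h']; norm_num
  have h4 : 0 ≤ c * u ^ 3 / L ^ 2 := by positivity
  have h5 : θ * u ≤ (1 / Real.sqrt c) * θ ^ (3/2 : ℝ) * L := by
    rw [h3, show (1 / Real.sqrt c) * (θ * Real.sqrt θ) * L = θ * ((Real.sqrt θ * L) / Real.sqrt c) by ring]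
    gcongr
    rw [le_div_iff₀ hsc]; linarith
  linarith

lemma dyadic_split (f : ℕ → ℂ) (J : ℕ) : ∑ n ∈ range (2 ^ J), f (n + 1) =
    f 1 + ∑ j ∈ range J, ∑ n ∈ range (2 ^ j), f (2 ^ j + n + 1) := by
  induction J with
  | zero => simp
  | succ J ih =>
    rw [sum_range_succ, ← add_assoc, ← ih, pow_succ, mul_two, sum_range_add]

/-- Richert-type bound -/
theorem zeta_upper : ∃ C B : ℝ, 1 ≤ C ∧ 0 < B ∧ ∀ σ t : ℝ, 1/2 ≤ σ → σ ≤ 2 → 2 ≤ |t| →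
    ‖riemannZeta ((σ:ℂ) + t * Complex.I)‖ ≤
      C * Real.log |t| * Real.exp (B * (max (1 - σ) 0) ^ (3/2 : ℝ) * Real.log |t|) := by
  obtain ⟨C, c, hC, hc, h⟩ := expsum
  refine ⟨3 * C + 38, 1 / Real.sqrt c, by linarith, by positivity, ?_⟩
  have main : ∀ σ t : ℝ, 1/2 ≤ σ → σ ≤ 2 → 2 ≤ t →
    ‖riemannZeta ((σ:ℂ) + t * Complex.I)‖ ≤
      (3 * C + 38) * Real.log t * Real.exp (1 / Real.sqrt c * (max (1 - σ) 0) ^ (3/2 : ℝ) * Real.log t) := by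
    intro σ t hσ hσ2 ht
    obtain ⟨L, hL⟩ : ∃ L, L = Real.log t := ⟨_, rfl⟩
    obtain ⟨θ, hθ⟩ : ∃ θ, θ = max (1 - σ) 0 := ⟨_, rfl⟩
    have hθ0 : 0 ≤ θ := by rw [hθ]; exact le_max_right _ _
    have hl2 := Real.log_two_gt_d9
    have hL2 : Real.log 2 ≤ L := by rw [hL]; exact Real.log_le_log (by norm_num) ht
    have hL0 : 0 < L := by linarith
    obtain ⟨E, hE⟩ : ∃ E, E = Real.exp (1 / Real.sqrt c * θ ^ (3/2 : ℝ) * L) := ⟨_, rfl⟩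
    have hE1 : 1 ≤ E := by rw [hE]; exact Real.one_le_exp (by positivity)
    obtain ⟨J, hJ1, hJ2⟩ := exists_nat_pow_near (x := t ^ 2) (y := 2) (by nlinarith) (by norm_num)
    have hJL : (J:ℝ) ≤ 3 * L := by
      have := Real.log_le_log (by positivity) hJ1
      rw [Real.log_pow, Real.log_pow, ← hL] at this
      push_cast at this
      nlinarith [Nat.cast_nonneg (α := ℝ) J]
    have hre : ((σ:ℂ) + t * Complex.I).re = σ := by simp
    have him : ((σ:ℂ) + t * Complex.I).im = t := by simp
    have hs1 : ((σ:ℂ) + t * Complex.I) ≠ 1 := by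
      intro h1
      have := congrArg Complex.im h1
      rw [him] at this; simp at this; linarith
    have hz := zeta_approx ((σ:ℂ) + t * Complex.I) (by rw [hre]; exact hσ) hs1 (2 ^ J)
    have hN0 : (0:ℝ) < 2 ^ J := by positivity
    -- block sums
    have hb : ‖∑ n ∈ range (2 ^ J), ((n + 1 : ℕ):ℂ) ^ (-((σ:ℂ) + t * Complex.I))‖ ≤ 1 + J * (C * E) := by
      rw [dyadic_split (fun n => ((n : ℕ):ℂ) ^ (-((σ:ℂ) + t * Complex.I)))]
      refine (norm_add_le _ _).trans ?_
      gcongr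
      · simp
      · refine (norm_sum_le _ _).trans ?_
        refine (sum_le_card_nsmul _ _ (C * E) fun j hj => ?_).trans (by simp)
        have hj' := mem_range.1 hj
        have hjt : (((2 ^ j : ℕ)):ℝ) ≤ t ^ 2 := by
          push_cast
          exact (pow_le_pow_right₀ (by norm_num) hj'.le).trans hJ1
        refine (dyadic C c hC h σ t (by linarith) ht (2 ^ j) Nat.one_le_two_pow hjt).trans ?_
        have hu : 0 ≤ Real.log ((2 ^ j : ℕ):ℝ) := Real.log_natCast_nonneg _
        have := opt_bound c θ L (Real.log ((2 ^ j : ℕ):ℝ)) hc hθ0 hL0 hu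
        rw [hE, ← hL]
        have h3 : (1 - σ) * Real.log ((2 ^ j : ℕ):ℝ) ≤ θ * Real.log ((2 ^ j : ℕ):ℝ) := by
          gcongr
          rw [hθ]; exact le_max_left _ _
        have h4 : (1 - σ) * Real.log ((2 ^ j : ℕ):ℝ) - c * Real.log ((2 ^ j : ℕ):ℝ) ^ 3 / L ^ 2 ≤
          1 / Real.sqrt c * θ ^ (3/2 : ℝ) * L := by linarith
        gcongr
    have hp : (((2 ^ J : ℕ):ℝ) + 1) ^ (1 - ((σ:ℂ) + t * Complex.I).re) / ‖(σ:ℂ) + t * Complex.I - 1‖ ≤ 2 := by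
      rw [hre]
      have h1 : t ≤ ‖(σ:ℂ) + t * Complex.I - 1‖ := by
        have := Complex.abs_im_le_norm ((σ:ℂ) + t * Complex.I - 1)
        simp at this
        exact (le_abs_self t).trans this
      rw [div_le_iff₀ (by linarith)]
      have h2 : ((2 ^ J : ℕ):ℝ) + 1 ≤ (2 * t) ^ 2 := by push_cast; nlinarith
      have h3 : (1:ℝ) ≤ ((2 ^ J : ℕ):ℝ) + 1 := by push_cast; linarith
      calc (((2 ^ J : ℕ):ℝ) + 1) ^ (1 - σ) ≤ (((2 ^ J : ℕ):ℝ) + 1) ^ (1 / 2 : ℝ) :=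
            Real.rpow_le_rpow_of_exponent_le h3 (by linarith)
        _ ≤ ((2 * t) ^ 2) ^ (1 / 2 : ℝ) := by
            apply Real.rpow_le_rpow (by linarith) h2 (by norm_num)
        _ = 2 * t := by
            rw [← Real.sqrt_eq_rpow, Real.sqrt_sq (by linarith)]
        _ ≤ _ := by linarith
    have ht2 : ‖(σ:ℂ) + t * Complex.I‖ * (4 / Real.sqrt (((2 ^ J : ℕ):ℝ) + 1)) ≤ 16 := by
      have h1 : ‖(σ:ℂ) + t * Complex.I‖ ≤ 2 * t := by
        refine (norm_add_le _ _).trans ?_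
        rw [norm_mul, Complex.norm_I, Complex.norm_real, Complex.norm_real, Real.norm_of_nonneg (by linarith), Real.norm_of_nonneg (by linarith)]
        linarith
      have h2 : t / 2 ≤ Real.sqrt (((2 ^ J : ℕ):ℝ) + 1) := by
        apply Real.le_sqrt_of_sq_le
        push_cast
        rw [pow_succ (2:ℝ) J] at hJ2
        nlinarith
      calc _ ≤ 2 * t * (4 / (t / 2)) := by gcongr
        _ = 16 := by field_simp; norm_num
    rw [← hL, ← hθ, ← hE]
    have hJ0 : (J:ℝ) * (C * E) ≤ 3 * L * (C * E) := by gcongr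
    have hLE : 1 / 2 ≤ L * E := by nlinarith
    calc _ ≤ 1 + J * (C * E) + 2 + 16 := hz.trans (by linarith)
      _ ≤ 3 * C * (L * E) + 17 + 2 := by linarith
      _ ≤ 3 * C * (L * E) + 38 * (L * E) := by linarith
      _ = _ := by ring
  intro σ t hσ hσ2 ht
  rcases le_or_gt 0 t with h0 | h0
  · rw [abs_of_nonneg h0] at ht ⊢
    exact main σ t hσ hσ2 ht
  · rw [abs_of_neg h0] at ht ⊢
    have := main σ (-t) hσ hσ2 ht
    rw [← Complex.norm_conj, ← riemannZeta_conj] at this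
    convert this using 3
    simp

end Wz
end

section
open Finset
namespace Wz

/-- logarithm of a nonvanishing function on a ball, normalised -/
lemma exists_log (f : ℂ → ℂ) (hf : Differentiable ℂ f) (r : ℝ) (hr : 0 < r)
    (h0 : ∀ z ∈ Metric.ball (0:ℂ) r, f z ≠ 0) :
    ∃ h : ℂ → ℂ, (∀ z ∈ Metric.ball (0:ℂ) r, HasDerivAt h (deriv f z / f z) z) ∧ h 0 = 0 ∧
      ∀ z ∈ Metric.ball (0:ℂ) r, f z = f 0 * Complex.exp (h z) := by
  have hd : DifferentiableOn ℂ (fun z => deriv f z / f z) (Metric.ball (0:ℂ) r) := by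
    intro z hz
    refine (DifferentiableAt.div ?_ (hf z) (h0 z hz)).differentiableWithinAt
    exact (hf.contDiff (n := 2)).differentiable_deriv_two z
  obtain ⟨g, hg⟩ := hd.isExactOn_ball
  have h0r : (0:ℂ) ∈ Metric.ball (0:ℂ) r := by simpa using hr
  refine ⟨fun z => g z - g 0, ?_, by simp, ?_⟩
  · intro z hz
    exact (hg z hz).sub_const _
  · intro z hz
    have hder : ∀ w ∈ Metric.ball (0:ℂ) r, HasDerivAt (fun w => f w * Complex.exp (-(g w - g 0))) 0 w := by
      intro w hw
      have h1 := (hf w).hasDerivAt.mul (((hg w hw).sub_const (g 0)).neg.cexp)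
      have e : f w * (deriv f w / f w) = deriv f w := mul_div_cancel₀ _ (h0 w hw)
      have e2 : (0:ℂ) = deriv f w * Complex.exp (-(g w - g 0)) + f w * (Complex.exp (-(g w - g 0)) * -(deriv f w / f w)) := by
        linear_combination Complex.exp (-(g w - g 0)) * e
      exact HasDerivAt.congr_deriv (show HasDerivAt (fun w => f w * Complex.exp (-(g w - g 0))) (deriv f w * Complex.exp (-(g w - g 0)) + f w * (Complex.exp (-(g w - g 0)) * -(deriv f w / f w))) w from h1) e2.symm
    have hconst := (convex_ball (0:ℂ) r).is_const_of_fderivWithin_eq_zero (𝕜 := ℂ)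
      (f := fun w => f w * Complex.exp (-(g w - g 0)))
      (fun w hw => (hder w hw).differentiableAt.differentiableWithinAt) (by
        intro w hw
        rw [fderivWithin_of_isOpen Metric.isOpen_ball hw]
        rw [(hder w hw).hasFDerivAt.fderiv]
        ext; simp) hz h0r
    simp only [sub_self, neg_zero, Complex.exp_zero, mul_one] at hconst
    rw [← hconst, mul_assoc, ← Complex.exp_add]
    simp

lemma log_bound (f : ℂ → ℂ) (hf : Differentiable ℂ f) (r M : ℝ) (hr : 0 < r) (hM : 0 < M)
    (h0 : ∀ z ∈ Metric.ball (0:ℂ) r, f z ≠ 0)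
    (hb : ∀ z ∈ Metric.ball (0:ℂ) r, ‖f z‖ ≤ Real.exp M * ‖f 0‖) :
    ∃ h : ℂ → ℂ, (∀ z ∈ Metric.ball (0:ℂ) r, HasDerivAt h (deriv f z / f z) z) ∧
      (∀ z ∈ Metric.ball (0:ℂ) r, f z = f 0 * Complex.exp (h z)) ∧
      ∀ z ∈ Metric.ball (0:ℂ) r, ‖h z‖ ≤ 2 * M * ‖z‖ / (r - ‖z‖) := by
  obtain ⟨h, h1, h2, h3⟩ := exists_log f hf r hr h0
  refine ⟨h, h1, h3, fun z hz => ?_⟩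
  have h0r : (0:ℂ) ∈ Metric.ball (0:ℂ) r := by simpa using hr
  refine Complex.borelCaratheodory_zero hM (fun w hw => (h1 w hw).differentiableAt.differentiableWithinAt) ?_ hr hz h2
  intro w hw
  have h4 := hb w hw
  rw [h3 w hw, norm_mul, mul_comm, Complex.norm_exp] at h4
  have h5 : 0 < ‖f 0‖ := norm_pos_iff.2 (h0 0 h0r)
  have := le_of_mul_le_mul_right h4 h5
  exact Real.exp_le_exp.1 this

/-- logarithmic derivative, nonvanishing case -/
lemma logderiv_nonvan (f : ℂ → ℂ) (hf : Differentiable ℂ f) (r M : ℝ) (hr : 0 < r) (hM : 0 < M)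
    (h0 : ∀ z ∈ Metric.ball (0:ℂ) r, f z ≠ 0)
    (hb : ∀ z ∈ Metric.ball (0:ℂ) r, ‖f z‖ ≤ Real.exp M * ‖f 0‖) :
    ‖deriv f 0 / f 0‖ ≤ 4 * M / r := by
  obtain ⟨h, h1, h2, h3⟩ := log_bound f hf r M hr hM h0 hb
  have h0r : (0:ℂ) ∈ Metric.ball (0:ℂ) r := by simpa using hr
  rw [← (h1 0 h0r).deriv]
  have hsub : Metric.closedBall (0:ℂ) (r/2) ⊆ Metric.ball (0:ℂ) r :=
    Metric.closedBall_subset_ball (by linarith)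
  have := Complex.norm_deriv_le_of_forall_mem_sphere_norm_le (c := (0:ℂ)) (R := r/2) (C := 2 * M) (f := h) (by positivity)
    (by
      refine DifferentiableOn.diffContOnCl fun w hw => ?_
      rw [closure_ball _ (by positivity)] at hw
      exact (h1 w (hsub hw)).differentiableAt.differentiableWithinAt) (by
      intro z hz
      have hz' : ‖z‖ = r / 2 := by simpa using hz
      have h4 := h3 z (hsub (Metric.sphere_subset_closedBall hz))
      rw [hz'] at h4
      convert h4 using 1
      field_simp
      ring)
  refine this.trans (le_of_eq ?_)
  field_simp
  norm_num

/-- removing a zero by a Blaschke factor -/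
lemma remove_zero (f : ℂ → ℂ) (hf : Differentiable ℂ f) (R K : ℝ) (hR : 0 < R)
    (hb : ∀ z ∈ Metric.closedBall (0:ℂ) R, ‖f z‖ ≤ K) (h0 : f 0 ≠ 0)
    (hz : ∀ z ∈ Metric.ball (0:ℂ) R, f z = 0 → z.re < 0)
    (u : ℂ) (hu : ‖u‖ < R) (hfu : f u = 0) :
    ∃ g : ℂ → ℂ, Differentiable ℂ g ∧ (∀ z ∈ Metric.closedBall (0:ℂ) R, ‖g z‖ ≤ K) ∧ g 0 ≠ 0 ∧
      (∀ z ∈ Metric.ball (0:ℂ) R, g z = 0 → z.re < 0) ∧ ‖g 0‖ = ‖f 0‖ * (R / ‖u‖) ∧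
      deriv f 0 / f 0 = deriv g 0 / g 0 + (-1 / u + (starRingEnd ℂ) u / R ^ 2) := by
  obtain ⟨D, hD⟩ : ∃ D, D = dslope f u := ⟨_, rfl⟩
  have hDd : Differentiable ℂ D := by
    rw [hD, ← differentiableOn_univ]
    exact (Complex.differentiableOn_dslope Filter.univ_mem).2 hf.differentiableOn
  have hfD : ∀ z, f z = (z - u) * D z := by
    intro z
    have := sub_smul_dslope f u z
    rw [hfu, sub_zero, smul_eq_mul, ← hD] at this
    exact this.symm
  have hR0 : (R:ℂ) ≠ 0 := by exact_mod_cast hR.ne'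
  have hu0 : u ≠ 0 := by rintro rfl; exact h0 hfu
  have hD0 : D 0 ≠ 0 := by
    intro h; apply h0; rw [hfD, h, mul_zero]
  obtain ⟨g, hg⟩ : ∃ g : ℂ → ℂ, g = fun z => D z * ((R ^ 2 - (starRingEnd ℂ) u * z) / R) := ⟨_, rfl⟩
  have hgd : Differentiable ℂ g := by rw [hg]; fun_prop
  have hg0 : g 0 = D 0 * R := by rw [hg]; simp only [mul_zero, sub_zero]; rw [pow_two, mul_div_assoc, div_self hR0, mul_one]
  have hsph : ∀ z ∈ Metric.sphere (0:ℂ) R, ‖g z‖ ≤ K := by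
    intro z hz'
    have hzn : ‖z‖ = R := by simpa using hz'
    have := hb z (Metric.sphere_subset_closedBall hz')
    refine le_trans (le_of_eq ?_) this
    rw [hg, hfD, norm_mul, norm_mul, mul_comm]
    congr 1
    have e : (R:ℂ) ^ 2 - (starRingEnd ℂ) u * z = z * (starRingEnd ℂ) (z - u) := by
      have : z * (starRingEnd ℂ) z = (R:ℂ) ^ 2 := by
        rw [Complex.mul_conj, Complex.normSq_eq_norm_sq, hzn]; push_cast; ring
      rw [map_sub, mul_sub, this]; ring
    rw [e, norm_div, norm_mul, Complex.norm_conj, hzn, Complex.norm_real, Real.norm_of_nonneg hR.le]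
    field_simp
  refine ⟨g, hgd, ?_, ?_, ?_, ?_, ?_⟩
  · intro z hz'
    refine Complex.norm_le_of_forall_mem_frontier_norm_le (U := Metric.ball (0:ℂ) R) Metric.isBounded_ball
      hgd.diffContOnCl ?_ (by rwa [closure_ball _ hR.ne'])
    rw [frontier_ball _ hR.ne']
    exact hsph
  · rw [hg0]; exact mul_ne_zero hD0 hR0
  · intro z hz' hgz
    have hzn : ‖z‖ < R := by simpa using hz'
    apply hz z hz'
    rw [hg] at hgz
    rcases mul_eq_zero.1 hgz with h | h
    · rw [hfD, h, mul_zero]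
    · exfalso
      rw [div_eq_zero_iff] at h
      rcases h with h | h
      · have h1 : (R:ℂ) ^ 2 = (starRingEnd ℂ) u * z := by linear_combination h
        have h2 := congrArg norm h1
        rw [norm_mul, norm_pow, Complex.norm_conj, Complex.norm_real, Real.norm_of_nonneg hR.le] at h2
        nlinarith [norm_nonneg u, norm_nonneg z]
      · exact hR0 h
  · rw [hg0, hfD, norm_mul, norm_mul, zero_sub, norm_neg, Complex.norm_real, Real.norm_of_nonneg hR.le]
    have : ‖u‖ ≠ 0 := norm_ne_zero_iff.2 hu0
    field_simp
  · have d1 : deriv f 0 = D 0 + (-u) * deriv D 0 := by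
      have : HasDerivAt f (1 * D 0 + (0 - u) * deriv D 0) 0 := by
        have h1 := ((hasDerivAt_id (0:ℂ)).sub_const u).mul (hDd 0).hasDerivAt
        refine h1.congr_of_eventuallyEq (Filter.Eventually.of_forall fun z => ?_)
        exact hfD z
      rw [this.deriv]; ring
    have d2 : deriv g 0 = deriv D 0 * R + D 0 * (-(starRingEnd ℂ) u / R) := by
      have h1 : HasDerivAt (fun z : ℂ => ((R:ℂ) ^ 2 - (starRingEnd ℂ) u * z) / R) (-((starRingEnd ℂ) u * 1) / R) 0 :=
        ((((hasDerivAt_id (0:ℂ)).const_mul ((starRingEnd ℂ) u))).const_sub ((R:ℂ) ^ 2)).div_const _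
      have h2 := (hDd 0).hasDerivAt.mul h1
      have h3 : HasDerivAt g (deriv D 0 * (((R:ℂ) ^ 2 - (starRingEnd ℂ) u * 0) / R) + D 0 * (-((starRingEnd ℂ) u * 1) / R)) 0 := by
        rw [hg]; exact h2
      rw [h3.deriv]
      simp only [mul_zero, sub_zero, mul_one]
      rw [pow_two, mul_div_assoc, div_self hR0, mul_one]
    rw [d1, d2, hg0, hfD 0, zero_sub]
    field_simp
    ring

lemma blaschke_re (u : ℂ) (R : ℝ) (hu : ‖u‖ < R) (hu0 : u.re < 0) :
    0 ≤ (-1 / u + (starRingEnd ℂ) u / (R:ℂ) ^ 2).re := by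
  have hR : 0 < R := (norm_nonneg u).trans_lt hu
  have hn : 0 < ‖u‖ := norm_pos_iff.2 (by rintro rfl; simp at hu0)
  have e : (-1 / u + (starRingEnd ℂ) u / (R:ℂ) ^ 2).re = -u.re * (1 / ‖u‖ ^ 2 - 1 / R ^ 2) := by
    rw [Complex.add_re, ← Complex.ofReal_pow, Complex.div_ofReal_re, Complex.conj_re, neg_div, one_div, Complex.neg_re,
      Complex.inv_re, Complex.normSq_eq_norm_sq]
    ring
  rw [e]
  have : 1 / R ^ 2 ≤ 1 / ‖u‖ ^ 2 := by gcongr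
  nlinarith

lemma logderiv_ind (R M K : ℝ) (hR : 0 < R) (hM : 0 < M) (n : ℕ) : ∀ (f : ℂ → ℂ), Differentiable ℂ f →
    (∀ z ∈ Metric.closedBall (0:ℂ) R, ‖f z‖ ≤ K) → f 0 ≠ 0 →
    (∀ z ∈ Metric.ball (0:ℂ) R, f z = 0 → z.re < 0) → K ≤ Real.exp M * ‖f 0‖ → K < ‖f 0‖ * 2 ^ n →
    -(8 * M / R) ≤ (deriv f 0 / f 0).re := by
  induction n with
  | zero =>
    intro f hf hb h0 hz hK hn
    exfalso
    have := hb 0 (by simp [hR.le])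
    simp at hn; linarith
  | succ n ih =>
    intro f hf hb h0 hz hK hn
    by_cases hv : ∀ z ∈ Metric.ball (0:ℂ) (R/2), f z ≠ 0
    · have hsub : Metric.ball (0:ℂ) (R/2) ⊆ Metric.closedBall (0:ℂ) R :=
        Metric.ball_subset_closedBall.trans (Metric.closedBall_subset_closedBall (by linarith))
      have := logderiv_nonvan f hf (R/2) M (by positivity) hM hv (fun z hz => (hb z (hsub hz)).trans hK)
      have h2 := Complex.abs_re_le_norm (deriv f 0 / f 0)
      have h3 := neg_abs_le (deriv f 0 / f 0).re
      have e : 4 * M / (R / 2) = 8 * M / R := by field_simp; norm_num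
      linarith
    · push Not at hv
      obtain ⟨u, hu, hfu⟩ := hv
      have hu' : ‖u‖ < R / 2 := by simpa using hu
      have huR : ‖u‖ < R := by linarith
      obtain ⟨g, g1, g2, g3, g4, g5, g6⟩ := remove_zero f hf R K hR hb h0 hz u huR hfu
      have hu0 : u ≠ 0 := by rintro rfl; exact h0 hfu
      have hun : 0 < ‖u‖ := norm_pos_iff.2 hu0
      have hg : ‖f 0‖ * 2 ≤ ‖g 0‖ := by
        rw [g5]
        gcongr
        rw [le_div_iff₀ hun]; linarith
      have hf0 : 0 ≤ ‖f 0‖ := norm_nonneg _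
      have := ih g g1 g2 g3 g4 (hK.trans (by gcongr; linarith)) (hn.trans_le (by
        rw [pow_succ]
        calc ‖f 0‖ * (2 ^ n * 2) = ‖f 0‖ * 2 * 2 ^ n := by ring
          _ ≤ _ := by gcongr))
      rw [g6, Complex.add_re]
      have h3 := blaschke_re u R huR (hz u (by simpa using huR) hfu)
      linarith

/-- Lemma D, no distinguished zero -/
lemma logderiv_lower (f : ℂ → ℂ) (hf : Differentiable ℂ f) (R M K : ℝ) (hR : 0 < R) (hM : 0 < M)
    (hb : ∀ z ∈ Metric.closedBall (0:ℂ) R, ‖f z‖ ≤ K) (h0 : f 0 ≠ 0)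
    (hz : ∀ z ∈ Metric.ball (0:ℂ) R, f z = 0 → z.re < 0) (hK : K ≤ Real.exp M * ‖f 0‖) :
    -(8 * M / R) ≤ (deriv f 0 / f 0).re := by
  have hf0 : 0 < ‖f 0‖ := norm_pos_iff.2 h0
  obtain ⟨n, hn⟩ := pow_unbounded_of_one_lt (K / ‖f 0‖) (by norm_num : (1:ℝ) < 2)
  refine logderiv_ind R M K hR hM n f hf hb h0 hz hK ?_
  rwa [div_lt_iff₀ hf0, mul_comm] at hn

/-- Lemma D with a distinguished zero -/
lemma logderiv_lower_zero (f : ℂ → ℂ) (hf : Differentiable ℂ f) (R M K d : ℝ) (hR : 0 < R) (hM : 0 < M)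
    (hb : ∀ z ∈ Metric.closedBall (0:ℂ) R, ‖f z‖ ≤ K) (h0 : f 0 ≠ 0)
    (hz : ∀ z ∈ Metric.ball (0:ℂ) R, f z = 0 → z.re < 0) (hK : K ≤ Real.exp M * ‖f 0‖)
    (hd : 0 < d) (hdR : d < R) (hfd : f (-(d:ℂ)) = 0) :
    1 / d - d / R ^ 2 - 8 * M / R ≤ (deriv f 0 / f 0).re := by
  have hu : ‖(-(d:ℂ))‖ = d := by rw [norm_neg, Complex.norm_real, Real.norm_of_nonneg hd.le]
  obtain ⟨g, g1, g2, g3, g4, g5, g6⟩ := remove_zero f hf R K hR hb h0 hz (-(d:ℂ)) (by rw [hu]; exact hdR) hfd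
  rw [hu] at g5
  have hg : ‖f 0‖ ≤ ‖g 0‖ := by
    rw [g5]
    exact le_mul_of_one_le_right (norm_nonneg _) (by rw [le_div_iff₀ hd]; linarith)
  have := logderiv_lower g g1 R M K hR hM g2 g3 g4 (hK.trans (by gcongr))
  rw [g6, Complex.add_re]
  have e : (-1 / (-(d:ℂ)) + (starRingEnd ℂ) (-(d:ℂ)) / (R:ℂ) ^ 2).re = 1 / d - d / R ^ 2 := by
    have : (-1 / (-(d:ℂ)) + (starRingEnd ℂ) (-(d:ℂ)) / (R:ℂ) ^ 2) = ((1 / d - d / R ^ 2 : ℝ) : ℂ) := by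
      rw [map_neg, Complex.conj_ofReal]; push_cast; rw [neg_div_neg_eq]; ring
    rw [this, Complex.ofReal_re]
  rw [e]
  linarith

end Wz
end

section
open Finset
namespace Wz

lemma zeta1_ne_zero (s : ℂ) (hs : 1 ≤ s.re) : riemannZeta₁ s ≠ 0 := by
  by_cases h : s = 1
  · rw [h, riemannZeta₁_one]; exact one_ne_zero
  · intro h0
    apply riemannZeta_ne_zero_of_one_le_re hs
    rw [riemannZeta_eq_inv_sub_mul h, h0, mul_zero]

lemma zeta1_mul (s : ℂ) (hs : s ≠ 1) : riemannZeta₁ s = (s - 1) * riemannZeta s := by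
  rw [riemannZeta_eq_inv_sub_mul hs, ← mul_assoc, mul_inv_cancel₀ (sub_ne_zero.2 hs), one_mul]

lemma zeta_inv_eq (s : ℂ) (hs : 1 < s.re) :
    (riemannZeta s)⁻¹ = LSeries (fun n => ((ArithmeticFunction.moebius n : ℤ) : ℂ)) s := by
  have h := ArithmeticFunction.LSeries_zeta_mul_Lseries_moebius hs
  rw [ArithmeticFunction.LSeries_zeta_eq_riemannZeta hs] at h
  exact inv_eq_of_mul_eq_one_right h

lemma term_one_real (σ : ℝ) (n : ℕ) :
    ((‖LSeries.term 1 (σ:ℂ) n‖ : ℝ) : ℂ) = LSeries.term 1 (σ:ℂ) n := by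
  rw [LSeries.term_def]
  split_ifs with h
  · simp
  · have : ((n:ℂ) ^ (σ:ℂ)) = (((n:ℝ) ^ σ : ℝ) : ℂ) := by
      rw [Complex.ofReal_cpow (by positivity)]; simp
    simp only [Pi.one_apply]
    rw [this, norm_div, norm_one, Complex.norm_real, Real.norm_of_nonneg (by positivity)]
    push_cast; rfl

lemma sum_term_one (σ : ℝ) (hσ : 1 < σ) :
    ∑' n, ‖LSeries.term 1 (σ:ℂ) n‖ = ‖riemannZeta₁ σ‖ / (σ - 1) := by
  have hs : 1 < ((σ:ℂ)).re := by simpa using hσ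
  have h1 : ((∑' n, ‖LSeries.term 1 (σ:ℂ) n‖ : ℝ) : ℂ) = riemannZeta σ := by
    rw [Complex.ofReal_tsum, ← LSeries_one_eq_riemannZeta hs, LSeries]
    exact tsum_congr fun n => term_one_real σ n
  have h2 : ‖riemannZeta σ‖ = ∑' n, ‖LSeries.term 1 (σ:ℂ) n‖ := by
    rw [← h1, Complex.norm_real, Real.norm_of_nonneg (tsum_nonneg fun _ => norm_nonneg _)]
  have h3 : (σ:ℂ) ≠ 1 := by
    intro h; have : σ = 1 := by exact_mod_cast h
    linarith
  rw [← h2, zeta1_mul _ h3, norm_mul]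
  have : ‖(σ:ℂ) - 1‖ = σ - 1 := by
    rw [← Complex.ofReal_one, ← Complex.ofReal_sub, Complex.norm_real, Real.norm_of_nonneg (by linarith)]
  rw [this]
  field_simp [(by linarith : σ - 1 ≠ 0)]

lemma zeta_inv_bound : ∃ C : ℝ, 1 ≤ C ∧ ∀ σ t : ℝ, 1 < σ → σ ≤ 3 →
    ‖(riemannZeta ((σ:ℂ) + t * Complex.I))⁻¹‖ ≤ C / (σ - 1) := by
  have hc : ContinuousOn (fun σ : ℝ => ‖riemannZeta₁ (σ:ℂ)‖) (Set.Icc 1 3) :=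
    (differentiable_riemannZeta₁.continuous.comp Complex.continuous_ofReal).norm.continuousOn
  obtain ⟨C, hC⟩ := isCompact_Icc.exists_bound_of_continuousOn hc
  refine ⟨max C 1, le_max_right _ _, fun σ t h1 h3 => ?_⟩
  have hs : 1 < ((σ:ℂ) + t * Complex.I).re := by simpa using h1
  rw [zeta_inv_eq _ hs, LSeries]
  have hle : ∀ n, ‖LSeries.term (fun n => ((ArithmeticFunction.moebius n : ℤ) : ℂ)) ((σ:ℂ) + t * Complex.I) n‖
      ≤ ‖LSeries.term 1 (σ:ℂ) n‖ := by
    intro n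
    refine (LSeries.norm_term_le (g := 1) _ ?_).trans ?_
    · simp only [Pi.one_apply, norm_one, Complex.norm_intCast]
      exact_mod_cast ArithmeticFunction.abs_moebius_le_one
    · apply LSeries.norm_term_le_of_re_le_re
      simp
  have hsum : Summable (fun n => ‖LSeries.term 1 (σ:ℂ) n‖) :=
    (LSeriesSummable_one_iff.2 (by simpa using h1)).norm
  have hsum2 := Summable.of_nonneg_of_le (fun n => norm_nonneg _) hle hsum
  refine (norm_tsum_le_tsum_norm hsum2).trans ((hsum2.tsum_le_tsum hle hsum).trans ?_)
  rw [sum_term_one σ h1]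
  have := hC σ ⟨h1.le, h3⟩
  rw [norm_norm] at this
  have h0 : 0 < σ - 1 := by linarith
  gcongr
  exact this.trans (le_max_left _ _)

lemma logderiv_zeta1 (s : ℂ) (hs : 1 < s.re) :
    deriv riemannZeta₁ s / riemannZeta₁ s = 1 / (s - 1) + deriv riemannZeta s / riemannZeta s := by
  have h1 : s ≠ 1 := by rintro rfl; simp at hs
  have hz : riemannZeta s ≠ 0 := riemannZeta_ne_zero_of_one_le_re hs.le
  have hd : HasDerivAt riemannZeta₁ (1 * riemannZeta s + (s - 1) * deriv riemannZeta s) s := by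
    have := ((hasDerivAt_id s).sub_const 1).mul (differentiableAt_riemannZeta h1).hasDerivAt
    refine this.congr_of_eventuallyEq ?_
    filter_upwards [isOpen_ne.mem_nhds h1] with z hz
    exact zeta1_mul z hz
  rw [hd.deriv, zeta1_mul s h1]
  have := sub_ne_zero.2 h1
  field_simp

lemma three_four_one (σ t : ℝ) (hσ : 1 < σ) :
    (3 * (deriv riemannZeta σ / riemannZeta σ) +
      4 * (deriv riemannZeta (σ + t * Complex.I) / riemannZeta (σ + t * Complex.I)) +
      (deriv riemannZeta (σ + (2 * t : ℝ) * Complex.I) / riemannZeta (σ + (2 * t : ℝ) * Complex.I))).re ≤ 0 := by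
  have key : ∀ u : ℝ, deriv riemannZeta (σ + u * Complex.I) / riemannZeta (σ + u * Complex.I) =
      - ∑' n, LSeries.term (fun n => ((ArithmeticFunction.vonMangoldt n : ℝ) : ℂ)) (σ + u * Complex.I) n := by
    intro u
    have := ArithmeticFunction.LSeries_vonMangoldt_eq_deriv_riemannZeta_div (s := σ + u * Complex.I) (by simpa using hσ)
    rw [LSeries] at this
    rw [this]; ring
  have hsm : ∀ u : ℝ, Summable (LSeries.term (fun n => ((ArithmeticFunction.vonMangoldt n : ℝ) : ℂ)) (σ + u * Complex.I)) :=
    fun u => ArithmeticFunction.LSeriesSummable_vonMangoldt (by simpa using hσ)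
  have k0 := key 0
  have s0 := hsm 0
  rw [Complex.ofReal_zero, zero_mul, add_zero] at k0 s0
  rw [key, key, k0]
  have hre : ∀ {f : ℕ → ℂ}, Summable f → (∑' n, f n).re = ∑' n, (f n).re := fun h => Complex.re_tsum h
  have e : (3 * -∑' n, LSeries.term (fun n => ((ArithmeticFunction.vonMangoldt n : ℝ) : ℂ)) σ n +
      4 * -∑' n, LSeries.term (fun n => ((ArithmeticFunction.vonMangoldt n : ℝ) : ℂ)) (σ + t * Complex.I) n +
      -∑' n, LSeries.term (fun n => ((ArithmeticFunction.vonMangoldt n : ℝ) : ℂ)) (σ + (2 * t : ℝ) * Complex.I) n) =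
      - ∑' n, (3 * LSeries.term (fun n => ((ArithmeticFunction.vonMangoldt n : ℝ) : ℂ)) σ n +
        4 * LSeries.term (fun n => ((ArithmeticFunction.vonMangoldt n : ℝ) : ℂ)) (σ + t * Complex.I) n +
        LSeries.term (fun n => ((ArithmeticFunction.vonMangoldt n : ℝ) : ℂ)) (σ + (2 * t : ℝ) * Complex.I) n) := by
    rw [((s0.mul_left 3).add ((hsm t).mul_left 4)).tsum_add (hsm (2*t)), (s0.mul_left 3).tsum_add ((hsm t).mul_left 4),
      tsum_mul_left, tsum_mul_left]
    ring
  rw [e, Complex.neg_re, hre (((s0.mul_left 3).add ((hsm t).mul_left 4)).add (hsm (2*t)))]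
  rw [neg_nonpos]
  refine tsum_nonneg fun n => ?_
  simp only [LSeries.term_def]
  split_ifs with hn
  · simp
  have hnn : (n:ℂ) ≠ 0 := by exact_mod_cast hn
  have hΛ : 0 ≤ ArithmeticFunction.vonMangoldt n := ArithmeticFunction.vonMangoldt_nonneg
  have hns : ((n:ℂ) ^ (σ:ℂ)) = (((n:ℝ) ^ σ : ℝ) : ℂ) := by
    rw [Complex.ofReal_cpow (by positivity)]; simp
  obtain ⟨a, ha⟩ : ∃ a : ℝ, a = ArithmeticFunction.vonMangoldt n / (n:ℝ) ^ σ := ⟨_, rfl⟩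
  have ha0 : 0 ≤ a := by rw [ha]; positivity
  obtain ⟨θ, hθ⟩ : ∃ θ : ℝ, θ = -t * Real.log n := ⟨_, rfl⟩
  have hc : ∀ u : ℝ, ((ArithmeticFunction.vonMangoldt n : ℝ) : ℂ) / (n:ℂ) ^ ((σ:ℂ) + u * Complex.I) =
      (a:ℂ) * Complex.exp ((-u * Real.log n : ℝ) * Complex.I) := by
    intro u
    rw [Complex.cpow_add _ _ hnn, hns, ha, Complex.cpow_def_of_ne_zero hnn, ← Complex.natCast_log]
    rw [div_mul_eq_div_div, div_eq_mul_inv _ (Complex.exp _), ← Complex.exp_neg]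
    push_cast
    congr 2
    ring
  have hc0 := hc 0
  rw [Complex.ofReal_zero, zero_mul, add_zero] at hc0
  rw [hc, hc, hc0]
  simp only [Complex.add_re, Complex.re_ofReal_mul, Complex.exp_ofReal_mul_I_re, Complex.mul_re]
  have h2 : -(2 * t) * Real.log n = 2 * θ := by rw [hθ]; ring
  rw [h2, ← hθ, Real.cos_two_mul]
  simp
  nlinarith [mul_nonneg ha0 (sq_nonneg (1 + Real.cos θ))]

lemma logderiv_comb : ∃ C : ℝ, 0 < C ∧ ∀ σ t : ℝ, 1 < σ → σ ≤ 2 → 1 ≤ |t| →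
    4 * (deriv riemannZeta₁ (σ + t * Complex.I) / riemannZeta₁ (σ + t * Complex.I)).re +
    (deriv riemannZeta₁ (σ + (2 * t : ℝ) * Complex.I) / riemannZeta₁ (σ + (2 * t : ℝ) * Complex.I)).re
      ≤ 3 / (σ - 1) + C := by
  have hc : ContinuousOn (fun σ : ℝ => deriv riemannZeta₁ (σ:ℂ) / riemannZeta₁ (σ:ℂ)) (Set.Icc 1 2) := by
    intro x hx
    have h1 : Continuous (deriv riemannZeta₁) :=
      ((differentiable_riemannZeta₁.contDiff (n := 2)).differentiable_deriv_two).continuous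
    have h2 := differentiable_riemannZeta₁.continuous
    refine ContinuousAt.continuousWithinAt (ContinuousAt.div ?_ ?_ (zeta1_ne_zero _ (by simpa using hx.1)))
    · exact (h1.comp Complex.continuous_ofReal).continuousAt
    · exact (h2.comp Complex.continuous_ofReal).continuousAt
  obtain ⟨C, hC⟩ := isCompact_Icc.exists_bound_of_continuousOn hc
  refine ⟨3 * |C| + 5, by positivity, fun σ t h1 h2 ht => ?_⟩
  have h341 := three_four_one σ t h1
  have hz : ∀ u : ℝ, (deriv riemannZeta (σ + u * Complex.I) / riemannZeta (σ + u * Complex.I)) =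
     deriv riemannZeta₁ (σ + u * Complex.I) / riemannZeta₁ (σ + u * Complex.I) - 1 / (σ + u * Complex.I - 1) := by
    intro u
    rw [logderiv_zeta1 _ (by simpa using h1)]; ring
  have hz0 := hz 0
  rw [Complex.ofReal_zero, zero_mul, add_zero] at hz0
  rw [hz, hz, hz0] at h341
  have hb : ∀ u : ℝ, 1 ≤ |u| → (1 / ((σ:ℂ) + u * Complex.I - 1)).re ≤ 1 := by
    intro u hu
    refine (Complex.re_le_norm _).trans ?_
    rw [norm_div, norm_one]
    have : |u| ≤ ‖(σ:ℂ) + u * Complex.I - 1‖ := by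
      have := Complex.abs_im_le_norm ((σ:ℂ) + u * Complex.I - 1)
      simpa using this
    rw [div_le_one (by linarith)]
    linarith
  have b1 := hb t ht
  have b2 := hb (2 * t) (by rw [abs_mul, abs_two]; linarith)
  have b3 : (1 / ((σ:ℂ) - 1)).re = 1 / (σ - 1) := by
    rw [← Complex.ofReal_one, ← Complex.ofReal_sub, ← Complex.ofReal_div, Complex.ofReal_re]
  have b4 : -|C| ≤ (deriv riemannZeta₁ σ / riemannZeta₁ σ).re := by
    have := hC σ ⟨h1.le, h2⟩
    have h := Complex.abs_re_le_norm (deriv riemannZeta₁ σ / riemannZeta₁ σ)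
    have h3 := neg_abs_le (deriv riemannZeta₁ σ / riemannZeta₁ σ).re
    have h4 := le_abs_self C
    linarith
  have r3 : ∀ z : ℂ, (3 * z).re = 3 * z.re := fun z => by simp
  have r4 : ∀ z : ℂ, (4 * z).re = 4 * z.re := fun z => by simp
  rw [Complex.add_re, Complex.add_re, r3, r4, Complex.sub_re, Complex.sub_re, Complex.sub_re, b3] at h341
  have : 3 / (σ - 1) = 3 * (1 / (σ - 1)) := by ring
  rw [this]
  linarith

end Wz
end

section
open Finset
namespace Wz

lemma zeta1_local : ∃ C B : ℝ, 1 ≤ C ∧ 0 < B ∧ ∀ u δ R : ℝ, 4 ≤ |u| → 0 < δ → δ ≤ 1/2 → 0 < R → R ≤ 1/2 →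
    (∀ z ∈ Metric.closedBall (0:ℂ) R, ‖riemannZeta₁ (((1 + δ : ℝ):ℂ) + u * Complex.I + z)‖ ≤
      C * |u| * Real.log |u| * Real.exp (B * R ^ (3/2:ℝ) * Real.log |u|)) ∧
    |u| * δ / C ≤ ‖riemannZeta₁ (((1 + δ : ℝ):ℂ) + u * Complex.I)‖ := by
  obtain ⟨C, B, hC, hB, hz⟩ := zeta_upper
  obtain ⟨C2, hC2, hi⟩ := zeta_inv_bound
  refine ⟨max (4 * C) C2, 2 * B, le_max_of_le_right hC2, by positivity, fun u δ R hu hδ hδ2 hR hR2 => ⟨?_, ?_⟩⟩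
  · intro z hzR
    have hzn : ‖z‖ ≤ R := by simpa using hzR
    have hre := (Complex.abs_re_le_norm z).trans hzn
    have him := (Complex.abs_im_le_norm z).trans hzn
    rw [abs_le] at hre
    obtain ⟨s, hs⟩ : ∃ s : ℂ, s = ((1 + δ : ℝ):ℂ) + u * Complex.I + z := ⟨_, rfl⟩
    have hsre : s.re = 1 + δ + z.re := by rw [hs]; simp
    have hsim : s.im = u + z.im := by rw [hs]; simp
    have hse : s = (s.re : ℂ) + (s.im : ℂ) * Complex.I := (Complex.re_add_im s).symm
    have ht1 : |s.im| ≤ |u| + 1/2 := by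
      rw [hsim]; exact (abs_add_le _ _).trans (by linarith)
    have ht2 : |u| - 1/2 ≤ |s.im| := by
      have := abs_sub_abs_le_abs_sub u (-z.im)
      rw [abs_neg, sub_neg_eq_add, ← hsim] at this
      linarith
    have hs1 : s ≠ 1 := by
      intro h; rw [h] at ht2; simp at ht2; linarith
    rw [← hs, zeta1_mul s hs1, norm_mul]
    have hb := hz s.re s.im (by rw [hsre]; linarith) (by rw [hsre]; linarith) (by linarith)
    rw [← hse] at hb
    have hlog0 : 0 < Real.log |u| := Real.log_pos (by linarith)
    have hlogs0 : 0 < Real.log |s.im| := Real.log_pos (by linarith)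
    have hlog : Real.log |s.im| ≤ 2 * Real.log |u| := by
      have : Real.log |s.im| ≤ Real.log (|u| ^ 2) := Real.log_le_log (by linarith) (by nlinarith)
      rwa [Real.log_pow] at this
    have hn : ‖s - 1‖ ≤ 2 * |u| := by
      refine (Complex.norm_le_abs_re_add_abs_im _).trans ?_
      simp only [Complex.sub_re, Complex.one_re, Complex.sub_im, Complex.one_im, sub_zero]
      have : |s.re - 1| ≤ 1 := by rw [hsre, abs_le]; constructor <;> linarith
      linarith
    have hmax : max (1 - s.re) 0 ≤ R := max_le (by rw [hsre]; linarith) hR.le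
    have hm0 : 0 ≤ max (1 - s.re) 0 := le_max_right _ _
    calc ‖s - 1‖ * ‖riemannZeta s‖ ≤ (2 * |u|) * (C * (2 * Real.log |u|) * Real.exp (B * R ^ (3/2:ℝ) * (2 * Real.log |u|))) := by
          refine mul_le_mul hn (hb.trans ?_) (norm_nonneg _) (by positivity)
          gcongr
      _ = (4 * C) * |u| * Real.log |u| * Real.exp (2 * B * R ^ (3/2:ℝ) * Real.log |u|) := by ring_nf
      _ ≤ _ := by
          gcongr
          exact le_max_left _ _
  · have h := hi (1 + δ) u (by linarith) (by linarith)
    obtain ⟨s, hs⟩ : ∃ s : ℂ, s = ((1 + δ : ℝ):ℂ) + u * Complex.I := ⟨_, rfl⟩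
    rw [← hs] at h ⊢
    have hsim : s.im = u := by rw [hs]; simp
    have hs1 : s ≠ 1 := by
      intro h; rw [h] at hsim; simp at hsim; rw [← hsim] at hu; simp at hu; linarith
    rw [zeta1_mul s hs1, norm_mul]
    have hn : |u| ≤ ‖s - 1‖ := by
      have := Complex.abs_im_le_norm (s - 1)
      simpa [hsim] using this
    have hz0 : riemannZeta s ≠ 0 := riemannZeta_ne_zero_of_one_le_re (by rw [hs]; simp; linarith)
    have hzp : 0 < ‖riemannZeta s‖ := norm_pos_iff.2 hz0
    have h2 : δ / C2 ≤ ‖riemannZeta s‖ := by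
      rw [norm_inv, add_sub_cancel_left] at h
      have := inv_anti₀ (by positivity) h
      rwa [inv_inv, inv_div] at this
    calc |u| * δ / max (4 * C) C2 ≤ |u| * δ / C2 := by gcongr; exact le_max_right _ _
      _ = |u| * (δ / C2) := by ring
      _ ≤ _ := by gcongr

lemma zf_core (C' : ℝ) (hC' : 0 < C')
    (hcomb : ∀ σ t : ℝ, 1 < σ → σ ≤ 2 → 1 ≤ |t| →
    4 * (deriv riemannZeta₁ (σ + t * Complex.I) / riemannZeta₁ (σ + t * Complex.I)).re +
    (deriv riemannZeta₁ (σ + (2 * t : ℝ) * Complex.I) / riemannZeta₁ (σ + (2 * t : ℝ) * Complex.I)).re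
      ≤ 3 / (σ - 1) + C') (γ β R M : ℝ) (hγ : 1 ≤ |γ|) (hR : 0 < R) (hR2 : R ≤ 1/2) (hM : 1 ≤ M) (hMC : C' ≤ M)
    (hu : ∀ u : ℝ, (u = γ ∨ u = 2 * γ) → ∃ K : ℝ, 
      (∀ z ∈ Metric.closedBall (0:ℂ) R, ‖riemannZeta₁ (((1 + R / (200 * M) : ℝ):ℂ) + u * Complex.I + z)‖ ≤ K) ∧
      K ≤ Real.exp M * ‖riemannZeta₁ (((1 + R / (200 * M) : ℝ):ℂ) + u * Complex.I)‖)
    (hβ : 1 - R / (200 * M) / 6 ≤ β) : riemannZeta₁ (β + γ * Complex.I) ≠ 0 := by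
  intro hzero
  have hM0 : 0 < M := by linarith
  obtain ⟨δ, hδ⟩ : ∃ δ : ℝ, δ = R / (200 * M) := ⟨_, rfl⟩
  rw [← hδ] at hβ hu
  have hδ0 : 0 < δ := by rw [hδ]; positivity
  have hδR : δ ≤ R / 200 := by
    rw [hδ]; gcongr; linarith
  have hβ1 : β < 1 := by
    by_contra h
    push Not at h
    exact zeta1_ne_zero _ (by simpa using h) hzero
  have hcmb := hcomb (1 + δ) γ (by linarith) (by linarith) hγ
  have hder : ∀ c : ℂ, deriv (fun z => riemannZeta₁ (c + z)) 0 = deriv riemannZeta₁ c := by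
    intro c
    rw [deriv_comp_const_add, add_zero]
  have gen : ∀ u : ℝ, Differentiable ℂ (fun z => riemannZeta₁ (((1 + δ : ℝ):ℂ) + u * Complex.I + z)) :=
    fun u => differentiable_riemannZeta₁.comp (differentiable_id.const_add _)
  have gz : ∀ u : ℝ, ∀ z ∈ Metric.ball (0:ℂ) R, riemannZeta₁ (((1 + δ : ℝ):ℂ) + u * Complex.I + z) = 0 → z.re < 0 := by
    intro u z _ h
    by_contra h0
    push Not at h0
    refine zeta1_ne_zero _ ?_ h
    simp; linarith
  have g0 : ∀ u : ℝ, riemannZeta₁ (((1 + δ : ℝ):ℂ) + u * Complex.I + 0) ≠ 0 := by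
    intro u
    apply zeta1_ne_zero; simp; linarith
  obtain ⟨K1, k1, k2⟩ := hu γ (Or.inl rfl)
  obtain ⟨K2, k3, k4⟩ := hu (2 * γ) (Or.inr rfl)
  obtain ⟨d, hd⟩ : ∃ d : ℝ, d = 1 + δ - β := ⟨_, rfl⟩
  have hd0 : 0 < d := by linarith
  have hd1 : d ≤ 7 / 6 * δ := by linarith
  have e1 := logderiv_lower_zero (fun z => riemannZeta₁ (((1 + δ : ℝ):ℂ) + γ * Complex.I + z)) (gen γ) R M K1 d hR hM0
    k1 (g0 γ) (gz γ) (by simpa using k2) hd0 (by linarith) (by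
      rw [show ((1 + δ : ℝ):ℂ) + γ * Complex.I + -(d:ℂ) = β + γ * Complex.I by rw [hd]; push_cast; ring]
      exact hzero)
  have e2 := logderiv_lower (fun z => riemannZeta₁ (((1 + δ : ℝ):ℂ) + (2 * γ : ℝ) * Complex.I + z)) (gen (2 * γ)) R M K2 hR hM0
    k3 (g0 (2 * γ)) (gz (2 * γ)) (by simpa using k4)
  rw [hder, add_zero] at e1 e2
  rw [add_sub_cancel_left] at hcmb
  have f1 : 4 / d ≥ 24 / 7 * (1 / δ) := by
    rw [ge_iff_le, le_div_iff₀ hd0]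
    rw [show 24 / 7 * (1 / δ) * d = 24 / 7 * (d / δ) by ring]
    have : d / δ ≤ 7/6 := by rw [div_le_iff₀ hδ0]; exact hd1
    linarith
  have f2 : 1 / δ = 200 * (M / R) := by rw [hδ]; field_simp
  have f3 : d / R ^ 2 ≤ 1 / 100 * (M / R) := by
    rw [div_le_iff₀ (by positivity)]
    have : 1 / 100 * (M / R) * R ^ 2 = 1 / 100 * M * R := by field_simp
    rw [this]
    nlinarith
  have f4 : M ≤ M / R := by
    rw [le_div_iff₀ hR]; nlinarith
  have f5 : 8 * M / R = 8 * (M / R) := by ring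
  have f6 : 3 / δ = 3 * (1 / δ) := by ring
  have f7 : 4 / d = 4 * (1 / d) := by ring
  rw [f5] at e1 e2
  rw [f6] at hcmb
  rw [f7] at f1
  have : 0 < M / R := by positivity
  linarith

open Filter in
lemma zero_free : ∃ c t0 : ℝ, 0 < c ∧ 16 ≤ t0 ∧ ∀ σ t : ℝ, t0 ≤ |t| →
    1 - c * Real.log |t| ^ (-(2/3) : ℝ) * Real.log (Real.log |t|) ^ (-(1/3) : ℝ) ≤ σ →
    riemannZeta₁ (σ + t * Complex.I) ≠ 0 := by
  obtain ⟨C, B, hC, hB, hloc⟩ := zeta1_local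
  obtain ⟨C', hC', hcomb⟩ := logderiv_comb
  obtain ⟨A, hA⟩ : ∃ A : ℝ, A = 2 * B + 3 := ⟨_, rfl⟩
  have hA0 : 3 < A := by linarith
  have hlog := Real.tendsto_log_atTop
  have ev : ∀ᶠ l : ℝ in atTop, 1 ≤ l ∧ 1 ≤ Real.log l ∧ C' ≤ A * Real.log l ∧
      (2:ℝ) ≤ (l / Real.log l) ^ (2/3 : ℝ) ∧ 200 * A ≤ (l / Real.log l) ^ (1/3 : ℝ) ∧ 4 * C ^ 2 ≤ l := by
    have hq : Tendsto (fun l : ℝ => l / Real.log l) atTop atTop := by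
      have h1 := (Real.isLittleO_log_id_atTop).tendsto_div_nhds_zero
      have h2 : ∀ᶠ l : ℝ in atTop, 0 < Real.log l / id l := by
        filter_upwards [eventually_gt_atTop 1] with l hl
        have := Real.log_pos hl
        simp only [id]; positivity
      have h3 := (tendsto_nhdsWithin_iff.2 ⟨h1, h2⟩).inv_tendsto_nhdsGT_zero
      refine h3.congr fun l => ?_
      simp
    have q1 := (tendsto_rpow_atTop (by norm_num : (0:ℝ) < 2/3)).comp hq
    have q2 := (tendsto_rpow_atTop (by norm_num : (0:ℝ) < 1/3)).comp hq
    filter_upwards [eventually_ge_atTop 1, hlog.eventually_ge_atTop 1, hlog.eventually_ge_atTop (C' / A),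
      q1.eventually_ge_atTop 2, q2.eventually_ge_atTop (200 * A), eventually_ge_atTop (4 * C ^ 2)] with l a1 a2 a3 a4 a5 a6
    refine ⟨a1, a2, ?_, a4, a5, a6⟩
    rw [div_le_iff₀ (by linarith)] at a3; linarith
  have ev2 := hlog.eventually ev
  obtain ⟨t1, ht1⟩ := eventually_atTop.1 ev2
  refine ⟨1 / (1200 * A), max t1 16, by positivity, le_max_right _ _, fun σ t ht hσ => ?_⟩
  obtain ⟨b1, b2, b3, b4, b5, b6⟩ := ht1 |t| ((le_max_left _ _).trans ht)
  have ht16 : 16 ≤ |t| := (le_max_right _ _).trans ht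
  obtain ⟨l, hl⟩ : ∃ l, l = Real.log |t| := ⟨_, rfl⟩
  obtain ⟨L, hL⟩ : ∃ L, L = Real.log l := ⟨_, rfl⟩
  rw [← hl] at b1 b2 b3 b4 b5 b6 hσ
  rw [← hL] at b2 b3 b4 b5 hσ
  have hl0 : 0 < l := by linarith
  have hL0 : 0 < L := by linarith
  have hq0 : 0 < l / L := by positivity
  obtain ⟨R, hR⟩ : ∃ R : ℝ, R = (l / L) ^ (-(2/3) : ℝ) := ⟨_, rfl⟩
  have hR0 : 0 < R := by rw [hR]; positivity
  have hR2 : R ≤ 1/2 := by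
    rw [hR, Real.rpow_neg hq0.le, ← one_div]
    exact one_div_le_one_div_of_le (by norm_num) b4
  have hR32 : R ^ (3/2:ℝ) * l = L := by
    rw [hR, ← Real.rpow_mul hq0.le]
    norm_num
    rw [Real.rpow_neg_one]; field_simp
  obtain ⟨M, hM⟩ : ∃ M : ℝ, M = A * L := ⟨_, rfl⟩
  have hM1 : 1 ≤ M := by rw [hM]; nlinarith
  have hM0 : 0 < M := by linarith
  have hwid : R / (200 * M) / 6 = 1 / (1200 * A) * l ^ (-(2/3) : ℝ) * L ^ (-(1/3) : ℝ) := by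
    rw [hR, hM, Real.div_rpow hl0.le hL0.le]
    have : L ^ (-(1/3) : ℝ) = (L ^ (-(2/3):ℝ))⁻¹ * L⁻¹ := by
      rw [← Real.rpow_neg hL0.le, ← Real.rpow_neg_one, ← Real.rpow_add hL0]; norm_num
    rw [this]
    have : 0 < L ^ (-(2/3):ℝ) := by positivity
    field_simp
    norm_num
  refine zf_core C' hC' hcomb t σ R M (by linarith) hR0 hR2 hM1 (by rw [hM]; exact b3) ?_ (by rw [hwid]; exact hσ)
  intro u hu
  have hut : |t| ≤ |u| := by
    rcases hu with rfl | rfl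
    · exact le_refl _
    · rw [abs_mul, abs_two]; linarith
  have hut2 : |u| ≤ 2 * |t| := by
    rcases hu with rfl | rfl
    · linarith
    · rw [abs_mul, abs_two]
  have hlu : Real.log |u| ≤ 2 * l := by
    have : Real.log |u| ≤ Real.log (|t| ^ 2) := Real.log_le_log (by linarith) (by nlinarith)
    rwa [Real.log_pow, ← hl] at this
  obtain ⟨δ, hδ⟩ : ∃ δ : ℝ, δ = R / (200 * M) := ⟨_, rfl⟩
  have hδ0 : 0 < δ := by rw [hδ]; positivity
  have hδl : 1 ≤ δ * l := by
    have : δ * l = (l / L) ^ (1/3:ℝ) / (200 * A) := by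
      have e : (l / L) ^ (1/3:ℝ) = (l / L) ^ (-(2/3) : ℝ) * (l / L) := by
        nth_rewrite 3 [← Real.rpow_one (l / L)]
        rw [← Real.rpow_add hq0]; norm_num
      rw [e, hδ, hR, hM]; field_simp
    rw [this, one_le_div (by linarith)]; exact b5
  have hδ2 : δ ≤ 1/2 := by
    rw [hδ]
    refine (div_le_self hR0.le (by linarith)).trans hR2
  rw [← hδ]
  obtain ⟨g1, g2⟩ := hloc u δ R (by linarith) hδ0 hδ2 hR0 hR2
  refine ⟨_, g1, ?_⟩
  have hlu0 : 0 < Real.log |u| := Real.log_pos (by linarith)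
  have hu0 : 0 < |u| := by linarith
  calc C * |u| * Real.log |u| * Real.exp (B * R ^ (3/2:ℝ) * Real.log |u|) ≤
      C * |u| * (2 * l) * Real.exp (B * R ^ (3/2:ℝ) * (2 * l)) := by gcongr
    _ = C * |u| * (2 * l) * Real.exp (2 * B * L) := by
        rw [show B * R ^ (3/2:ℝ) * (2 * l) = 2 * B * (R ^ (3/2:ℝ) * l) by ring, hR32]
    _ ≤ Real.exp M * (|u| * δ / C) := by
        have hM' : Real.exp M = Real.exp (2 * B * L) * l ^ 3 := by
          rw [hM, hA, ← Real.exp_log (by positivity : 0 < l ^ 3), ← Real.exp_add, Real.log_pow, ← hL]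
          push_cast; ring_nf
        rw [hM']
        have : C * |u| * (2 * l) * Real.exp (2 * B * L) = Real.exp (2 * B * L) * (|u| / C) * (2 * C ^ 2 * l) := by
          field_simp
        rw [this]
        have : Real.exp (2 * B * L) * l ^ 3 * (|u| * δ / C) = Real.exp (2 * B * L) * (|u| / C) * (l ^ 2 * (δ * l)) := by
          field_simp
        rw [this]
        refine mul_le_mul_of_nonneg_left ?_ (by positivity)
        nlinarith [mul_nonneg (sq_nonneg l) (sub_nonneg.2 hδl), mul_nonneg hl0.le (sub_nonneg.2 b6)]
    _ ≤ _ := mul_le_mul_of_nonneg_left g2 (Real.exp_pos _).le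

end Wz
end

section
open Finset
namespace Wz

noncomputable def wdt (T : ℝ) : ℝ := Real.log T ^ (-(2/3) : ℝ) * Real.log (Real.log T) ^ (-(1/3) : ℝ)

lemma loglog16 (t : ℝ) (ht : 16 ≤ t) : 2 ≤ Real.log t ∧ 0 < Real.log (Real.log t) := by
  have h : 2 ≤ Real.log t := by
    have : Real.log ((2:ℝ) ^ 4) ≤ Real.log t := Real.log_le_log (by norm_num) (by linarith)
    rw [Real.log_pow] at this
    have := Real.log_two_gt_d9
    push_cast at *
    linarith
  exact ⟨h, Real.log_pos (by linarith)⟩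

lemma wdt_pos (T : ℝ) (hT : 16 ≤ T) : 0 < wdt T := by
  obtain ⟨h1, h2⟩ := loglog16 T hT
  unfold wdt
  have : 0 < Real.log T := by linarith
  positivity

lemma wdt_half (t T : ℝ) (ht : 16 ≤ t) (hT : 16 ≤ T) (htT : t ≤ T + 1) : wdt T / 2 ≤ wdt t := by
  obtain ⟨h1, h2⟩ := loglog16 T hT
  obtain ⟨h3, h4⟩ := loglog16 t ht
  have hl : Real.log t ≤ 2 * Real.log T := by
    have : Real.log t ≤ Real.log (T ^ 2) := Real.log_le_log (by linarith) (by nlinarith)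
    rwa [Real.log_pow] at this
  have hll : Real.log (Real.log t) ≤ 2 * Real.log (Real.log T) := by
    have : Real.log (Real.log t) ≤ Real.log (Real.log T ^ 2) := Real.log_le_log (by linarith) (by nlinarith)
    rwa [Real.log_pow] at this
  unfold wdt
  obtain ⟨a, ha⟩ : ∃ a, a = Real.log T := ⟨_, rfl⟩
  obtain ⟨b, hb⟩ : ∃ b, b = Real.log a := ⟨_, rfl⟩
  obtain ⟨a', ha'⟩ : ∃ a, a = Real.log t := ⟨_, rfl⟩
  obtain ⟨b', hb'⟩ : ∃ b, b = Real.log a' := ⟨_, rfl⟩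
  rw [← ha] at h1 h2 hl hll ⊢
  rw [← ha'] at h3 h4 hl hll ⊢
  rw [← hb] at h2 hll ⊢
  rw [← hb'] at h4 hll ⊢
  have ha0 : 0 < a := by linarith
  have ha0' : 0 < a' := by linarith
  have e : a ^ (-(2/3) : ℝ) * b ^ (-(1/3) : ℝ) / 2 = (2 * a) ^ (-(2/3) : ℝ) * (2 * b) ^ (-(1/3) : ℝ) := by
    rw [Real.mul_rpow (by norm_num) ha0.le, Real.mul_rpow (by norm_num) h2.le]
    have : (2:ℝ) ^ (-(2/3) : ℝ) * (2:ℝ) ^ (-(1/3) : ℝ) = 1 / 2 := by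
      rw [← Real.rpow_add (by norm_num)]
      norm_num
    linear_combination (-(a ^ (-(2/3) : ℝ) * b ^ (-(1/3) : ℝ))) * this
  rw [e]
  exact mul_le_mul (Real.rpow_le_rpow_of_nonpos ha0' hl (by norm_num))
    (Real.rpow_le_rpow_of_nonpos h4 hll (by norm_num)) (by positivity) (by positivity)

lemma low_zeros (t2 : ℝ) : ∃ ε C : ℝ, 0 < ε ∧ ε ≤ 1 ∧ 0 < C ∧ ∀ σ t : ℝ, |t| ≤ t2 → 1 - ε ≤ σ → σ ≤ 2 →
    riemannZeta₁ (σ + t * Complex.I) ≠ 0 ∧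
    ‖((σ:ℂ) + t * Complex.I - 1) / riemannZeta₁ (σ + t * Complex.I)‖ ≤ C := by
  have hcont := differentiable_riemannZeta₁.continuous
  have hg : Continuous (fun p : ℝ × ℝ => (p.1 : ℂ) + p.2 * Complex.I) := by fun_prop
  have h1 : ∃ ε : ℝ, 0 < ε ∧ ε ≤ 1 ∧ ∀ σ t : ℝ, |t| ≤ t2 → 1 - ε ≤ σ → σ ≤ 2 → riemannZeta₁ (σ + t * Complex.I) ≠ 0 := by
    have hK : IsCompact ((Set.Icc (0:ℝ) 2 ×ˢ Set.Icc (-t2) t2) ∩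
        {p : ℝ × ℝ | riemannZeta₁ ((p.1 : ℂ) + p.2 * Complex.I) = 0}) := by
      refine (isCompact_Icc.prod isCompact_Icc).inter_right ?_
      exact isClosed_eq (hcont.comp hg) continuous_const
    rcases Set.eq_empty_or_nonempty ((Set.Icc (0:ℝ) 2 ×ˢ Set.Icc (-t2) t2) ∩
        {p : ℝ × ℝ | riemannZeta₁ ((p.1 : ℂ) + p.2 * Complex.I) = 0}) with he | hne
    · refine ⟨1, one_pos, le_refl _, fun σ t ht h1 h2 h0 => ?_⟩
      have : (σ, t) ∈ ((Set.Icc (0:ℝ) 2 ×ˢ Set.Icc (-t2) t2) ∩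
        {p : ℝ × ℝ | riemannZeta₁ ((p.1 : ℂ) + p.2 * Complex.I) = 0}) :=
        ⟨⟨⟨by simpa using h1, h2⟩, abs_le.1 ht⟩, h0⟩
      rw [he] at this
      exact this
    · obtain ⟨p, hp, hmax⟩ := hK.exists_isMaxOn hne (continuous_fst.continuousOn)
      have hp1 : p.1 < 1 := by
        by_contra h
        push Not at h
        exact zeta1_ne_zero _ (by simpa using h) hp.2
      have hp0 : 0 ≤ p.1 := hp.1.1.1
      refine ⟨(1 - p.1) / 2, by linarith, by linarith, fun σ t ht h1 h2 h0 => ?_⟩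
      have : (σ, t) ∈ ((Set.Icc (0:ℝ) 2 ×ˢ Set.Icc (-t2) t2) ∩
        {p : ℝ × ℝ | riemannZeta₁ ((p.1 : ℂ) + p.2 * Complex.I) = 0}) :=
        ⟨⟨⟨show 0 ≤ σ by linarith, h2⟩, abs_le.1 ht⟩, h0⟩
      have h3 : σ ≤ p.1 := hmax this
      linarith
  obtain ⟨ε, hε, hε1, hne⟩ := h1
  have hc : ContinuousOn (fun p : ℝ × ℝ => ((p.1 : ℂ) + p.2 * Complex.I - 1) / riemannZeta₁ ((p.1 : ℂ) + p.2 * Complex.I))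
      (Set.Icc (1 - ε) 2 ×ˢ Set.Icc (-t2) t2) := by
    refine ContinuousOn.div (by fun_prop) (hcont.comp hg).continuousOn ?_
    rintro ⟨σ, t⟩ ⟨⟨h1, h2⟩, h3⟩
    exact hne σ t (abs_le.2 h3) h1 h2
  obtain ⟨C, hC⟩ := (isCompact_Icc.prod isCompact_Icc).exists_bound_of_continuousOn hc
  refine ⟨ε, |C| + 1, hε, hε1, by positivity, fun σ t ht h1 h2 => ⟨hne σ t ht h1 h2, ?_⟩⟩
  have := hC (σ, t) ⟨⟨h1, h2⟩, abs_le.1 ht⟩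
  exact this.trans (by linarith [le_abs_self C])

set_option maxHeartbeats 1000000 in
open Filter in
lemma inv_bound : ∃ c T0 : ℝ, 0 < c ∧ 16 ≤ T0 ∧ ∀ T : ℝ, T0 ≤ T → c * wdt T ≤ 1/4 ∧
    ∀ σ t : ℝ, |t| ≤ T → 1 - c * wdt T ≤ σ → σ ≤ 2 →
    riemannZeta₁ (σ + t * Complex.I) ≠ 0 ∧
    ‖((σ:ℂ) + t * Complex.I - 1) / riemannZeta₁ (σ + t * Complex.I)‖ ≤ Real.log T ^ 8 := by
  obtain ⟨c1, t0, hc1, ht0, hzf⟩ := zero_free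
  obtain ⟨C, B, hC, hB, hloc⟩ := zeta1_local
  obtain ⟨C2, hC2, hinv⟩ := zeta_inv_bound
  obtain ⟨ε, C4, hε, hε1, hC4, hlow⟩ := low_zeros (t0 + 1)
  obtain ⟨c, hc⟩ : ∃ c : ℝ, c = min (c1 / 2) 1 := ⟨_, rfl⟩
  have hc0 : 0 < c := by rw [hc]; positivity
  have hcc1 : c ≤ c1 / 2 := by rw [hc]; exact min_le_left _ _
  have hcc2 : c ≤ 1 := by rw [hc]; exact min_le_right _ _
  have ev : ∀ᶠ T : ℝ in atTop, 16 ≤ T ∧ 2 * C ^ 2 * Real.exp (2 * B) / c ≤ Real.log T ∧ 4 * C / c ≤ Real.log T ∧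
      2 * C2 / c ≤ Real.log T ∧ C4 ≤ Real.log T ∧ 1 ≤ Real.log T ∧ 1 ≤ Real.log (Real.log T) ∧
      (3 / ε) ^ (3/2 : ℝ) ≤ Real.log T := by
    have h := Real.tendsto_log_atTop
    filter_upwards [eventually_ge_atTop 16, h.eventually_ge_atTop (2 * C ^ 2 * Real.exp (2 * B) / c),
      h.eventually_ge_atTop (4 * C / c), h.eventually_ge_atTop (2 * C2 / c), h.eventually_ge_atTop C4,
      h.eventually_ge_atTop 1, (h.comp h).eventually_ge_atTop 1, h.eventually_ge_atTop ((3 / ε) ^ (3/2 : ℝ))]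
      with T a1 a2 a3 a4 a5 a6 a7 a8
    exact ⟨a1, a2, a3, a4, a5, a6, a7, a8⟩
  obtain ⟨T0, hT0⟩ := eventually_atTop.1 ev
  refine ⟨c / 4, max T0 16, by positivity, le_max_right _ _, fun T hT => ?_⟩
  obtain ⟨hT16, a2, a3, a4, a5, a6, a7, a8⟩ := hT0 T ((le_max_left _ _).trans hT)
  obtain ⟨l, hl⟩ : ∃ l, l = Real.log T := ⟨_, rfl⟩
  obtain ⟨L, hL⟩ : ∃ L, L = Real.log l := ⟨_, rfl⟩
  obtain ⟨w, hw⟩ : ∃ w, w = c * wdt T := ⟨_, rfl⟩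
  have hw0 : 0 < w := by rw [hw]; exact mul_pos hc0 (wdt_pos T hT16)
  rw [← hl] at a2 a3 a4 a5 a6 a7 a8 ⊢
  rw [← hL] at a7
  have hl0 : 0 < l := by linarith
  have hL0 : 0 < L := by linarith
  have hLl : L ≤ l := by rw [hL]; exact (Real.log_le_self hl0.le)
  have hwd : wdt T = l ^ (-(2/3) : ℝ) * L ^ (-(1/3) : ℝ) := by rw [wdt, ← hl, ← hL]
  have hL1 : L ^ (-(1/3) : ℝ) ≤ 1 := Real.rpow_le_one_of_one_le_of_nonpos a7 (by norm_num)
  -- w ≤ ε/3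
  have hwl : w ≤ l ^ (-(2/3) : ℝ) := by
    rw [hw, hwd]
    have : 0 < l ^ (-(2/3) : ℝ) := by positivity
    calc c * (l ^ (-(2/3) : ℝ) * L ^ (-(1/3) : ℝ)) ≤ 1 * (l ^ (-(2/3) : ℝ) * 1) := by gcongr
      _ = _ := by ring
  have hwε : w ≤ ε / 3 := by
    refine hwl.trans ?_
    have := Real.rpow_le_rpow_of_nonpos (z := -(2/3)) (by positivity) a8 (by norm_num)
    rw [← Real.rpow_mul (by positivity)] at this
    norm_num at this
    rw [Real.rpow_neg_one, inv_div] at this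
    exact this
  have hw32 : w ^ (3/2:ℝ) * l ≤ 1 := by
    have := Real.rpow_le_rpow hw0.le hwl (by norm_num : (0:ℝ) ≤ 3/2)
    rw [← Real.rpow_mul hl0.le] at this
    norm_num at this
    rw [Real.rpow_neg_one] at this
    calc w ^ (3/2:ℝ) * l ≤ l⁻¹ * l := by gcongr
      _ = 1 := by field_simp
  have hwinv : 1 / w ≤ l / c := by
    rw [hw, hwd]
    have h1 : 1 / (c * (l ^ (-(2/3) : ℝ) * L ^ (-(1/3) : ℝ))) = l ^ (2/3:ℝ) * L ^ (1/3:ℝ) / c := by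
      rw [Real.rpow_neg hl0.le, Real.rpow_neg hL0.le]; field_simp
    rw [h1]
    gcongr
    calc l ^ (2/3:ℝ) * L ^ (1/3:ℝ) ≤ l ^ (2/3:ℝ) * l ^ (1/3:ℝ) := by gcongr
      _ = l := by rw [← Real.rpow_add hl0]; norm_num
  have hcw : c / 4 * wdt T = w / 4 := by rw [hw]; ring
  rw [hcw]
  refine ⟨by linarith, fun σ t ht h1 h2 => ?_⟩
  have hl8 : ∀ X : ℝ, X ≤ l ^ 2 → X ≤ l ^ 8 := fun X hX => hX.trans (pow_le_pow_right₀ a6 (by norm_num))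
  by_cases htl : |t| ≤ t0 + 1
  · obtain ⟨b1, b2⟩ := hlow σ t htl (by linarith) h2
    refine ⟨b1, b2.trans (hl8 _ ?_)⟩
    nlinarith
  push Not at htl
  by_cases hσ : 1 + w / 2 ≤ σ
  · have hne := zeta1_ne_zero ((σ:ℂ) + t * Complex.I) (by simp; linarith)
    refine ⟨hne, ?_⟩
    have hs1 : (σ:ℂ) + t * Complex.I ≠ 1 := by
      intro h
      have := congrArg Complex.re h
      simp at this; linarith
    rw [zeta1_mul _ hs1, div_mul_eq_div_div, div_self (sub_ne_zero.2 hs1), one_div]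
    refine (hinv σ t (by linarith) (by linarith)).trans (hl8 _ ?_)
    calc C2 / (σ - 1) ≤ C2 / (w / 2) := by gcongr; linarith
      _ = 2 * C2 * (1 / w) := by field_simp
      _ ≤ 2 * C2 * (l / c) := by gcongr
      _ = (2 * C2 / c) * l := by ring
      _ ≤ l * l := by gcongr
      _ = l ^ 2 := by ring
  push Not at hσ
  -- main case
  obtain ⟨f, hf⟩ : ∃ f : ℂ → ℂ, f = fun z => riemannZeta₁ (((1 + w / 2 : ℝ):ℂ) + t * Complex.I + z) := ⟨_, rfl⟩
  have hfd : Differentiable ℂ f := by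
    rw [hf]; exact differentiable_riemannZeta₁.comp (differentiable_id.const_add _)
  obtain ⟨g1, g2⟩ := hloc t (w / 2) (3 * w / 2) (by linarith) (by linarith) (by linarith) (by linarith) (by linarith)
  have hf0 : f 0 = riemannZeta₁ (((1 + w / 2 : ℝ):ℂ) + t * Complex.I) := by rw [hf]; simp
  rw [← hf0] at g2
  have hlt : Real.log |t| ≤ l := by rw [hl]; exact Real.log_le_log (by linarith) ht
  have hlt0 : 0 < Real.log |t| := Real.log_pos (by linarith)
  have hu0 : 0 < |t| := by linarith
  have h32 : (3 * w / 2) ^ (3/2:ℝ) ≤ 2 * w ^ (3/2:ℝ) := by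
    rw [show 3 * w / 2 = (3/2) * w by ring, Real.mul_rpow (by norm_num) hw0.le]
    gcongr
    have : (3/2:ℝ) ^ (3/2:ℝ) = Real.sqrt ((3/2) ^ 3) := by
      rw [Real.sqrt_eq_rpow, ← Real.rpow_natCast, ← Real.rpow_mul (by norm_num)]; norm_num
    rw [this, Real.sqrt_le_left (by norm_num)]
    norm_num
  have hf0p : 0 < ‖f 0‖ := by
    refine lt_of_lt_of_le ?_ g2
    positivity
  have hb : ∀ z ∈ Metric.ball (0:ℂ) (3 * w / 2), ‖f z‖ ≤ Real.exp (3 * L) * ‖f 0‖ := by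
    intro z hz
    have hx := g1 z (Metric.ball_subset_closedBall hz)
    rw [hf]
    refine hx.trans ?_
    rw [← hf]
    have hE : Real.exp (3 * L) = l ^ 3 := by
      rw [hL, ← Real.exp_log (by positivity : 0 < l ^ 3), Real.log_pow]; norm_num
    rw [hE]
    calc C * |t| * Real.log |t| * Real.exp (B * (3 * w / 2) ^ (3/2:ℝ) * Real.log |t|)
        ≤ C * |t| * l * Real.exp (B * (2 * w ^ (3/2:ℝ)) * l) := by gcongr
      _ ≤ C * |t| * l * Real.exp (2 * B) := by
          refine mul_le_mul_of_nonneg_left (Real.exp_le_exp.2 ?_) (by positivity)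
          have := mul_le_mul_of_nonneg_left hw32 (by positivity : 0 ≤ 2 * B)
          linarith
      _ = (2 * C ^ 2 * Real.exp (2 * B) * (1 / w)) * l * (|t| * (w / 2) / C) := by field_simp
      _ ≤ l ^ 2 * l * ‖f 0‖ := by
          refine mul_le_mul (mul_le_mul_of_nonneg_right ?_ hl0.le) g2 (by positivity) (by positivity)
          calc 2 * C ^ 2 * Real.exp (2 * B) * (1 / w) ≤ 2 * C ^ 2 * Real.exp (2 * B) * (l / c) := by gcongr
            _ = (2 * C ^ 2 * Real.exp (2 * B) / c) * l := by ring
            _ ≤ l * l := by gcongr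
            _ = l ^ 2 := by ring
      _ = _ := by ring
  have hnv : ∀ z ∈ Metric.ball (0:ℂ) (3 * w / 2), f z ≠ 0 := by
    intro z hz
    have hzn : ‖z‖ < 3 * w / 2 := by simpa using hz
    have hre := (Complex.abs_re_le_norm z).trans_lt hzn
    have him := (Complex.abs_im_le_norm z).trans_lt hzn
    have e : ((1 + w / 2 : ℝ):ℂ) + t * Complex.I + z = ((1 + w / 2 + z.re : ℝ):ℂ) + ((t + z.im : ℝ):ℂ) * Complex.I := by
      apply Complex.ext <;> simp
    have hA1 : |t + z.im| ≤ T + 1 := (abs_add_le _ _).trans (by linarith)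
    have hA2 : t0 ≤ |t + z.im| := by
      have := abs_sub_abs_le_abs_sub t (-z.im)
      rw [abs_neg, sub_neg_eq_add] at this
      linarith
    rw [hf]
    simp only [e]
    refine hzf _ _ hA2 ?_
    have hh : wdt T / 2 ≤ Real.log |t + z.im| ^ (-(2/3) : ℝ) * Real.log (Real.log |t + z.im|) ^ (-(1/3) : ℝ) :=
      wdt_half _ T (by linarith) hT16 hA1
    rw [abs_lt] at hre
    rw [mul_assoc]
    have : w ≤ c1 * (Real.log |t + z.im| ^ (-(2/3) : ℝ) * Real.log (Real.log |t + z.im|) ^ (-(1/3) : ℝ)) := by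
      calc w = c * wdt T := hw
        _ ≤ (c1 / 2) * wdt T := by
            have := wdt_pos T hT16
            gcongr
        _ = c1 * (wdt T / 2) := by ring
        _ ≤ _ := by gcongr
    linarith
  obtain ⟨h, _, k2, k3⟩ := log_bound f hfd (3 * w / 2) (3 * L) (by positivity) (by positivity) hnv hb
  obtain ⟨z, hz⟩ : ∃ z : ℂ, z = ((σ - 1 - w / 2 : ℝ) : ℂ) := ⟨_, rfl⟩
  have hzn : ‖z‖ ≤ 3 * w / 4 := by
    rw [hz, Complex.norm_real, Real.norm_eq_abs, abs_le]; constructor <;> linarith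
  have hzb : z ∈ Metric.ball (0:ℂ) (3 * w / 2) := by simp; linarith
  have hfz : f z = riemannZeta₁ ((σ:ℂ) + t * Complex.I) := by
    rw [hf, hz]; simp only; congr 1; push_cast; ring
  have hh : ‖h z‖ ≤ 6 * L := by
    refine (k3 z hzb).trans ?_
    rw [div_le_iff₀ (by linarith)]
    have e1 := mul_le_mul_of_nonneg_left hzn hL0.le
    linarith only [e1]
  have hlb : ‖f 0‖ / l ^ 6 ≤ ‖f z‖ := by
    rw [k2 z hzb, norm_mul, Complex.norm_exp, div_eq_mul_inv]
    gcongr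
    have : (l ^ 6)⁻¹ = Real.exp (-(6 * L)) := by
      rw [Real.exp_neg, hL, ← Real.exp_log (by positivity : 0 < l ^ 6), Real.log_pow]; norm_num
    rw [this]
    apply Real.exp_le_exp.2
    have := Complex.abs_re_le_norm (h z)
    have := neg_abs_le (h z).re
    linarith
  rw [← hfz]
  refine ⟨hnv z hzb, ?_⟩
  rw [norm_div]
  have hn : ‖(σ:ℂ) + t * Complex.I - 1‖ ≤ 2 * |t| := by
    refine (Complex.norm_le_abs_re_add_abs_im _).trans ?_
    simp
    have : |σ - 1| ≤ 1 := by rw [abs_le]; constructor <;> linarith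
    linarith
  calc ‖(σ:ℂ) + t * Complex.I - 1‖ / ‖f z‖ ≤ 2 * |t| / ((|t| * (w / 2) / C) / l ^ 6) := by
        refine div_le_div₀ (by positivity) hn (by positivity) (le_trans ?_ hlb)
        gcongr
    _ = (4 * C * (1 / w)) * l ^ 6 := by field_simp; norm_num
    _ ≤ (4 * C * (l / c)) * l ^ 6 := by gcongr
    _ = (4 * C / c) * l * l ^ 6 := by ring
    _ ≤ l * l * l ^ 6 := by gcongr
    _ = l ^ 8 := by ring

end Wz
end

section
open Finset
namespace Wz

noncomputable def kern (s : ℂ) : ℂ := 1 / s - 1 / (s + 1)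

lemma kern_norm (σ t : ℝ) (hσ : 3/4 ≤ σ) : ‖kern (σ + t * Complex.I)‖ ≤ 2 * (1 + t ^ 2)⁻¹ := by
  obtain ⟨s, hs⟩ : ∃ s : ℂ, s = σ + t * Complex.I := ⟨_, rfl⟩
  have hre : s.re = σ := by rw [hs]; simp
  have him : s.im = t := by rw [hs]; simp
  rw [← hs]
  have h0 : s ≠ 0 := by intro h; rw [h] at hre; simp at hre; linarith
  have h1 : s + 1 ≠ 0 := by
    intro h
    have := congrArg Complex.re h
    simp [hre] at this; linarith
  have e : kern s = 1 / (s * (s + 1)) := by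
    rw [kern]; field_simp; ring
  rw [e, norm_div, norm_one, norm_mul, ← div_eq_mul_inv, div_le_div_iff₀ (by positivity) (by positivity)]
  have hn1 : ‖s‖ ^ 2 = σ ^ 2 + t ^ 2 := by
    rw [← Complex.normSq_eq_norm_sq, Complex.normSq_apply, hre, him]; ring
  have hn2 : ‖s + 1‖ ^ 2 = (σ + 1) ^ 2 + t ^ 2 := by
    rw [← Complex.normSq_eq_norm_sq, Complex.normSq_apply]; simp [hre, him]; ring
  have hle : ‖s‖ ≤ ‖s + 1‖ := by
    apply le_of_sq_le_sq _ (norm_nonneg _)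
    rw [hn1, hn2]; nlinarith
  nlinarith [norm_nonneg s, mul_le_mul_of_nonneg_left hle (norm_nonneg s)]

lemma kern_cont (σ : ℝ) (hσ : 3/4 ≤ σ) : Continuous (fun y : ℝ => kern (σ + y * Complex.I)) := by
  unfold kern
  refine Continuous.sub (Continuous.div continuous_const (by fun_prop) ?_)
    (Continuous.div continuous_const (by fun_prop) ?_)
  · intro y h
    have := congrArg Complex.re h
    simp at this; linarith
  · intro y h
    have := congrArg Complex.re h
    simp at this; linarith

open MeasureTheory

noncomputable def hat (u : ℝ) : ℂ :=
  (Set.Ioc (0:ℝ) 1).indicator (fun _ => (1:ℂ)) u - (Set.Ioc (0:ℝ) 1).indicator (fun t : ℝ => (t:ℂ) ^ (1:ℂ)) u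

lemma hat_eq (u : ℝ) (hu : 0 < u) : hat u = ((max (1 - u) 0 : ℝ) : ℂ) := by
  unfold hat
  by_cases h : u ≤ 1
  · rw [Set.indicator_of_mem (by exact ⟨hu, h⟩), Set.indicator_of_mem (by exact ⟨hu, h⟩), max_eq_left (by linarith)]
    simp
  · rw [Set.indicator_of_notMem (by intro h'; exact h h'.2), Set.indicator_of_notMem (by intro h'; exact h h'.2),
      max_eq_right (by linarith)]
    simp

lemma hat_mellin (s : ℂ) (hs : 0 < s.re) : HasMellin hat s (kern s) := by
  have h1 := hasMellin_one_Ioc hs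
  have h2 := hasMellin_cpow_Ioc 1 (s := s) (by simp; linarith)
  have := hasMellin_sub h1.1 h2.1
  rw [h1.2, h2.2] at this
  exact this

lemma kern_int (X σ : ℝ) (hX : 0 < X) (hσ : 3/4 ≤ σ) :
    Integrable (fun y : ℝ => (X:ℂ) ^ ((σ:ℂ) + y * Complex.I) * kern (σ + y * Complex.I)) := by
  have hX0 : (X:ℂ) ≠ 0 := by exact_mod_cast hX.ne'
  refine ((integrable_inv_one_add_sq.const_mul 2).const_mul (X ^ σ)).mono' ?_ ?_
  · refine Continuous.aestronglyMeasurable (Continuous.mul ?_ (kern_cont σ hσ))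
    exact Continuous.const_cpow (by fun_prop) (Or.inl hX0)
  · refine Filter.Eventually.of_forall fun y => ?_
    rw [norm_mul, Complex.norm_cpow_eq_rpow_re_of_pos hX]
    have := kern_norm σ y hσ
    simp only [Complex.add_re, Complex.ofReal_re, Complex.mul_re, Complex.I_re, mul_zero, Complex.ofReal_im,
      Complex.I_im, mul_one, sub_self, add_zero]
    gcongr

lemma hat_inv (σ u : ℝ) (hσ : 3/4 ≤ σ) (hu : 0 < u) :
    ((1 / (2 * Real.pi) : ℝ) : ℂ) * ∫ y : ℝ, (u:ℂ) ^ (-((σ:ℂ) + y * Complex.I)) * kern (σ + y * Complex.I) =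
      ((max (1 - u) 0 : ℝ) : ℂ) := by
  have hm : ∀ y : ℝ, mellin hat (σ + y * Complex.I) = kern (σ + y * Complex.I) := by
    intro y
    exact (hat_mellin _ (by simp; linarith)).2
  have hV : Complex.VerticalIntegrable (mellin hat) σ := by
    unfold Complex.VerticalIntegrable
    simp only [hm]
    have := kern_int 1 σ one_pos hσ
    simpa using this
  have hcont : ContinuousAt hat u := by
    have : hat =ᶠ[nhds u] fun u => ((max (1 - u) 0 : ℝ) : ℂ) := by
      filter_upwards [lt_mem_nhds hu] with v hv
      exact hat_eq v hv
    rw [continuousAt_congr this]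
    apply Continuous.continuousAt
    fun_prop
  have := mellinInv_mellin_eq σ hat hu (hat_mellin (σ:ℂ) (by simp; linarith)).1 hV hcont
  rw [hat_eq u hu] at this
  rw [← this, mellinInv, Complex.real_smul]
  simp only [hm, smul_eq_mul]

lemma perron (X σ : ℝ) (hX : 0 < X) (hσ : 1 < σ) :
    HasSum (fun n : ℕ => ((ArithmeticFunction.moebius n : ℤ) : ℂ) * ((max (1 - n / X) 0 : ℝ) : ℂ))
      (((1 / (2 * Real.pi) : ℝ) : ℂ) * ∫ y : ℝ, (X:ℂ) ^ ((σ:ℂ) + y * Complex.I) * kern (σ + y * Complex.I) *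
        (riemannZeta (σ + y * Complex.I))⁻¹) := by
  have hX0 : (X:ℂ) ≠ 0 := by exact_mod_cast hX.ne'
  have hσ' : 3/4 ≤ σ := by linarith
  have hki := kern_int X σ hX hσ'
  obtain ⟨F, hF⟩ : ∃ F : ℕ → ℝ → ℂ, F = fun n (y : ℝ) => LSeries.term (fun n => ((ArithmeticFunction.moebius n : ℤ) : ℂ))
    (σ + y * Complex.I) n * ((X:ℂ) ^ ((σ:ℂ) + y * Complex.I) * kern (σ + y * Complex.I)) := ⟨_, rfl⟩
  have htn : ∀ n : ℕ, ∀ y : ℝ, ‖LSeries.term (fun n => ((ArithmeticFunction.moebius n : ℤ) : ℂ))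
      (σ + y * Complex.I) n‖ ≤ ‖LSeries.term 1 (σ:ℂ) n‖ := by
    intro n y
    refine (LSeries.norm_term_le (g := 1) _ ?_).trans ?_
    · simp only [Pi.one_apply, norm_one, Complex.norm_intCast]
      exact_mod_cast ArithmeticFunction.abs_moebius_le_one
    · apply LSeries.norm_term_le_of_re_le_re
      simp
  have htc : ∀ n : ℕ, Continuous (fun y : ℝ => LSeries.term (fun n => ((ArithmeticFunction.moebius n : ℤ) : ℂ))
      (σ + y * Complex.I) n) := by
    intro n
    simp only [LSeries.term_def]
    split_ifs with hn
    · exact continuous_const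
    · have hn0 : (n:ℂ) ≠ 0 := by exact_mod_cast hn
      refine Continuous.div continuous_const (Continuous.const_cpow (by fun_prop) (Or.inl hn0)) ?_
      intro y
      simp [Complex.cpow_eq_zero_iff, hn0]
  have hintg : ∀ n, Integrable (F n) := by
    intro n
    rw [hF]
    exact hki.bdd_mul (htc n).aestronglyMeasurable (Filter.Eventually.of_forall (htn n))
  have hs1 : Summable (fun n => ‖LSeries.term 1 (σ:ℂ) n‖) :=
    (LSeriesSummable_one_iff.2 (by simpa using hσ)).norm
  have hsum : Summable (fun n => ∫ y, ‖F n y‖) := by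
    refine Summable.of_nonneg_of_le (fun n => integral_nonneg fun _ => norm_nonneg _) (fun n => ?_)
      (hs1.mul_right (∫ y : ℝ, ‖(X:ℂ) ^ ((σ:ℂ) + y * Complex.I) * kern (σ + y * Complex.I)‖))
    rw [← integral_const_mul]
    refine integral_mono (hintg n).norm (hki.norm.const_mul _) fun y => ?_
    rw [hF]
    simp only [norm_mul _ ((X:ℂ) ^ ((σ:ℂ) + y * Complex.I) * kern (σ + y * Complex.I))]
    exact mul_le_mul_of_nonneg_right (htn n y) (norm_nonneg _)
  have hh := (hasSum_integral_of_summable_integral_norm hintg hsum).mul_left ((1 / (2 * Real.pi) : ℝ) : ℂ)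
  have e1 : ∀ y : ℝ, ∑' n, F n y = (X:ℂ) ^ ((σ:ℂ) + y * Complex.I) * kern (σ + y * Complex.I) *
        (riemannZeta (σ + y * Complex.I))⁻¹ := by
    intro y
    rw [zeta_inv_eq _ (by simpa using hσ), LSeries, hF, tsum_mul_right, mul_comm]
  have e2 : ∀ n : ℕ, ((1 / (2 * Real.pi) : ℝ) : ℂ) * ∫ y, F n y =
      ((ArithmeticFunction.moebius n : ℤ) : ℂ) * ((max (1 - n / X) 0 : ℝ) : ℂ) := by
    intro n
    rcases Nat.eq_zero_or_pos n with rfl | hn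
    · rw [hF]; simp
    have hn0 : (0:ℝ) < n := by exact_mod_cast hn
    have hnX : 0 < (n:ℝ) / X := by positivity
    rw [← hat_inv σ (n / X) hσ' hnX]
    have : ∀ y, F n y = ((ArithmeticFunction.moebius n : ℤ) : ℂ) *
        (((n / X : ℝ):ℂ) ^ (-((σ:ℂ) + y * Complex.I)) * kern (σ + y * Complex.I)) := by
      intro y
      rw [hF]
      simp only [LSeries.term_def, hn.ne', if_false]
      have hc : (n:ℂ) ^ ((σ:ℂ) + y * Complex.I) = ((n / X : ℝ):ℂ) ^ ((σ:ℂ) + y * Complex.I) * (X:ℂ) ^ ((σ:ℂ) + y * Complex.I) := by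
        rw [← Complex.mul_cpow_ofReal_nonneg hnX.le hX.le]
        congr 1
        push_cast
        field_simp
      have hX1 : (X:ℂ) ^ ((σ:ℂ) + y * Complex.I) ≠ 0 := by simp [Complex.cpow_eq_zero_iff, hX0]
      have hc1 : ((n / X : ℝ):ℂ) ^ ((σ:ℂ) + y * Complex.I) ≠ 0 := by
        have : ((n / X : ℝ):ℂ) ≠ 0 := by exact_mod_cast hnX.ne'
        intro h
        rw [Complex.cpow_eq_zero_iff] at h
        exact this h.1
      rw [hc, Complex.cpow_neg]
      field_simp
    simp only [this]
    rw [integral_const_mul]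
    ring
  simp only [e1, e2] at hh
  exact hh

end Wz
end

section
open Finset
namespace Wz
open MeasureTheory

lemma line_tail (h : ℝ → ℂ) (T D : ℝ) (hT : 0 < T) (hD : 0 ≤ D) (hi : Integrable h)
    (hb : ∀ y, ‖h y‖ ≤ D * (1 + y ^ 2)⁻¹) : ‖∫ y, h y‖ ≤ ‖∫ y in (-T)..T, h y‖ + D * (2 / T) := by
  have hTT : -T ≤ T := by linarith
  rw [intervalIntegral.integral_of_le hTT, ← integral_add_compl (measurableSet_Ioc (a := -T) (b := T)) hi]
  refine (norm_add_le _ _).trans (by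
    gcongr
    have hg : Integrable (fun y : ℝ => D * (1 + y ^ 2)⁻¹) := integrable_inv_one_add_sq.const_mul D
    have h1 : ‖∫ y in (Set.Ioc (-T) T)ᶜ, h y‖ ≤ ∫ y in (Set.Ioc (-T) T)ᶜ, D * (1 + y ^ 2)⁻¹ :=
      norm_integral_le_of_norm_le hg.integrableOn (Filter.Eventually.of_forall hb)
    refine h1.trans ?_
    have h2 := integral_add_compl (measurableSet_Ioc (a := -T) (b := T)) integrable_inv_one_add_sq
    rw [← intervalIntegral.integral_of_le hTT, integral_inv_one_add_sq, integral_univ_inv_one_add_sq, Real.arctan_neg] at h2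
    rw [integral_const_mul]
    refine mul_le_mul_of_nonneg_left ?_ hD
    have h3 := Real.arctan_inv_of_pos hT
    have h4 : Real.arctan T⁻¹ ≤ T⁻¹ := by
      have := Real.le_tan (x := Real.arctan T⁻¹) (Real.arctan_nonneg.2 (by positivity)) (Real.arctan_lt_pi_div_two _)
      rwa [Real.tan_arctan] at this
    have h5 : 2 / T = 2 * T⁻¹ := by ring
    rw [h5]
    linarith)

lemma rect_bound (H : ℂ → ℂ) (a b T A B : ℝ) (hab : a ≤ b) (hba : b ≤ a + 2) (hT : 0 < T) (hA : 0 ≤ A) (hB : 0 ≤ B)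
    (hd : ∀ σ t : ℝ, a ≤ σ → σ ≤ b → |t| ≤ T → DifferentiableAt ℂ H (σ + t * Complex.I))
    (h1 : ∀ t : ℝ, |t| ≤ T → ‖H (a + t * Complex.I)‖ ≤ A * (1 + t ^ 2)⁻¹)
    (h2 : ∀ σ t : ℝ, a ≤ σ → σ ≤ b → |t| = T → ‖H (σ + t * Complex.I)‖ ≤ B) :
    ‖∫ y in (-T)..T, H (b + y * Complex.I)‖ ≤ A * 4 + 4 * B := by
  have hTT : -T ≤ T := by linarith
  have hrect := Complex.integral_boundary_rect_eq_zero_of_differentiableOn H (a + (-T : ℝ) * Complex.I) (b + T * Complex.I) (by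
    intro z hz
    simp only [Complex.mem_reProdIm] at hz
    simp at hz
    rw [Set.uIcc_of_le hab, Set.uIcc_of_le hTT] at hz
    have := hd z.re z.im hz.1.1 hz.1.2 (abs_le.2 hz.2)
    rw [Complex.re_add_im] at this
    exact this.differentiableWithinAt)
  simp only [Complex.add_re, Complex.ofReal_re, Complex.mul_re, Complex.I_re, mul_zero, Complex.ofReal_im,
      Complex.I_im, mul_one, sub_self, add_zero, Complex.add_im, Complex.mul_im, zero_add] at hrect
  have e : Complex.I * (∫ y in (-T)..T, H (b + y * Complex.I)) =
      Complex.I * (∫ y in (-T)..T, H (a + y * Complex.I)) + (∫ x in a..b, H (x + T * Complex.I)) -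
      ∫ x in a..b, H (x + (-T : ℝ) * Complex.I) := by
    simp only [smul_eq_mul] at hrect
    linear_combination hrect
  have hn : ‖∫ y in (-T)..T, H (b + y * Complex.I)‖ = ‖Complex.I * (∫ y in (-T)..T, H (b + y * Complex.I))‖ := by
    rw [norm_mul, Complex.norm_I, one_mul]
  rw [hn, e]
  have n1 : ‖∫ y in (-T)..T, H (a + y * Complex.I)‖ ≤ A * 4 := by
    have := intervalIntegral.norm_integral_le_of_norm_le (a := -T) (b := T) (μ := volume)
      (f := fun y : ℝ => H (a + y * Complex.I)) (g := fun y => A * (1 + y ^ 2)⁻¹) hTT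
      (Filter.Eventually.of_forall fun t ht => h1 t (abs_le.2 ⟨ht.1.le, ht.2⟩))
      ((integrable_inv_one_add_sq.const_mul A).intervalIntegrable)
    refine this.trans ?_
    rw [intervalIntegral.integral_const_mul]
    refine mul_le_mul_of_nonneg_left ?_ hA
    rw [integral_inv_one_add_sq, Real.arctan_neg]
    have := Real.arctan_lt_pi_div_two T
    have := Real.pi_lt_four
    linarith
  have n2 : ∀ t : ℝ, |t| = T → ‖∫ x in a..b, H (x + t * Complex.I)‖ ≤ 2 * B := by
    intro t ht
    have := intervalIntegral.norm_integral_le_of_norm_le_const (a := a) (b := b) (C := B)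
      (f := fun x : ℝ => H (x + t * Complex.I)) (by
        intro x hx
        rw [Set.uIoc_of_le hab] at hx
        exact h2 x t hx.1.le hx.2 ht)
    refine this.trans ?_
    rw [abs_of_nonneg (by linarith)]
    nlinarith
  have n3 := n2 T (abs_of_pos hT)
  have n4 := n2 (-T) (by rw [abs_neg, abs_of_pos hT])
  refine (norm_sub_le _ _).trans ?_
  have := norm_add_le (Complex.I * (∫ y in (-T)..T, H (a + y * Complex.I))) (∫ x in a..b, H (x + T * Complex.I))
  rw [norm_mul, Complex.norm_I, one_mul] at this
  linarith

set_option maxHeartbeats 1000000 in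
lemma F_bound : ∃ c T0 C : ℝ, 0 < c ∧ 16 ≤ T0 ∧ 0 < C ∧ ∀ T X : ℝ, T0 ≤ T → 3 ≤ X →
    ‖∑' n : ℕ, ((ArithmeticFunction.moebius n : ℤ) : ℂ) * ((max (1 - n / X) 0 : ℝ) : ℂ)‖ ≤
    C * Real.log T ^ 8 * X * (Real.exp (-(c * wdt T * Real.log X)) + Real.log X / T) := by
  obtain ⟨c, T0, hc, hT0, hinv⟩ := inv_bound
  obtain ⟨C2, hC2, hz⟩ := zeta_inv_bound
  refine ⟨c, T0, 100 * C2, hc, hT0, by positivity, fun T X hT hX => ?_⟩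
  obtain ⟨hw, hQ⟩ := hinv T hT
  have hT16 : 16 ≤ T := hT0.trans hT
  have hw0 : 0 < c * wdt T := mul_pos hc (wdt_pos T hT16)
  have hX0 : 0 < X := by linarith
  have hXc : (X:ℂ) ≠ 0 := by exact_mod_cast hX0.ne'
  obtain ⟨l, hl⟩ : ∃ l, l = Real.log T := ⟨_, rfl⟩
  have hl2 : 2 ≤ l := by rw [hl]; exact (loglog16 T hT16).1
  obtain ⟨x, hx⟩ : ∃ x, x = Real.log X := ⟨_, rfl⟩
  have hx1 : 1 ≤ x := by
    rw [hx, Real.le_log_iff_exp_le hX0]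
    exact Real.exp_one_lt_d9.le.trans (by linarith)
  rw [← hl] at hQ ⊢
  rw [← hx]
  obtain ⟨a, ha⟩ : ∃ a, a = 1 - c * wdt T := ⟨_, rfl⟩
  obtain ⟨b, hb⟩ : ∃ b : ℝ, b = 1 + 1 / x := ⟨_, rfl⟩
  rw [← ha] at hQ
  have hx' : 1 / x ≤ 1 := by rw [div_le_one (by linarith)]; exact hx1
  have hx'' : 0 < 1 / x := by positivity
  have ha34 : 3/4 ≤ a := by linarith
  have hb1 : 1 < b := by linarith
  have hXn : ∀ σ t : ℝ, ‖(X:ℂ) ^ ((σ:ℂ) + t * Complex.I)‖ = X ^ σ := by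
    intro σ t
    rw [Complex.norm_cpow_eq_rpow_re_of_pos hX0]; simp
  have hXb : X ^ b ≤ 3 * X := by
    have e1 : X ^ b = X * Real.exp 1 := by
      rw [hb, Real.rpow_add hX0, Real.rpow_one, Real.rpow_def_of_pos hX0, ← hx]
      congr 2
      field_simp
    rw [e1]
    have := Real.exp_one_lt_d9
    nlinarith
  have hXa : X ^ a = X * Real.exp (-(c * wdt T * x)) := by
    rw [ha, sub_eq_add_neg, Real.rpow_add hX0, Real.rpow_one, Real.rpow_def_of_pos hX0, ← hx]
    congr 2; ring
  obtain ⟨Q, hQd⟩ : ∃ Q : ℂ → ℂ, Q = fun s => (s - 1) / riemannZeta₁ s := ⟨_, rfl⟩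
  obtain ⟨H, hH⟩ : ∃ H : ℂ → ℂ, H = fun s => (X:ℂ) ^ s * kern s * Q s := ⟨_, rfl⟩
  have hQz : ∀ y : ℝ, (riemannZeta (b + y * Complex.I))⁻¹ = Q (b + y * Complex.I) := by
    intro y
    have hs1 : (b:ℂ) + y * Complex.I ≠ 1 := by
      intro h
      have := congrArg Complex.re h
      simp at this; linarith
    rw [hQd]; simp only
    rw [zeta1_mul _ hs1, div_mul_eq_div_div, div_self (sub_ne_zero.2 hs1), one_div]
  have hp := perron X b hX0 hb1
  rw [hp.tsum_eq]
  have hQb : ∀ y : ℝ, ‖Q (b + y * Complex.I)‖ ≤ C2 * x := by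
    intro y
    rw [← hQz]
    refine (hz b y hb1 (by linarith)).trans (le_of_eq ?_)
    rw [hb, add_sub_cancel_left]; field_simp
  have hintg : Integrable (fun y : ℝ => H (b + y * Complex.I)) := by
    have h1 := kern_int X b hX0 (by linarith)
    have h2 : Continuous (fun y : ℝ => Q (b + y * Complex.I)) := by
      rw [hQd]
      refine Continuous.div (by fun_prop) (differentiable_riemannZeta₁.continuous.comp (by fun_prop)) ?_
      intro y
      exact zeta1_ne_zero _ (by simp; linarith)
    rw [hH]
    exact h1.mul_bdd h2.aestronglyMeasurable (Filter.Eventually.of_forall hQb)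
  have eI : ∫ y : ℝ, (X:ℂ) ^ ((b:ℂ) + y * Complex.I) * kern (b + y * Complex.I) *
        (riemannZeta (b + y * Complex.I))⁻¹ = ∫ y : ℝ, H (b + y * Complex.I) := by
    rw [hH]; simp only [hQz]
  rw [eI]
  have hHb : ∀ y : ℝ, ‖H (b + y * Complex.I)‖ ≤ (6 * X * C2 * x) * (1 + y ^ 2)⁻¹ := by
    intro y
    rw [hH]; simp only
    rw [norm_mul, norm_mul, hXn]
    calc X ^ b * ‖kern (b + y * Complex.I)‖ * ‖Q (b + y * Complex.I)‖ ≤ (3 * X) * (2 * (1 + y ^ 2)⁻¹) * (C2 * x) := by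
          have := kern_norm b y (by linarith)
          have := hQb y
          gcongr
      _ = _ := by ring
  have s1 := line_tail _ T _ (by linarith) (by positivity) hintg hHb
  have hHr : ∀ σ t : ℝ, a ≤ σ → σ ≤ b → |t| ≤ T → ‖H (σ + t * Complex.I)‖ ≤ X ^ σ * (2 * (1 + t ^ 2)⁻¹) * l ^ 8 := by
    intro σ t h1 h2 h3
    rw [hH]; simp only
    rw [norm_mul, norm_mul, hXn]
    have e1 := kern_norm σ t (by linarith)
    have e2 := (hQ σ t h3 h1 (by linarith)).2
    rw [hQd]
    gcongr
  have s2 := rect_bound H a b T (2 * X ^ a * l ^ 8) (6 * X * l ^ 8 / T) (by linarith) (by linarith) (by linarith)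
    (by positivity) (by positivity) (by
      intro σ t h1 h2 h3
      have e2 := (hQ σ t h3 h1 (by linarith)).1
      rw [hH, hQd]
      refine DifferentiableAt.mul (DifferentiableAt.mul ?_ ?_) (DifferentiableAt.div (by fun_prop) (differentiable_riemannZeta₁ _) e2)
      · exact DifferentiableAt.const_cpow differentiableAt_id (Or.inl hXc)
      · unfold kern
        refine DifferentiableAt.sub (DifferentiableAt.div (by fun_prop) (by fun_prop) ?_)
          (DifferentiableAt.div (by fun_prop) (by fun_prop) ?_)
        · intro h
          have := congrArg Complex.re h
          simp at this; linarith
        · intro h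
          have := congrArg Complex.re h
          simp at this; linarith)
    (by
      intro t ht
      refine (hHr a t le_rfl (by linarith) ht).trans (le_of_eq (by ring)))
    (by
      intro σ t h1 h2 ht
      refine (hHr σ t h1 h2 ht.le).trans ?_
      have e1 : X ^ σ ≤ 3 * X := (Real.rpow_le_rpow_of_exponent_le (by linarith) h2).trans hXb
      have e2 : (1 + t ^ 2)⁻¹ ≤ 1 / T := by
        rw [← sq_abs, ht, ← one_div]
        apply one_div_le_one_div_of_le (by linarith)
        nlinarith
      calc X ^ σ * (2 * (1 + t ^ 2)⁻¹) * l ^ 8 ≤ (3 * X) * (2 * (1 / T)) * l ^ 8 := by gcongr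
        _ = _ := by ring)
  rw [norm_mul, Complex.norm_real, Real.norm_of_nonneg (by positivity)]
  have hpi : 1 / (2 * Real.pi) ≤ 1 := by
    rw [div_le_one (by positivity)]
    have := Real.pi_gt_three
    linarith
  have hl8 : 1 ≤ l ^ 8 := one_le_pow₀ (by linarith)
  calc 1 / (2 * Real.pi) * ‖∫ y : ℝ, H (b + y * Complex.I)‖ ≤ 1 * ‖∫ y : ℝ, H (b + y * Complex.I)‖ := by gcongr
    _ ≤ 2 * X ^ a * l ^ 8 * 4 + 4 * (6 * X * l ^ 8 / T) + 6 * X * C2 * x * (2 / T) := by linarith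
    _ = (8 * l ^ 8 * X) * Real.exp (-(c * wdt T * x)) + (24 * X * (1 * l ^ 8 * 1)  + 12 * X * (C2 * 1 * x)) / T := by
        rw [hXa]; ring
    _ ≤ (100 * C2 * l ^ 8 * X) * Real.exp (-(c * wdt T * x)) + (24 * X * (C2 * l ^ 8 * x)  + 12 * X * (C2 * l ^ 8 * x)) / T := by
        gcongr
        linarith
    _ ≤ (100 * C2 * l ^ 8 * X) * Real.exp (-(c * wdt T * x)) + (100 * X * (C2 * l ^ 8 * x)) / T := by
        gcongr
        have : 0 ≤ X * (C2 * l ^ 8 * x) := by positivity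
        linarith
    _ = _ := by ring

end Wz
end

section
open Finset
namespace Wz

lemma S_finite (X : ℝ) (hX : 0 < X) (N : ℕ) (hN : X < N + 1) :
    ∑' n : ℕ, ((ArithmeticFunction.moebius n : ℤ) : ℂ) * ((max (1 - n / X) 0 : ℝ) : ℂ)
      = ((∑ n ∈ Finset.Icc 1 N, (ArithmeticFunction.moebius n : ℝ) * max (1 - n / X) 0 : ℝ) : ℂ) := by
  rw [tsum_eq_sum (s := Finset.Icc 1 N)]
  · push_cast
    rfl
  · intro n hn
    rw [Finset.mem_Icc, not_and_or] at hn
    rcases hn with hn | hn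
    · have : n = 0 := by omega
      subst this
      simp
    · have h1 : (N : ℝ) + 1 ≤ n := by exact_mod_cast (by omega : N + 1 ≤ n)
      have h2 : 1 - (n : ℝ) / X ≤ 0 := by
        rw [sub_nonpos, le_div_iff₀ hX]; linarith
      rw [max_eq_right h2]; simp

lemma moebius_abs (n : ℕ) : |(ArithmeticFunction.moebius n : ℝ)| ≤ 1 := by
  exact_mod_cast ArithmeticFunction.abs_moebius_le_one (n := n)

lemma desmooth (x h B : ℝ) (hx : 1 ≤ x) (hh : 0 < h)
    (hB : ∀ X ∈ ({x, x + h} : Set ℝ),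
      ‖∑' n : ℕ, ((ArithmeticFunction.moebius n : ℤ) : ℂ) * ((max (1 - n / X) 0 : ℝ) : ℂ)‖ * X ≤ B) :
    |∑ n ∈ Finset.Icc 1 ⌊x⌋₊, (ArithmeticFunction.moebius n : ℝ)| ≤ 2 * B / h + h + 1 := by
  set m := ⌊x⌋₊ with hm
  set N := ⌊x + h⌋₊ with hN
  have hmN : m ≤ N := Nat.floor_mono (by linarith)
  have hNlt : x + h < N + 1 := Nat.lt_floor_add_one _
  have hmlt : x < m + 1 := Nat.lt_floor_add_one _
  have hmle : (m : ℝ) ≤ x := Nat.floor_le (by linarith)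
  have hNle : (N : ℝ) ≤ x + h := Nat.floor_le (by linarith)
  have hG : ∀ X ∈ ({x, x + h} : Set ℝ),
      |∑ n ∈ Finset.Icc 1 N, (ArithmeticFunction.moebius n : ℝ) * max (X - n) 0| ≤ B := by
    intro X hX
    have h0 := hB X hX
    have hX1 : 0 < X := by rcases hX with rfl | rfl <;> linarith
    have hX2 : X < N + 1 := by rcases hX with rfl | rfl <;> linarith
    rw [S_finite X hX1 N hX2, Complex.norm_real, Real.norm_eq_abs] at h0
    refine le_trans (le_of_eq ?_) h0
    rw [← abs_of_pos hX1, ← abs_mul, abs_of_pos hX1, Finset.sum_mul]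
    congr 1
    refine Finset.sum_congr rfl fun n _ => ?_
    rw [mul_assoc, max_mul_of_nonneg _ _ hX1.le, sub_mul, div_mul_cancel₀ _ hX1.ne']
    simp
  have h1 := hG x (by simp)
  have h2 := hG (x + h) (by simp)
  have hsplit : Finset.Icc 1 N = Finset.Icc 1 m ∪ Finset.Ioc m N := by
    ext n; simp only [Finset.mem_Icc, Finset.mem_union, Finset.mem_Ioc]; omega
  have hdisj : Disjoint (Finset.Icc 1 m) (Finset.Ioc m N) := by
    rw [Finset.disjoint_left]; intro n; simp only [Finset.mem_Icc, Finset.mem_Ioc]; omega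
  have key : ∑ n ∈ Finset.Icc 1 N, (ArithmeticFunction.moebius n : ℝ) * max (x + h - n) 0
      - ∑ n ∈ Finset.Icc 1 N, (ArithmeticFunction.moebius n : ℝ) * max (x - n) 0
      = h * ∑ n ∈ Finset.Icc 1 m, (ArithmeticFunction.moebius n : ℝ)
        + ∑ n ∈ Finset.Ioc m N, (ArithmeticFunction.moebius n : ℝ) * (max (x + h - n) 0 - max (x - n) 0) := by
    rw [← Finset.sum_sub_distrib, hsplit, Finset.sum_union hdisj, Finset.mul_sum]
    congr 1
    · refine Finset.sum_congr rfl fun n hn => ?_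
      have : (n : ℝ) ≤ m := by exact_mod_cast (Finset.mem_Icc.mp hn).2
      rw [max_eq_left (by linarith), max_eq_left (by linarith)]; ring
    · refine Finset.sum_congr rfl fun n hn => ?_
      ring
  have hrem : |∑ n ∈ Finset.Ioc m N, (ArithmeticFunction.moebius n : ℝ) * (max (x + h - n) 0 - max (x - n) 0)|
      ≤ (h + 1) * h := by
    calc _ ≤ ∑ n ∈ Finset.Ioc m N, |(ArithmeticFunction.moebius n : ℝ) * (max (x + h - n) 0 - max (x - n) 0)| :=
          Finset.abs_sum_le_sum_abs _ _
      _ ≤ ∑ n ∈ Finset.Ioc m N, h := by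
          refine Finset.sum_le_sum fun n hn => ?_
          rw [abs_mul]
          have ha := moebius_abs n
          have hb : |max (x + h - n) 0 - max (x - n) 0| ≤ h := by
            refine (abs_max_sub_max_le_abs _ _ _).trans ?_
            rw [show x + h - n - (x - n) = h by ring, abs_of_pos hh]
          calc _ ≤ 1 * h := mul_le_mul ha hb (abs_nonneg _) zero_le_one
            _ = h := one_mul h
      _ = (N - m : ℕ) * h := by simp
      _ ≤ (h + 1) * h := by
          refine mul_le_mul_of_nonneg_right ?_ hh.le
          rw [Nat.cast_sub hmN]; linarith
  have h3 : h * |∑ n ∈ Finset.Icc 1 m, (ArithmeticFunction.moebius n : ℝ)| ≤ 2 * B + (h + 1) * h := by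
    rw [← abs_of_pos hh, ← abs_mul, abs_of_pos hh]
    rw [abs_le] at *
    constructor <;> linarith [h1.1, h1.2, h2.1, h2.2, hrem.1, hrem.2]
  have h4 : 2 * B / h + h + 1 = (2 * B + (h + 1) * h) / h := by field_simp; ring
  rw [h4, le_div_iff₀ hh]; linarith

/-- Parameter facts for large `L`. -/
lemma u_facts (L : ℝ) (hL : Real.exp 1 ≤ L) (hlL : Real.log L ≤ L ^ (1/2 : ℝ)) (u : ℝ)
    (hu : u = L ^ ((3:ℝ)/5) * Real.log L ^ (-(1:ℝ)/5)) :
    u ≤ L ∧ L ≤ u ^ 2 ∧ (1 < u → u ≤ u ^ (-(2/3) : ℝ) * Real.log u ^ (-(1/3) : ℝ) * L) := by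
  have he := Real.add_one_le_exp (1:ℝ)
  have hL1 : 1 ≤ L := by linarith
  have hL0 : 0 < L := by linarith
  have hl : 1 ≤ Real.log L := by rwa [Real.le_log_iff_exp_le hL0]
  have hl0 : 0 < Real.log L := by linarith
  obtain ⟨l, hldef⟩ : ∃ l, l = Real.log L := ⟨_, rfl⟩
  rw [← hldef] at hlL hu hl hl0
  have hu0 : 0 < u := by rw [hu]; positivity
  have huL : u ≤ L := by
    rw [hu]
    calc L ^ ((3:ℝ)/5) * l ^ (-(1:ℝ)/5) ≤ L ^ (1:ℝ) * 1 := by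
          refine mul_le_mul (Real.rpow_le_rpow_of_exponent_le hL1 (by norm_num)) ?_ (by positivity) (by positivity)
          exact Real.rpow_le_one_of_one_le_of_nonpos hl (by norm_num)
      _ = L := by simp
  refine ⟨huL, ?_, ?_⟩
  · have h1 : u ^ 2 = L ^ ((6:ℝ)/5) * l ^ (-(2:ℝ)/5) := by
      rw [hu, mul_pow, ← Real.rpow_natCast, ← Real.rpow_natCast, ← Real.rpow_mul hL0.le, ← Real.rpow_mul hl0.le]
      norm_num
    have h2 : (L ^ (1/2:ℝ)) ^ (-(2:ℝ)/5) ≤ l ^ (-(2:ℝ)/5) :=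
      Real.rpow_le_rpow_of_nonpos hl0 hlL (by norm_num)
    rw [h1]
    calc L = L ^ ((6:ℝ)/5) * (L ^ (1/2:ℝ)) ^ (-(2:ℝ)/5) := by
          rw [← Real.rpow_mul hL0.le, ← Real.rpow_add hL0]; norm_num
      _ ≤ _ := mul_le_mul_of_nonneg_left h2 (by positivity)
  · intro hu1
    have hlu0 : 0 < Real.log u := Real.log_pos hu1
    have hlu : Real.log u ≤ l := by rw [hldef]; exact Real.log_le_log hu0 huL
    have h2 : l ^ (-(1/3) : ℝ) ≤ Real.log u ^ (-(1/3) : ℝ) :=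
      Real.rpow_le_rpow_of_nonpos hlu0 hlu (by norm_num)
    have h3 : u ^ (5/3:ℝ) = L * l ^ (-(1/3) : ℝ) := by
      rw [hu, Real.mul_rpow (by positivity) (by positivity), ← Real.rpow_mul hL0.le, ← Real.rpow_mul hl0.le]
      norm_num
    calc u = u ^ (-(2/3) : ℝ) * u ^ (5/3:ℝ) := by
          rw [← Real.rpow_add hu0]; norm_num
      _ = u ^ (-(2/3) : ℝ) * l ^ (-(1/3) : ℝ) * L := by rw [h3]; ring
      _ ≤ _ := by gcongr

lemma eventually_params (C c T0 : ℝ) (hc : 0 < c) :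
    ∃ x0 : ℝ, 16 ≤ x0 ∧ ∀ x : ℝ, x0 ≤ x → ∀ u : ℝ,
      u = Real.log x ^ ((3:ℝ)/5) * Real.log (Real.log x) ^ (-(1:ℝ)/5) →
      T0 ≤ Real.exp u ∧ 1 < u ∧ u ≤ Real.log x ∧ Real.log x ≤ u ^ 2 ∧
      u ≤ u ^ (-(2/3) : ℝ) * Real.log u ^ (-(1/3) : ℝ) * Real.log x ∧
      6 * C * u ^ 10 ≤ Real.exp (c * u / 2) := by
  open Filter in
  have e1 : ∀ᶠ u : ℝ in atTop, T0 ≤ Real.exp u := Real.tendsto_exp_atTop.eventually_ge_atTop T0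
  have e2 : ∀ᶠ u : ℝ in Filter.atTop, 6 * C * u ^ 10 ≤ Real.exp (c * u / 2) := by
    have h := (isLittleO_pow_exp_pos_mul_atTop 10 (b := c / 2) (by positivity)).const_mul_left (6 * C)
    have h' := h.bound (show (0:ℝ) < 1 by norm_num)
    filter_upwards [h'] with u hu
    rw [one_mul, Real.norm_eq_abs, Real.norm_eq_abs, abs_of_pos (Real.exp_pos _)] at hu
    rw [show c * u / 2 = c / 2 * u by ring]
    exact (le_abs_self _).trans hu
  obtain ⟨u0, hu0⟩ := Filter.eventually_atTop.mp (e1.and e2)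
  have e3 : ∀ᶠ L : ℝ in Filter.atTop, Real.log L ≤ L ^ (1/2:ℝ) := by
    have h := (isLittleO_log_rpow_atTop (r := 1/2) (by norm_num)).bound (show (0:ℝ) < 1 by norm_num)
    filter_upwards [h, Filter.eventually_ge_atTop 0] with L hL h0
    rw [one_mul, Real.norm_eq_abs, Real.norm_eq_abs, abs_of_nonneg (Real.rpow_nonneg h0 _)] at hL
    exact (le_abs_self _).trans hL
  have e4 : ∀ᶠ x : ℝ in Filter.atTop, Real.log (Real.log x) ≤ Real.log x ^ (1/2:ℝ) ∧
      Real.exp 1 ≤ Real.log x ∧ (max u0 1 + 1) ^ 2 ≤ Real.log x ∧ 16 ≤ x := by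
    refine (Real.tendsto_log_atTop.eventually e3).and ?_
    refine (Real.tendsto_log_atTop.eventually_ge_atTop _).and ?_
    exact (Real.tendsto_log_atTop.eventually_ge_atTop _).and (Filter.eventually_ge_atTop 16)
  obtain ⟨x1, hx1⟩ := Filter.eventually_atTop.mp e4
  refine ⟨max x1 16, le_max_right _ _, fun x hx u hu => ?_⟩
  obtain ⟨ha, hb, hc1, -⟩ := hx1 x ((le_max_left _ _).trans hx)
  obtain ⟨f1, f2, f3⟩ := u_facts (Real.log x) hb ha u hu
  have hupos : 0 ≤ u := by
    have h1 : 1 ≤ Real.log x := by linarith [Real.add_one_le_exp (1:ℝ)]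
    have h2 := Real.log_nonneg h1
    rw [hu]; positivity
  have hm : max u0 1 + 1 ≤ u := by
    refine le_of_sq_le_sq ?_ hupos
    linarith
  have hu1 : 1 < u := by linarith [le_max_right u0 1]
  obtain ⟨g1, g2⟩ := hu0 u (by linarith [le_max_left u0 1])
  exact ⟨g1, hu1, f1, f2, f3 hu1, g2⟩

lemma large_bound : ∃ c x0 : ℝ, 0 < c ∧ 16 ≤ x0 ∧ ∀ x : ℝ, x0 ≤ x →
    |∑ n ∈ Finset.Icc 1 ⌊x⌋₊, (ArithmeticFunction.moebius n : ℝ)| ≤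
      6 * x * Real.exp (-(c * (Real.log x ^ ((3:ℝ)/5) * Real.log (Real.log x) ^ (-(1:ℝ)/5)))) := by
  obtain ⟨c0, T0, C, hc0, hT0, hC, hF⟩ := F_bound
  obtain ⟨c, hcdef⟩ : ∃ c, c = min c0 1 := ⟨_, rfl⟩
  have hc : 0 < c := by rw [hcdef]; exact lt_min hc0 one_pos
  have hcc0 : c ≤ c0 := by rw [hcdef]; exact min_le_left _ _
  have hc1 : c ≤ 1 := by rw [hcdef]; exact min_le_right _ _
  obtain ⟨x0, hx0, hx⟩ := eventually_params C c T0 hc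
  refine ⟨c / 4, x0, by positivity, hx0, fun x hxx => ?_⟩
  obtain ⟨u, hu⟩ : ∃ u, u = Real.log x ^ ((3:ℝ)/5) * Real.log (Real.log x) ^ (-(1:ℝ)/5) := ⟨_, rfl⟩
  rw [← hu]
  obtain ⟨h1, h2, h3, h4, h5, h6⟩ := hx x hxx u hu
  have hx16 : 16 ≤ x := by linarith
  have hxp : 0 < x := by linarith
  have hE : 0 < Real.exp (-(c / 4 * u)) := Real.exp_pos _
  have hEle : Real.exp (-(c / 4 * u)) ≤ 1 := by
    rw [Real.exp_le_one_iff]; nlinarith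
  obtain ⟨h, hh⟩ : ∃ h, h = x * Real.exp (-(c / 4 * u)) := ⟨_, rfl⟩
  have hhp : 0 < h := by rw [hh]; positivity
  have hhx : h ≤ x := by rw [hh]; nlinarith
  have hh1 : 1 ≤ h := by
    rw [hh]
    nth_rewrite 1 [← Real.exp_log hxp]
    rw [← Real.exp_add, Real.one_le_exp_iff]; nlinarith
  have hwdt : wdt (Real.exp u) = u ^ (-(2/3) : ℝ) * Real.log u ^ (-(1/3) : ℝ) := by
    unfold wdt; rw [Real.log_exp]
  have hw0 : 0 ≤ wdt (Real.exp u) := by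
    rw [hwdt]; have := Real.log_pos h2; positivity
  rw [← hwdt] at h5
  have hL1 : 1 ≤ Real.log x := by linarith
  have hS : ∀ X : ℝ, x ≤ X → X ≤ 2 * x →
      ‖∑' n : ℕ, ((ArithmeticFunction.moebius n : ℤ) : ℂ) * ((max (1 - n / X) 0 : ℝ) : ℂ)‖ * X
        ≤ 2 * x * (x * Real.exp (-(c * u / 2))) := by
    intro X hX1 hX2
    have hXp : 0 < X := by linarith
    have hb := hF (Real.exp u) X h1 (by linarith)
    have hlX : Real.log x ≤ Real.log X := Real.log_le_log hxp hX1
    have hlX2 : Real.log X ≤ 2 * Real.log x := by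
      have := Real.log_le_log hXp (show X ≤ x * x by nlinarith)
      rw [Real.log_mul hxp.ne' hxp.ne'] at this; linarith
    have e1 : Real.exp (-(c0 * wdt (Real.exp u) * Real.log X)) ≤ Real.exp (-(c * u)) := by
      rw [Real.exp_le_exp, neg_le_neg_iff]
      calc c * u ≤ c0 * (wdt (Real.exp u) * Real.log X) := by
            refine mul_le_mul hcc0 ?_ (by linarith) hc0.le
            exact h5.trans (mul_le_mul_of_nonneg_left hlX hw0)
        _ = _ := by ring
    have e2 : Real.log X / Real.exp u ≤ 2 * Real.log x * Real.exp (-(c * u)) := by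
      rw [div_eq_mul_inv, ← Real.exp_neg]
      refine mul_le_mul hlX2 ?_ (Real.exp_pos _).le (by linarith)
      rw [Real.exp_le_exp]; nlinarith
    have e3 : Real.exp (-(c0 * wdt (Real.exp u) * Real.log X)) + Real.log X / Real.exp u
        ≤ 3 * u ^ 2 * Real.exp (-(c * u)) := by
      have := Real.exp_pos (-(c * u))
      nlinarith
    have e4 : C * Real.log (Real.exp u) ^ 8 * X *
        (Real.exp (-(c0 * wdt (Real.exp u) * Real.log X)) + Real.log X / Real.exp u)
        ≤ x * Real.exp (-(c * u / 2)) := by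
      rw [Real.log_exp]
      calc _ ≤ C * u ^ 8 * (2 * x) * (3 * u ^ 2 * Real.exp (-(c * u))) := by
            have hlX0 : 0 ≤ Real.log X := by linarith
            gcongr
        _ = 6 * C * u ^ 10 * (x * Real.exp (-(c * u))) := by ring
        _ ≤ Real.exp (c * u / 2) * (x * Real.exp (-(c * u))) :=
            mul_le_mul_of_nonneg_right h6 (by positivity)
        _ = x * (Real.exp (c * u / 2) * Real.exp (-(c * u))) := by ring
        _ = _ := by rw [← Real.exp_add]; congr 2; ring
    calc _ ≤ (x * Real.exp (-(c * u / 2))) * (2 * x) :=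
          mul_le_mul (hb.trans e4) hX2 hXp.le (by positivity)
      _ = _ := by ring
  have hd := desmooth x h (2 * x * (x * Real.exp (-(c * u / 2)))) (by linarith) hhp (by
    intro X hX
    rcases hX with rfl | rfl
    · exact hS _ le_rfl (by linarith)
    · exact hS _ (by linarith) (by linarith))
  have hq : 2 * (2 * x * (x * Real.exp (-(c * u / 2)))) / h = 4 * h := by
    rw [div_eq_iff hhp.ne', hh]
    have : Real.exp (-(c * u / 2)) = Real.exp (-(c / 4 * u)) * Real.exp (-(c / 4 * u)) := by
      rw [← Real.exp_add]; congr 1; ring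
    rw [this]; ring
  rw [hq] at hd
  calc _ ≤ 4 * h + h + 1 := hd
    _ ≤ 6 * h := by linarith
    _ = _ := by rw [hh]; ring

lemma all_bound : ∃ c K : ℝ, 0 < c ∧ 0 < K ∧ ∀ t : ℝ, 16 ≤ t →
    |∑ n ∈ Finset.Icc 1 ⌊t⌋₊, (ArithmeticFunction.moebius n : ℝ)| ≤
      K * t * Real.exp (-(c * (Real.log t ^ ((3:ℝ)/5) * Real.log (Real.log t) ^ (-(1:ℝ)/5)))) := by
  obtain ⟨c, x0, hc, hx0, hb⟩ := large_bound
  obtain ⟨U, hU⟩ : ∃ U, U = Real.log x0 ^ ((3:ℝ)/5) * Real.log 2 ^ (-(1:ℝ)/5) := ⟨_, rfl⟩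
  refine ⟨c, max 6 (Real.exp (c * U)), hc, lt_max_of_lt_left (by norm_num), fun t ht => ?_⟩
  have ht0 : 0 < t := by linarith
  rcases le_total x0 t with h | h
  · refine (hb t h).trans ?_
    gcongr
    exact le_max_left _ _
  · obtain ⟨hl2, hll⟩ := loglog16 t ht
    have hlog2 : 0 < Real.log 2 := Real.log_pos (by norm_num)
    have hu : Real.log t ^ ((3:ℝ)/5) * Real.log (Real.log t) ^ (-(1:ℝ)/5) ≤ U := by
      rw [hU]
      refine mul_le_mul (Real.rpow_le_rpow (by linarith) (Real.log_le_log ht0 h) (by norm_num)) ?_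
        (by positivity) (Real.rpow_nonneg (Real.log_nonneg (by linarith)) _)
      exact Real.rpow_le_rpow_of_nonpos hlog2 (Real.log_le_log (by norm_num) hl2) (by norm_num)
    obtain ⟨u, hudef⟩ : ∃ u, u = Real.log t ^ ((3:ℝ)/5) * Real.log (Real.log t) ^ (-(1:ℝ)/5) := ⟨_, rfl⟩
    rw [← hudef] at hu ⊢
    have htriv : |∑ n ∈ Finset.Icc 1 ⌊t⌋₊, (ArithmeticFunction.moebius n : ℝ)| ≤ t := by
      calc _ ≤ ∑ n ∈ Finset.Icc 1 ⌊t⌋₊, |(ArithmeticFunction.moebius n : ℝ)| := Finset.abs_sum_le_sum_abs _ _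
        _ ≤ ∑ n ∈ Finset.Icc 1 ⌊t⌋₊, (1:ℝ) := Finset.sum_le_sum fun n _ => moebius_abs n
        _ = (⌊t⌋₊ : ℝ) := by simp
        _ ≤ t := Nat.floor_le ht0.le
    refine htriv.trans ?_
    calc t = Real.exp (c * u) * t * Real.exp (-(c * u)) := by
          rw [Real.exp_neg]; field_simp
      _ ≤ _ := by
          gcongr
          refine le_trans ?_ (le_max_right _ _)
          gcongr

end Wz
end

/-- Walfisz's bound: `|M(t)| ≤ K·t·exp(-c·(log t)^{3/5}·(log log t)^{-1/5})` for `t ≥ 16`. -/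
theorem walfisz_mertens :
    ∃ c K : ℝ, 0 < c ∧ 0 < K ∧ ∀ t : ℝ, 16 ≤ t →
      |(mertens ⌊t⌋₊ : ℝ)| ≤
        K * t * Real.exp (-c * Real.log t ^ ((3 : ℝ) / 5)
          * Real.log (Real.log t) ^ (-(1 : ℝ) / 5)) := by
  obtain ⟨c, K, hc, hK, h⟩ := Wz.all_bound
  refine ⟨c, K, hc, hK, fun t ht => ?_⟩
  have h1 := h t ht
  have h2 : (mertens ⌊t⌋₊ : ℝ)
      = ∑ n ∈ Finset.Icc 1 ⌊t⌋₊, (ArithmeticFunction.moebius n : ℝ) := by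
    unfold mertens
    push_cast
    rfl
  rw [h2]
  refine h1.trans (le_of_eq ?_)
  congr 2
  ring
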